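/- Let S = k[x_1,…,x_{d+2}] with d ≥ 2 and R = S/(f,g) where f,g is a homogeneous S-regular sequence of degree-2 forms. Let E be a torsion-free R-module of rank e and projective dimension one with μ(E) = d+e, minimal free resolution 0 → R^d →φ R^{d+e} → E → 0 with φ consisting of linear entries, E satisfying G_d and I_1(φ) = (x_1,…,x_{d+2})R. Let A = H^0_m(S(E)) with m = (x_1,…,x_{d+2}), and let ρ be the first map in the graded strand of the bigraded Koszul complex of ℓ_1,…,ℓ_d,f,g resolving S(E)_2. Then A_0 is a principal ideal of T, and if ht I(ρ) ≥ 2 then its generator has bidegree (0, 4d). -/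

import Mathlib

/-!
STATEMENT 16: With `S`, `R = S/(f,g)`, `E`, `ψ` as in Statement 12, `A = H⁰_m(S(E))`
and `ρ` the first map in the graded strand of the Koszul complex of `ℓ_1,…,ℓ_d,f,g`
resolving `S(E)_2` (a presentation matrix of `S(E)_2` over `T`): `A_0` is a principal
ideal of `T`, and if `ht I(ρ) ≥ 2` then its generator has bidegree `(0, 4d)`.
-/

open MvPolynomial

noncomputable section

namespace Stmt16

variable (k : Type) [Field k] (d n : ℕ)

/-- `B = R ⊗_k T = k[x_1,…,x_d,y_1,…,y_n]`. -/
abbrev B := MvPolynomial (Fin d ⊕ Fin n) k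

/-- `T = k[y_1,…,y_n]`. -/
abbrev T := MvPolynomial (Fin n) k

/-- `B` is a `T`-algebra via `y_j ↦ y_j`. -/
instance : Algebra (T k n) (B k d n) :=
  ((rename Sum.inr : T k n →ₐ[k] B k d n).toRingHom).toAlgebra

/-- The bigrading weight: `bideg x_i = (1,0)`, `bideg y_j = (0,1)`. -/
def bwt : (Fin d ⊕ Fin n) → ℕ × ℕ := Sum.elim (fun _ => (1, 0)) (fun _ => (0, 1))

/-- The `x`-degree weight. -/
def wx : (Fin d ⊕ Fin n) → ℕ := Sum.elim (fun _ => 1) (fun _ => 0)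

/-- The ideal `m = (x_1,…,x_d)B`. -/
def mxB : Ideal (B k d n) := Ideal.span (Set.range fun i : Fin d => (X (Sum.inl i) : B k d n))

variable (I : Ideal (B k d n))

/-- `A = H⁰_m(S)`: elements of `S = B/I` annihilated by a power of `m`. -/
def H0 : Submodule (B k d n) (B k d n ⧸ I) :=
  ⨆ N : ℕ, Submodule.torsionBySet (B k d n) (B k d n ⧸ I)
    ((mxB k d n ^ N : Ideal (B k d n)) : Set (B k d n))

/-- The bigraded component of `S = B/I` in bidegree `p`. -/
def Scomp (p : ℕ × ℕ) : Submodule k (B k d n ⧸ I) :=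
  (weightedHomogeneousSubmodule k (bwt d n) p).map (Ideal.Quotient.mkₐ k I).toLinearMap

/-- The graded strand `S_j = ⊕_b S_{(j,b)}` of `S` in `x`-degree `j`, as a `T`-module. -/
def SxDeg (j : ℕ) : Submodule (T k n) (B k d n ⧸ I) :=
  Submodule.span (T k n) ((Ideal.Quotient.mk I) '' {g : B k d n | g.IsWeightedHomogeneous (wx d n) j})

/-- The graded strand of `S` in (possibly negative) `x`-degree `i : ℤ`. -/
def SxDegZ (i : ℤ) : Submodule (T k n) (B k d n ⧸ I) :=
  if 0 ≤ i then SxDeg k d n I i.toNat else ⊥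

/-- The graded strand `A_i = ⊕_b A_{(i,b)}` of `A = H⁰_m(S)`, as a `T`-module. -/
def AcompZ (i : ℤ) : Submodule (T k n) (B k d n ⧸ I) :=
  (H0 k d n I).restrictScalars (T k n) ⊓ SxDegZ k d n I i

/-- The graded component of `T` in (possibly negative) degree `j`. -/
def TcompZ (j : ℤ) : Submodule k (T k n) :=
  if 0 ≤ j then homogeneousSubmodule (Fin n) k j.toNat else ⊥

/-- The ideal of `t × t` minors of a matrix. -/
def minorsIdeal {R : Type} [CommRing R] {m' n' : Type} (M : Matrix m' n' R) (t : ℕ) :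
    Ideal R :=
  Ideal.span {x | ∃ (f : Fin t → m') (g : Fin t → n'), x = (M.submatrix f g).det}

/-- `ht I ≥ c`: every prime containing `I` has height (= dimension of the localization)
at least `c`. -/
def htGE {R : Type} [CommRing R] (I : Ideal R) (c : ℕ) : Prop :=
  ∀ (p : Ideal R) (_ : p.IsPrime), I ≤ p →
    (c : WithBot ℕ∞) ≤ ringKrullDim (Localization.AtPrime p)

end Stmt16

set_option linter.all false

namespace CI16
section

section Wie
variable {R R' σ : Type*} [CommRing R] [CommRing R'] [Fintype σ] [DecidableEq σ]

/-- Wiebe property. -/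
def Wie (x : σ → R) (M : Matrix σ σ R) : Prop :=
  ∀ h : R, (∀ j, h * x j ∈ Ideal.span (Set.range (M.mulVec x))) →
    h ∈ Ideal.span (Set.range (M.mulVec x)) ⊔ Ideal.span {M.det}

/-- no ideal with few generators contains `I`. -/
def HH (c : ℕ) (I : Ideal R) : Prop :=
  ∀ s : Finset R, s.card ≤ c → I ≤ Ideal.span (s : Set R) → Ideal.span (s : Set R) = ⊤

theorem span_mulVec_le {m : Type*} (P : Matrix m σ R) (v : σ → R) :
    Ideal.span (Set.range (P.mulVec v)) ≤ Ideal.span (Set.range v) := by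
  rw [Ideal.span_le]
  rintro _ ⟨i, rfl⟩
  simp only [Matrix.mulVec, dotProduct]
  exact Ideal.sum_mem _ fun j _ => Ideal.mul_mem_left _ _ (Ideal.subset_span ⟨j, rfl⟩)

theorem span_mulVec_eq (P : Matrix σ σ R) (hP : IsUnit P.det) (v : σ → R) :
    Ideal.span (Set.range (P.mulVec v)) = Ideal.span (Set.range v) := by
  refine le_antisymm (span_mulVec_le P v) ?_
  have : v = P⁻¹.mulVec (P.mulVec v) := by
    rw [Matrix.mulVec_mulVec, Matrix.nonsing_inv_mul _ hP, Matrix.one_mulVec]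
  conv_lhs => rw [this]
  exact span_mulVec_le _ _

theorem Wie.of_mul {x x' : σ → R} {M : Matrix σ σ R} (P Q : Matrix σ σ R)
    (hP : IsUnit P.det) (hQ : IsUnit Q.det) (hx : x = Q.mulVec x')
    (h : Wie x' (P * M * Q)) : Wie x M := by
  have e1 : (P * M * Q).mulVec x' = P.mulVec (M.mulVec x) := by
    rw [hx, Matrix.mulVec_mulVec, Matrix.mulVec_mulVec, Matrix.mul_assoc]
  have e2 : Ideal.span (Set.range ((P * M * Q).mulVec x')) =
      Ideal.span (Set.range (M.mulVec x)) := by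
    rw [e1, span_mulVec_eq P hP]
  have hx' : x' = Q⁻¹.mulVec x := by
    rw [hx, Matrix.mulVec_mulVec, Matrix.nonsing_inv_mul _ hQ, Matrix.one_mulVec]
  intro a ha
  have := h a (by
    intro j
    rw [e2, hx']
    simp only [Matrix.mulVec, dotProduct, Finset.mul_sum]
    refine Ideal.sum_mem _ fun i _ => ?_
    rw [mul_left_comm]
    exact Ideal.mul_mem_left _ _ (ha i))
  rw [e2] at this
  have hle : Ideal.span {(P * M * Q).det} ≤ Ideal.span {M.det} := by
    rw [Ideal.span_singleton_le_span_singleton, Matrix.det_mul, Matrix.det_mul]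
    exact ⟨P.det * Q.det, by ring⟩
  have hle2 := sup_le_sup_left hle (Ideal.span (Set.range (M.mulVec x)))
  exact hle2 this

theorem Wie.of_equiv (e : R ≃+* R') {x : σ → R} {M : Matrix σ σ R}
    (h : Wie (fun i => e (x i)) (M.map e)) : Wie x M := by
  have e1 : (M.map e).mulVec (fun i => e (x i)) = fun i => e (M.mulVec x i) := by
    funext i
    simp [Matrix.mulVec, dotProduct]
  have e2 : Ideal.span (Set.range ((M.map e).mulVec (fun i => e (x i)))) =
      (Ideal.span (Set.range (M.mulVec x))).map (e : R →+* R') := by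
    rw [e1, Ideal.map_span, ← Set.range_comp]; rfl
  have e3 : (M.map e).det = e M.det := by
    exact (RingHom.map_det (e : R →+* R') M).symm
  intro a ha
  have h1 := h (e a) (by
    intro j
    rw [e2, ← map_mul]
    exact Ideal.mem_map_of_mem (e : R →+* R') (ha j))
  have e4 : (Ideal.span {e M.det} : Ideal R') = (Ideal.span {M.det}).map (e : R →+* R') := by
    rw [Ideal.map_span]; simp
  rw [e2, e3, e4, ← Ideal.map_sup] at h1
  obtain ⟨b, hb, hab⟩ := (Ideal.mem_map_iff_of_surjective (e : R →+* R') e.surjective).1 h1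
  rwa [← e.injective hab]

theorem HH.map_equiv {c : ℕ} {I : Ideal R} (h : HH c I) (e : R ≃+* R') :
    HH c (I.map (e : R →+* R')) := by
  classical
  intro s hs hI
  have h1 : Ideal.span ((s.image e.symm : Finset R) : Set R) =
      (Ideal.span (s : Set R')).map (e.symm : R' →+* R) := by
    rw [Ideal.map_span]; simp
  have h2 := h (s.image e.symm) (Finset.card_image_le.trans hs) (by
    rw [h1]
    have := Ideal.map_mono (f := (e.symm : R' →+* R)) hI
    refine le_trans ?_ this
    rw [Ideal.map_map]
    intro a ha
    have := Ideal.mem_map_of_mem ((e.symm : R' →+* R).comp (e : R →+* R')) ha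
    simpa using this)
  rw [h1, Ideal.eq_top_iff_one] at h2
  rw [Ideal.eq_top_iff_one]
  obtain ⟨b, hb, hab⟩ := (Ideal.mem_map_iff_of_surjective (e.symm : R' →+* R) e.symm.surjective).1 h2
  have : b = 1 := by
    apply e.symm.injective; simpa using hab
  rwa [← this]

end Wie

section Reg
variable {R R' : Type*} [CommRing R] [CommRing R']

/-- relation between relatively prime elements -/
theorem relprime_syz [IsDomain R'] [UniqueFactorizationMonoid R'] {a b f g : R'} (h : IsRelPrime f g)
    (hab : a * f + b * g = 0) : ∃ c, a = c * g ∧ b = - c * f := by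
  by_cases hf : f = 0
  · have hg : IsUnit g := h (by simp [hf]) dvd_rfl
    obtain ⟨u, rfl⟩ := hg
    subst hf
    have hb : b = 0 := by simpa using hab
    exact ⟨a * ↑u⁻¹, by simp, by simp [hb]⟩
  · have : f ∣ b * g := ⟨-a, by linear_combination hab⟩
    obtain ⟨c, rfl⟩ := h.dvd_of_dvd_mul_right this
    refine ⟨-c, ?_, by ring⟩
    apply mul_right_cancel₀ hf
    linear_combination hab

theorem reg_mod [IsDomain R'] [UniqueFactorizationMonoid R'] (X0 : Ideal R) [X0.IsPrime] {y f g : R}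
    (hy : y ∉ X0) (φ : R →+* R') (hφ : Function.Surjective φ)
    (hker : RingHom.ker φ = X0 ⊔ Ideal.span {y})
    (hrel : IsRelPrime (φ f) (φ g)) {h : R}
    (hh : y * h ∈ X0 ⊔ Ideal.span {f, g}) : h ∈ X0 ⊔ Ideal.span {f, g} := by
  obtain ⟨z, hz, w, hw, hzw⟩ := Submodule.mem_sup.1 hh
  obtain ⟨a, b, rfl⟩ := Ideal.mem_span_pair.1 hw
  have hX : ∀ z ∈ X0, φ z = 0 := fun z hz => by
    rw [← RingHom.mem_ker, hker]; exact Ideal.mem_sup_left hz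
  have hyk : φ y = 0 := by
    rw [← RingHom.mem_ker, hker]
    exact Ideal.mem_sup_right (Ideal.mem_span_singleton_self y)
  have h0 : φ a * φ f + φ b * φ g = 0 := by
    have := congrArg φ hzw
    simp only [map_add, map_mul, hX z hz, hyk] at this
    linear_combination this
  obtain ⟨c', hc1, hc2⟩ := relprime_syz hrel h0
  obtain ⟨c, rfl⟩ := hφ c'
  have ha : a - c * g ∈ X0 ⊔ Ideal.span {y} := by
    rw [← hker, RingHom.mem_ker]; simp [hc1]
  have hb : b + c * f ∈ X0 ⊔ Ideal.span {y} := by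
    rw [← hker, RingHom.mem_ker]; simp [hc2]
  obtain ⟨z1, hz1, w1, hw1, h1⟩ := Submodule.mem_sup.1 ha
  obtain ⟨a1, rfl⟩ := Ideal.mem_span_singleton'.1 hw1
  obtain ⟨z2, hz2, w2, hw2, h2⟩ := Submodule.mem_sup.1 hb
  obtain ⟨b1, rfl⟩ := Ideal.mem_span_singleton'.1 hw2
  have h3 : y * (h - (a1 * f + b1 * g)) ∈ X0 := by
    have : y * (h - (a1 * f + b1 * g)) = z + z1 * f + z2 * g := by
      linear_combination (-1 : R) * hzw + (-f) * h1 + (-g) * h2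
    rw [this]
    exact X0.add_mem (X0.add_mem hz (X0.mul_mem_right _ hz1)) (X0.mul_mem_right _ hz2)
  have h4 := (Ideal.IsPrime.mem_or_mem inferInstance h3).resolve_left hy
  have : h = (h - (a1 * f + b1 * g)) + (a1 * f + b1 * g) := by ring
  rw [this]
  exact Submodule.add_mem_sup h4 (Ideal.mem_span_pair.2 ⟨a1, b1, rfl⟩)

theorem step_lemma {σ : Type*} (xs : σ → R) (K : Ideal R) (a D : R) (i0 : σ)
    (hx : ∀ h, xs i0 * h ∈ K → h ∈ K) (ha : ∀ h, a * h ∈ K → h ∈ K)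
    (h1 : ∀ h, (∀ j, h * xs j ∈ K ⊔ Ideal.span {xs i0}) →
      h ∈ K ⊔ Ideal.span {xs i0} ⊔ Ideal.span {D})
    (h : R) (hh : ∀ j, h * xs j ∈ K ⊔ Ideal.span {a * xs i0}) :
    h ∈ K ⊔ Ideal.span {a * xs i0} ⊔ Ideal.span {a * D} := by
  obtain ⟨z, hz, w, hw, hzw⟩ := Submodule.mem_sup.1 (hh i0)
  obtain ⟨b, rfl⟩ := Ideal.mem_span_singleton'.1 hw
  have h2 : h - b * a ∈ K := by
    apply hx
    have : xs i0 * (h - b * a) = z := by linear_combination (-1 : R) * hzw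
    rwa [this]
  have h3 := h1 b (by
    intro j
    have h4 : (b * a) * xs j ∈ K ⊔ Ideal.span {a * xs i0} := by
      have : (b * a) * xs j = h * xs j - (h - b * a) * xs j := by ring
      rw [this]
      exact Ideal.sub_mem _ (hh j) (Ideal.mem_sup_left (K.mul_mem_right _ h2))
    obtain ⟨z, hz, w, hw, hzw⟩ := Submodule.mem_sup.1 h4
    obtain ⟨c, rfl⟩ := Ideal.mem_span_singleton'.1 hw
    have h5 : b * xs j - c * xs i0 ∈ K := by
      apply ha
      have : a * (b * xs j - c * xs i0) = z := by linear_combination (-1 : R) * hzw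
      rwa [this]
    have : b * xs j = (b * xs j - c * xs i0) + c * xs i0 := by ring
    rw [this]
    exact Submodule.add_mem_sup h5 (Ideal.mem_span_singleton'.2 ⟨c, rfl⟩))
  obtain ⟨z1, hz1, w, hw, hzw⟩ := Submodule.mem_sup.1 h3
  obtain ⟨c, rfl⟩ := Ideal.mem_span_singleton'.1 hw
  obtain ⟨z2, hz2, w, hw, hzw2⟩ := Submodule.mem_sup.1 hz1
  obtain ⟨c2, rfl⟩ := Ideal.mem_span_singleton'.1 hw
  have : h = ((h - b * a) + a * z2 + c2 * (a * xs i0)) + c * (a * D) := by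
    rw [← hzw, ← hzw2]; ring
  rw [this]
  refine Submodule.add_mem_sup (Submodule.add_mem_sup (K.add_mem h2 (K.mul_mem_left _ hz2)) ?_) ?_
  · exact Ideal.mem_span_singleton'.2 ⟨c2, rfl⟩
  · exact Ideal.mem_span_singleton'.2 ⟨c, rfl⟩

/-- two-variable case -/
theorem base_two [IsDomain R] [UniqueFactorizationMonoid R] {u v α β γ δ h : R}
    (hrel : IsRelPrime (α * u + β * v) (γ * u + δ * v)) (huv : ∀ a b, a * u + b * v = 0 → v ∣ a)
    (hu : h * u ∈ Ideal.span {α * u + β * v, γ * u + δ * v})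
    (hv : h * v ∈ Ideal.span {α * u + β * v, γ * u + δ * v}) :
    h ∈ Ideal.span {α * u + β * v, γ * u + δ * v} ⊔ Ideal.span {α * δ - β * γ} := by
  obtain ⟨p, q, h1⟩ := Ideal.mem_span_pair.1 hu
  obtain ⟨r, s, h2⟩ := Ideal.mem_span_pair.1 hv
  -- v*(p f + q g) = u*(r f + s g)
  have h3 : (v * p - u * r) * (α * u + β * v) + (v * q - u * s) * (γ * u + δ * v) = 0 := by
    linear_combination v * h1 - u * h2
  obtain ⟨c, hc1, hc2⟩ := relprime_syz hrel h3
  -- v p - u r = c (γ u + δ v), v q - u s = - c (α u + β v)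
  obtain ⟨w1, hw1⟩ := huv (r + c * γ) (c * δ - p) (by linear_combination -hc1)
  obtain ⟨w2, hw2⟩ := huv (s - c * α) (-(c * β) - q) (by linear_combination -hc2)
  by_cases hv0 : v = 0
  · subst hv0
    have hu1 : IsUnit u := by
      refine hrel ?_ ?_ <;> simp
    obtain ⟨w, rfl⟩ := hu1
    refine Ideal.mem_sup_left (Ideal.mem_span_pair.2 ⟨p * ↑w⁻¹, q * ↑w⁻¹, ?_⟩)
    have : h = (h * ↑w) * ↑w⁻¹ := by rw [mul_assoc]; simp
    rw [this, ← h1]; ring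
  have : h = w1 * (α * u + β * v) + w2 * (γ * u + δ * v) + c * (α * δ - β * γ) := by
    apply mul_right_cancel₀ hv0
    rw [← h2]
    linear_combination (α * u + β * v) * hw1 + (γ * u + δ * v) * hw2
  rw [this]
  exact Submodule.add_mem_sup (Ideal.mem_span_pair.2 ⟨_, _, rfl⟩)
    (Ideal.mem_span_singleton'.2 ⟨c, rfl⟩)

end Reg

section Kill
variable {V σ τ : Type*} [CommRing V]

theorem sub_rename_killCompl_mem {f : σ → τ} (hf : Function.Injective f) (p : MvPolynomial τ V) :
    p - rename f (killCompl hf p) ∈ Ideal.span ((X : τ → MvPolynomial τ V) '' (Set.range f)ᶜ) := by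
  induction p using MvPolynomial.induction_on with
  | C a => simp
  | add p q hp hq =>
    have : p + q - rename f (killCompl hf (p + q)) = (p - rename f (killCompl hf p)) +
      (q - rename f (killCompl hf q)) := by simp only [map_add]; ring
    rw [this]; exact Ideal.add_mem _ hp hq
  | mul_X p n hp =>
    have : p * X n - rename f (killCompl hf (p * X n)) =
      (p - rename f (killCompl hf p)) * X n +
        rename f (killCompl hf p) * (X n - rename f (killCompl hf (X n))) := by
      simp only [map_mul]; ring
    rw [this]
    refine Ideal.add_mem _ (Ideal.mul_mem_right _ _ hp) (Ideal.mul_mem_left _ _ ?_)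
    by_cases hn : n ∈ Set.range f
    · obtain ⟨m, rfl⟩ := hn
      have : killCompl hf (X (f m) : MvPolynomial τ V) = X m := by
        rw [← rename_X f m, killCompl_rename_app]
      simp [this]
    · have : killCompl hf (X n : MvPolynomial τ V) = 0 := by
        simp [killCompl, hn]
      simp only [this, map_zero, sub_zero]
      exact Ideal.subset_span ⟨n, hn, rfl⟩

theorem killCompl_X_mem {f : σ → τ} (hf : Function.Injective f) (m : σ) :
    killCompl hf (X (f m) : MvPolynomial τ V) = X m := by
  rw [← rename_X f m, killCompl_rename_app]

theorem killCompl_X_notMem {f : σ → τ} (hf : Function.Injective f) {n : τ} (hn : n ∉ Set.range f) :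
    killCompl hf (X n : MvPolynomial τ V) = 0 := by
  simp [killCompl, hn]

theorem ker_killCompl {f : σ → τ} (hf : Function.Injective f) :
    RingHom.ker (killCompl hf : MvPolynomial τ V →ₐ[V] MvPolynomial σ V) =
      Ideal.span ((X : τ → MvPolynomial τ V) '' (Set.range f)ᶜ) := by
  apply le_antisymm
  · intro p hp
    have := sub_rename_killCompl_mem hf p
    rw [RingHom.mem_ker] at hp
    simpa [hp] using this
  · rw [Ideal.span_le]
    rintro _ ⟨n, hn, rfl⟩
    exact killCompl_X_notMem hf hn

theorem killCompl_surj {f : σ → τ} (hf : Function.Injective f) :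
    Function.Surjective (killCompl hf : MvPolynomial τ V →ₐ[V] MvPolynomial σ V) :=
  fun p => ⟨rename f p, killCompl_rename_app hf p⟩

end Kill
end
end CI16

namespace CI16
section

theorem mem_of_map_mem {R R' : Type*} [CommRing R] [CommRing R'] (φ : R →+* R')
    (hφ : Function.Surjective φ) (J : Ideal R) {h : R} (hh : φ h ∈ J.map φ) :
    h ∈ J ⊔ RingHom.ker φ := by
  have := Ideal.comap_map_of_surjective φ hφ J
  have h2 : h ∈ Ideal.comap φ (J.map φ) := hh
  rw [this] at h2
  exact h2

section Diag
variable {V : Type*} [CommRing V] [IsDomain V] [IsPrincipalIdealRing V] [IsLocalRing V] {d : ℕ}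

/-- the diagonalized matrix -/
def dM (a : Fin d → V) (A : Matrix (Fin 2) (Fin d) (MvPolynomial (Fin d ⊕ Fin 2) V))
    (Bm : Matrix (Fin 2) (Fin 2) (MvPolynomial (Fin d ⊕ Fin 2) V)) :
    Matrix (Fin d ⊕ Fin 2) (Fin d ⊕ Fin 2) (MvPolynomial (Fin d ⊕ Fin 2) V) :=
  Matrix.fromBlocks (Matrix.diagonal fun i => C (a i)) 0 A Bm

/-- the two quadrics -/
def qq (A : Matrix (Fin 2) (Fin d) (MvPolynomial (Fin d ⊕ Fin 2) V))
    (Bm : Matrix (Fin 2) (Fin 2) (MvPolynomial (Fin d ⊕ Fin 2) V)) (i : Fin 2) :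
    MvPolynomial (Fin d ⊕ Fin 2) V :=
  ∑ k, A i k * X (Sum.inl k) + ∑ k, Bm i k * X (Sum.inr k)

theorem dM_mulVec (a : Fin d → V) (A Bm) :
    (dM a A Bm).mulVec X = Sum.elim (fun k => C (a k) * X (Sum.inl k)) (qq A Bm) := by
  funext t
  rcases t with k | i
  · simp [dM, Matrix.mulVec, dotProduct, Matrix.diagonal_apply, Fintype.sum_sum_type]
  · simp [dM, Matrix.mulVec, dotProduct, qq, Fintype.sum_sum_type]

theorem dM_span_le (a : Fin d → V) (A Bm) (N : Ideal (MvPolynomial (Fin d ⊕ Fin 2) V))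
    (h1 : ∀ k, C (a k) * X (Sum.inl k) ∈ N) (h2 : ∀ i, qq A Bm i ∈ N) :
    Ideal.span (Set.range ((dM a A Bm).mulVec X)) ≤ N := by
  rw [dM_mulVec, Ideal.span_le]
  rintro _ ⟨t, rfl⟩
  rcases t with k | i
  · exact h1 k
  · exact h2 i

theorem dM_mem1 (a : Fin d → V) (A Bm) (k : Fin d) :
    C (a k) * X (Sum.inl k) ∈ Ideal.span (Set.range ((dM a A Bm).mulVec X)) := by
  rw [dM_mulVec]
  exact Ideal.subset_span ⟨Sum.inl k, rfl⟩

theorem dM_mem2 (a : Fin d → V) (A Bm) (i : Fin 2) :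
    qq A Bm i ∈ Ideal.span (Set.range ((dM a A Bm).mulVec X)) := by
  rw [dM_mulVec]
  exact Ideal.subset_span ⟨Sum.inr i, rfl⟩

/-- evaluation at the origin of the closed fibre -/
def ev0 : MvPolynomial (Fin d ⊕ Fin 2) V →+* IsLocalRing.ResidueField V :=
  (IsLocalRing.residue V).comp constantCoeff

theorem ev0_qq (A Bm) (i : Fin 2) : ev0 (V := V) (d := d) (qq A Bm i) = 0 := by
  simp [ev0, qq]

theorem proper_of_ev0 (s : Set (MvPolynomial (Fin d ⊕ Fin 2) V)) (hs : ∀ p ∈ s, ev0 p = 0) :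
    Ideal.span s ≠ ⊤ := by
  have : Ideal.span s ≤ RingHom.ker (ev0 (V := V) (d := d)) := by
    rw [Ideal.span_le]; intro p hp; exact hs p hp
  intro h
  rw [h, top_le_iff, Ideal.eq_top_iff_one, RingHom.mem_ker, map_one] at this
  exact one_ne_zero this

theorem residue_of_nonunit {v : V} (h : ¬ IsUnit v) : IsLocalRing.residue V v = 0 := by
  rw [IsLocalRing.residue_eq_zero_iff]
  exact (IsLocalRing.mem_maximalIdeal v).2 h

theorem diag_exists (hd : 1 ≤ d) (a : Fin d → V) (A Bm)
    (hH : HH (d + 1) (Ideal.span (Set.range ((dM a A Bm).mulVec X)))) :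
    ∃ i0, ∀ k, k ≠ i0 → IsUnit (a k) := by
  classical
  by_contra hcon
  push Not at hcon
  obtain ⟨k1, -, hk1⟩ := hcon ⟨0, hd⟩
  obtain ⟨k2, hk, hk2⟩ := hcon k1
  obtain ⟨ϖ, hϖ⟩ := (IsPrincipalIdealRing.principal (IsLocalRing.maximalIdeal V)).principal
  have hϖ0 : IsLocalRing.residue V ϖ = 0 := by
    rw [IsLocalRing.residue_eq_zero_iff, hϖ]
    exact Submodule.mem_span_singleton_self ϖ
  have hdiv : ∀ v : V, ¬ IsUnit v → ϖ ∣ v := fun v hv => by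
    have := (IsLocalRing.mem_maximalIdeal v).2 hv
    rw [hϖ] at this
    exact Ideal.mem_span_singleton.1 this
  let s0 : Finset (MvPolynomial (Fin d ⊕ Fin 2) V) :=
    ((Finset.univ.erase k1).erase k2).image fun k => C (a k) * X (Sum.inl k)
  let s : Finset (MvPolynomial (Fin d ⊕ Fin 2) V) :=
    insert (C ϖ) (insert (qq A Bm 0) (insert (qq A Bm 1) s0))
  have hcard : s.card ≤ d + 1 := by
    have h0 : s0.card ≤ d - 2 := by
      refine Finset.card_image_le.trans ?_
      rw [Finset.card_erase_of_mem (by simp [hk]), Finset.card_erase_of_mem (by simp)]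
      simp; omega
    have h1 := Finset.card_insert_le (qq A Bm 1) s0
    have h2 := Finset.card_insert_le (qq A Bm 0) (insert (qq A Bm 1) s0)
    have h3 := Finset.card_insert_le (C ϖ) (insert (qq A Bm 0) (insert (qq A Bm 1) s0))
    have : 2 ≤ d := by
      have h1 := k1.2; have h2 := k2.2
      have : (k1 : ℕ) ≠ k2 := fun h => hk (Fin.ext h.symm)
      omega
    show (insert _ _ : Finset (MvPolynomial (Fin d ⊕ Fin 2) V)).card ≤ d + 1
    omega
  refine proper_of_ev0 (s : Set (MvPolynomial (Fin d ⊕ Fin 2) V)) ?_ (hH s hcard ?_)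
  · intro p hp
    have hp' : p ∈ s := hp
    simp only [s, s0, Finset.mem_insert, Finset.mem_image] at hp'
    rcases hp' with rfl | rfl | rfl | ⟨k, -, rfl⟩
    · simp [ev0, hϖ0]
    · exact ev0_qq _ _ _
    · exact ev0_qq _ _ _
    · simp [ev0]
  · apply dM_span_le
    · intro k
      have hw : ∀ k, ¬ IsUnit (a k) → C (a k) * X (Sum.inl k) ∈ Ideal.span (s : Set (MvPolynomial (Fin d ⊕ Fin 2) V)) := by
        intro k hk
        obtain ⟨c, hc⟩ := hdiv _ hk
        rw [hc, C_mul, mul_assoc]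
        exact Ideal.mul_mem_right _ _ (Ideal.subset_span (by simp [s]))
      by_cases h1 : k = k1
      · exact hw k (h1 ▸ hk1)
      by_cases h2 : k = k2
      · exact hw k (h2 ▸ hk2)
      refine Ideal.subset_span ?_
      simp only [s, s0, Finset.coe_insert, Finset.coe_image]
      right; right; right
      exact ⟨k, by simp [h1, h2], rfl⟩
    · intro i
      refine Ideal.subset_span ?_
      fin_cases i <;> simp [s]

theorem diag_ne_zero (a : Fin d → V) (A Bm)
    (hH : HH (d + 1) (Ideal.span (Set.range ((dM a A Bm).mulVec X)))) (i0 : Fin d) :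
    a i0 ≠ 0 := by
  classical
  intro h0
  have hd : 1 ≤ d := by have := i0.2; omega
  let s0 : Finset (MvPolynomial (Fin d ⊕ Fin 2) V) :=
    (Finset.univ.erase i0).image fun k => C (a k) * X (Sum.inl k)
  let s : Finset (MvPolynomial (Fin d ⊕ Fin 2) V) :=
    (insert (qq A Bm 0) (insert (qq A Bm 1) s0))
  have hcard : s.card ≤ d + 1 := by
    have h0 : s0.card ≤ d - 1 := by
      refine Finset.card_image_le.trans ?_
      rw [Finset.card_erase_of_mem (by simp)]
      simp
    have h1 := Finset.card_insert_le (qq A Bm 1) s0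
    have h2 := Finset.card_insert_le (qq A Bm 0) (insert (qq A Bm 1) s0)
    show (insert _ _ : Finset (MvPolynomial (Fin d ⊕ Fin 2) V)).card ≤ d + 1
    omega
  refine proper_of_ev0 (s : Set (MvPolynomial (Fin d ⊕ Fin 2) V)) ?_ (hH s hcard ?_)
  · intro p hp
    have hp' : p ∈ s := hp
    simp only [s, s0, Finset.mem_insert, Finset.mem_image] at hp'
    rcases hp' with rfl | rfl | ⟨k, -, rfl⟩
    · exact ev0_qq _ _ _
    · exact ev0_qq _ _ _
    · simp [ev0]
  · apply dM_span_le
    · intro k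
      by_cases h1 : k = i0
      · rw [h1, h0]; simp
      refine Ideal.subset_span ?_
      simp only [s, s0, Finset.coe_insert, Finset.coe_image]
      right; right
      exact ⟨k, by simp [h1], rfl⟩
    · intro i
      refine Ideal.subset_span ?_
      fin_cases i <;> simp [s]

/-- ideal of the variables `x_k`, `k ≠ i0`. -/
def XX (V : Type*) [CommRing V] (i0 : Fin d) : Ideal (MvPolynomial (Fin d ⊕ Fin 2) V) :=
  Ideal.span ((X : Fin d ⊕ Fin 2 → MvPolynomial (Fin d ⊕ Fin 2) V) ''
    (Set.range (Subtype.val : {t : Fin d ⊕ Fin 2 // ∀ k, k ≠ i0 → t ≠ Sum.inl k} → _))ᶜ)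

theorem XX_eq (i0 : Fin d) : XX V i0 = Ideal.span
    ((fun k => (X (Sum.inl k) : MvPolynomial (Fin d ⊕ Fin 2) V)) '' ((Finset.univ.erase i0 : Finset (Fin d)) : Set (Fin d))) := by
  classical
  unfold XX
  congr 1
  ext p
  simp only [Subtype.range_coe_subtype, Set.mem_image, Set.mem_compl_iff, Set.mem_ofPred_eq,
    Finset.mem_coe, Finset.mem_erase, Finset.mem_univ, and_true]
  constructor
  · rintro ⟨t, ht, rfl⟩
    push Not at ht
    obtain ⟨k, hk, rfl⟩ := ht
    exact ⟨k, hk, rfl⟩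
  · rintro ⟨k, hk, rfl⟩
    exact ⟨Sum.inl k, fun h => h k hk rfl, rfl⟩

theorem XX_mem (i0 k : Fin d) (hk : k ≠ i0) : (X (Sum.inl k) : MvPolynomial (Fin d ⊕ Fin 2) V) ∈ XX V i0 := by
  classical
  rw [XX_eq]
  exact Ideal.subset_span ⟨k, by simp [hk], rfl⟩

theorem XX_eq_ker (i0 : Fin d) : XX V i0 = RingHom.ker (killCompl (R := V) (Subtype.val_injective
    (p := fun t : Fin d ⊕ Fin 2 => ∀ k, k ≠ i0 → t ≠ Sum.inl k))) := by
  rw [ker_killCompl]; rfl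

instance XX_prime (i0 : Fin d) : (XX V i0).IsPrime := by
  rw [XX_eq_ker]
  exact RingHom.ker_isPrime _

theorem diag_relprime {R' : Type*} [CommRing R'] (a : Fin d → V) (A Bm)
    (hH : HH (d + 1) (Ideal.span (Set.range ((dM a A Bm).mulVec X)))) (i0 : Fin d)
    (φ : MvPolynomial (Fin d ⊕ Fin 2) V →+* R') (hφ : Function.Surjective φ) (y)
    (hker : RingHom.ker φ = XX V i0 ⊔ Ideal.span {y}) (hax : φ (C (a i0) * X (Sum.inl i0)) = 0) :
    IsRelPrime (φ (qq A Bm 0)) (φ (qq A Bm 1)) := by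
  classical
  intro c' h0 h1
  obtain ⟨c, rfl⟩ := hφ c'
  have hd : 1 ≤ d := by have := i0.2; omega
  let s0 : Finset (MvPolynomial (Fin d ⊕ Fin 2) V) :=
    (Finset.univ.erase i0).image fun k => X (Sum.inl k)
  let s : Finset (MvPolynomial (Fin d ⊕ Fin 2) V) := (insert c (insert y s0))
  have hcard : s.card ≤ d + 1 := by
    have h0 : s0.card ≤ d - 1 := by
      refine Finset.card_image_le.trans ?_
      rw [Finset.card_erase_of_mem (by simp)]
      simp
    have h1 := Finset.card_insert_le y s0
    have h2 := Finset.card_insert_le c (insert y s0)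
    show (insert _ _ : Finset (MvPolynomial (Fin d ⊕ Fin 2) V)).card ≤ d + 1
    omega
  have hspan : Ideal.span (s : Set (MvPolynomial (Fin d ⊕ Fin 2) V)) = Ideal.span {c} ⊔ RingHom.ker φ := by
    simp only [s, s0, Finset.coe_insert, Finset.coe_image]
    rw [Ideal.span_insert, Ideal.span_insert, hker, XX_eq, sup_comm (Ideal.span {y})]
  have hq : ∀ p, φ c ∣ φ p → p ∈ Ideal.span {c} ⊔ RingHom.ker φ := by
    intro p hp
    apply mem_of_map_mem φ hφ
    rw [Ideal.map_span, Set.image_singleton]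
    exact Ideal.mem_span_singleton.2 hp
  have := hH s hcard (by
    rw [hspan]
    apply dM_span_le
    · intro k
      apply Ideal.mem_sup_right
      by_cases hk : k = i0
      · subst hk; exact hax
      · rw [hker]
        exact Ideal.mem_sup_left (Ideal.mul_mem_left _ _ (XX_mem i0 k hk))
    · intro i
      fin_cases i
      · exact hq _ h0
      · exact hq _ h1)
  rw [hspan, Ideal.eq_top_iff_one] at this
  obtain ⟨z, hz, w, hw, hzw⟩ := Submodule.mem_sup.1 this
  obtain ⟨b, rfl⟩ := Ideal.mem_span_singleton'.1 hz
  have h3 := congrArg φ hzw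
  rw [map_add, (RingHom.mem_ker).1 hw, map_mul, map_one, add_zero] at h3
  exact IsUnit.of_mul_eq_one (φ b) (by rw [mul_comm]; exact h3)

/-- kill all `x_k`. -/
abbrev phi1 (V : Type*) [CommRing V] (d : ℕ) : MvPolynomial (Fin d ⊕ Fin 2) V →+* MvPolynomial (Fin 2) V :=
  (killCompl (R := V) (Sum.inr_injective (α := Fin d) (β := Fin 2))).toRingHom

theorem phi1_ker (i0 : Fin d) : RingHom.ker (phi1 V d) = XX V i0 ⊔ Ideal.span {X (Sum.inl i0)} := by
  have h := ker_killCompl (V := V) (Sum.inr_injective (α := Fin d) (β := Fin 2))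
  have h' : RingHom.ker (phi1 V d) = Ideal.span ((X : Fin d ⊕ Fin 2 → MvPolynomial (Fin d ⊕ Fin 2) V) '' (Set.range Sum.inr)ᶜ) := h
  rw [h']
  apply le_antisymm
  · rw [Ideal.span_le]
    rintro _ ⟨t, ht, rfl⟩
    rcases t with k | i
    · by_cases hk : k = i0
      · subst hk
        exact Ideal.mem_sup_right (Ideal.mem_span_singleton_self _)
      · exact Ideal.mem_sup_left (XX_mem i0 k hk)
    · exact absurd ⟨i, rfl⟩ ht
  · rw [XX_eq, sup_le_iff, Ideal.span_le, Ideal.span_le]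
    constructor
    · rintro _ ⟨k, -, rfl⟩
      exact Ideal.subset_span ⟨_, by simp, rfl⟩
    · rintro _ rfl
      exact Ideal.subset_span ⟨_, by simp, rfl⟩

theorem phi1_surj : Function.Surjective (phi1 V d) := killCompl_surj _

theorem XX_not_mem (i0 : Fin d) : (X (Sum.inl i0) : MvPolynomial (Fin d ⊕ Fin 2) V) ∉ XX V i0 := by
  rw [XX_eq_ker, RingHom.mem_ker]
  have := killCompl_X_mem (V := V) (Subtype.val_injective
    (p := fun t : Fin d ⊕ Fin 2 => ∀ k, k ≠ i0 → t ≠ Sum.inl k)) ⟨Sum.inl i0, fun k hk h => hk (Sum.inl.inj h).symm⟩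
  simp only at this
  rw [this]
  exact X_ne_zero _

/-- kill `x_k`, `k ≠ i0`, and reduce mod the maximal ideal. -/
abbrev phi2 (V : Type*) [CommRing V] [IsLocalRing V] (i0 : Fin d) : MvPolynomial (Fin d ⊕ Fin 2) V →+*
    MvPolynomial {t : Fin d ⊕ Fin 2 // ∀ k, k ≠ i0 → t ≠ Sum.inl k} (IsLocalRing.ResidueField V) :=
  (map (IsLocalRing.residue V)).comp (killCompl (R := V) (Subtype.val_injective
    (p := fun t : Fin d ⊕ Fin 2 => ∀ k, k ≠ i0 → t ≠ Sum.inl k))).toRingHom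

theorem phi2_surj (i0 : Fin d) : Function.Surjective (phi2 V i0) :=
  (map_surjective _ IsLocalRing.residue_surjective).comp (killCompl_surj _)

theorem phi2_ker (i0 : Fin d) (ϖ : V) (hϖ : IsLocalRing.maximalIdeal V = Ideal.span {ϖ}) :
    RingHom.ker (phi2 V i0) = XX V i0 ⊔ Ideal.span {C ϖ} := by
  have hk := XX_eq_ker (V := V) i0
  set κ := killCompl (R := V) (Subtype.val_injective
    (p := fun t : Fin d ⊕ Fin 2 => ∀ k, k ≠ i0 → t ≠ Sum.inl k)) with hκ
  apply le_antisymm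
  · intro p hp
    have h1 : κ p ∈ RingHom.ker (map (IsLocalRing.residue V) : MvPolynomial {t : Fin d ⊕ Fin 2 // ∀ k, k ≠ i0 → t ≠ Sum.inl k} V →+* _) := hp
    rw [ker_map, IsLocalRing.ker_residue, hϖ, Ideal.map_span, Set.image_singleton] at h1
    have h2 : (κ.toRingHom) p ∈ (Ideal.span {(C ϖ : MvPolynomial (Fin d ⊕ Fin 2) V)}).map κ.toRingHom := by
      rw [Ideal.map_span, Set.image_singleton]
      have : κ.toRingHom (C ϖ) = C ϖ := killCompl_C _ _
      rw [this]; exact h1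
    have h3 := mem_of_map_mem κ.toRingHom (killCompl_surj _) _ h2
    rw [sup_comm] at h3
    have : RingHom.ker κ.toRingHom = XX V i0 := hk.symm
    rwa [this] at h3
  · rw [sup_le_iff, hk]
    constructor
    · intro p hp
      have : κ p = 0 := hp
      simp only [phi2, RingHom.mem_ker, RingHom.comp_apply, AlgHom.toRingHom_eq_coe, RingHom.coe_coe, ← hκ, this, map_zero]
    · rw [Ideal.span_le]
      rintro _ rfl
      have h0 : IsLocalRing.residue V ϖ = 0 := by
        rw [IsLocalRing.residue_eq_zero_iff, hϖ]
        exact Ideal.mem_span_singleton_self ϖ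
      simp [RingHom.mem_ker, h0]

theorem Wie_diag (hd : 1 ≤ d) (a : Fin d → V) (A Bm)
    (hH : HH (d + 1) (Ideal.span (Set.range ((dM a A Bm).mulVec X)))) :
    Wie X (dM a A Bm) := by
  classical
  obtain ⟨i0, hi0⟩ := diag_exists hd a A Bm hH
  have ha0 := diag_ne_zero a A Bm hH i0
  set K : Ideal (MvPolynomial (Fin d ⊕ Fin 2) V) := XX V i0 ⊔ Ideal.span {qq A Bm 0, qq A Bm 1} with hK
  have hI : Ideal.span (Set.range ((dM a A Bm).mulVec X)) = K ⊔ Ideal.span {C (a i0) * X (Sum.inl i0)} := by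
    apply le_antisymm
    · apply dM_span_le
      · intro k
        by_cases hk : k = i0
        · subst hk; exact Ideal.mem_sup_right (Ideal.mem_span_singleton_self _)
        · exact Ideal.mem_sup_left (Ideal.mem_sup_left (Ideal.mul_mem_left _ _ (XX_mem i0 k hk)))
      · intro i
        refine Ideal.mem_sup_left (Ideal.mem_sup_right (Ideal.subset_span ?_))
        fin_cases i <;> simp
    · rw [hK, sup_le_iff, sup_le_iff, XX_eq, Ideal.span_le, Ideal.span_le, Ideal.span_le]
      refine ⟨⟨?_, ?_⟩, ?_⟩
      · rintro _ ⟨k, hk, rfl⟩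
        have hk' : k ≠ i0 := by simpa using hk
        obtain ⟨u, hu⟩ := hi0 k hk'
        have : (X (Sum.inl k) : MvPolynomial (Fin d ⊕ Fin 2) V) = C (↑u⁻¹ : V) * (C (a k) * X (Sum.inl k)) := by
          rw [← mul_assoc, ← C_mul, ← hu]; simp
        show X (Sum.inl k) ∈ _
        rw [this]
        exact Ideal.mul_mem_left _ _ (dM_mem1 a A Bm k)
      · rintro _ (rfl | rfl)
        · exact dM_mem2 a A Bm 0
        · exact dM_mem2 a A Bm 1
      · rintro _ rfl
        exact dM_mem1 a A Bm i0
  have hregx : ∀ h, X (Sum.inl i0) * h ∈ K → h ∈ K := by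
    intro h hh
    have hrel := diag_relprime a A Bm hH i0 (phi1 V d) phi1_surj _ (phi1_ker i0) (by
      rw [map_mul]
      have : phi1 V d (X (Sum.inl i0)) = 0 := killCompl_X_notMem _ (by simp)
      rw [this, mul_zero])
    exact reg_mod (XX V i0) (XX_not_mem i0) (phi1 V d) phi1_surj (phi1_ker i0) hrel hh
  have hrega : ∀ b : V, b ∣ a i0 → ∀ h, C b * h ∈ K → h ∈ K := by
    intro b
    induction b using WfDvdMonoid.induction_on_irreducible with
    | zero => intro hb; exact absurd (zero_dvd_iff.1 hb) ha0
    | unit u hu =>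
      intro _ h hh
      obtain ⟨u, rfl⟩ := hu
      have : h = C (↑u⁻¹ : V) * (C (↑u : V) * h) := by
        rw [← mul_assoc, ← C_mul]; simp
      rw [this]
      exact Ideal.mul_mem_left _ _ hh
    | mul b ϖ hb0 hϖ ih =>
      intro hb h hh
      have hbd : b ∣ a i0 := (Dvd.intro_left ϖ rfl).trans hb
      have hϖd : ϖ ∣ a i0 := (Dvd.intro b rfl).trans hb
      apply ih hbd
      have hmax : IsLocalRing.maximalIdeal V = Ideal.span {ϖ} := by
        have := PrincipalIdealRing.isMaximal_of_irreducible hϖ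
        exact (IsLocalRing.eq_maximalIdeal this).symm
      have hrel := diag_relprime a A Bm hH i0 (phi2 V i0) (phi2_surj i0) _ (phi2_ker i0 ϖ hmax) (by
        rw [← RingHom.mem_ker, phi2_ker i0 ϖ hmax]
        apply Ideal.mem_sup_right
        obtain ⟨c, hc⟩ := hϖd
        rw [hc, C_mul, mul_assoc]
        exact Ideal.mul_mem_right _ _ (Ideal.mem_span_singleton_self _))
      refine reg_mod (XX V i0) ?_ (phi2 V i0) (phi2_surj i0) (phi2_ker i0 ϖ hmax) hrel (h := C b * h) ?_
      · rw [XX_eq_ker, RingHom.mem_ker, killCompl_C]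
        simpa using hϖ.ne_zero
      · rw [C_mul, mul_assoc] at hh; exact hh
  have hbase : ∀ h, (∀ j, h * X j ∈ K ⊔ Ideal.span {(X (Sum.inl i0) : MvPolynomial (Fin d ⊕ Fin 2) V)}) →
      h ∈ K ⊔ Ideal.span {X (Sum.inl i0)} ⊔ Ideal.span {Bm.det} := by
    intro h hh
    have hKer : K ⊔ Ideal.span {X (Sum.inl i0)} = Ideal.span {qq A Bm 0, qq A Bm 1} ⊔ RingHom.ker (phi1 V d) := by
      rw [hK, phi1_ker i0, sup_comm (XX V i0), sup_assoc]
    have hrel := diag_relprime a A Bm hH i0 (phi1 V d) phi1_surj _ (phi1_ker i0) (by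
      rw [map_mul]
      have : phi1 V d (X (Sum.inl i0)) = 0 := killCompl_X_notMem _ (by simp)
      rw [this, mul_zero])
    set φ := phi1 V d with hφ
    have hXl : ∀ k, φ (X (Sum.inl k)) = 0 := fun k => killCompl_X_notMem _ (by simp)
    have hXr : ∀ k, φ (X (Sum.inr k)) = X k := fun k => killCompl_X_mem _ _
    have hq : ∀ i, φ (qq A Bm i) = φ (Bm i 0) * X 0 + φ (Bm i 1) * X 1 := by
      intro i
      simp only [qq, map_add, map_sum, map_mul, hXl, hXr, mul_zero, Finset.sum_const_zero, zero_add,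
        Fin.sum_univ_two]
    have hmap : ∀ p, p ∈ Ideal.span {qq A Bm 0, qq A Bm 1} ⊔ RingHom.ker φ →
        φ p ∈ Ideal.span {φ (qq A Bm 0), φ (qq A Bm 1)} := by
      intro p hp
      obtain ⟨z, hz, w, hw, rfl⟩ := Submodule.mem_sup.1 hp
      obtain ⟨b1, b2, rfl⟩ := Ideal.mem_span_pair.1 hz
      rw [map_add, RingHom.mem_ker.1 hw, add_zero, map_add, map_mul, map_mul]
      exact Ideal.mem_span_pair.2 ⟨_, _, rfl⟩
    have h0 := hmap _ (hKer ▸ hh (Sum.inr 0))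
    have h1 := hmap _ (hKer ▸ hh (Sum.inr 1))
    rw [map_mul, hXr, hq, hq] at h0 h1
    rw [hq, hq] at hrel
    have := base_two hrel (by
      intro p q hpq
      have hX1 : Prime (X 1 : MvPolynomial (Fin 2) V) := X_prime
      have h2 : X 1 ∣ p * X 0 := ⟨-q, by linear_combination hpq⟩
      refine (hX1.dvd_or_dvd h2).resolve_right ?_
      intro h3
      have := (X_dvd_X (R := V) (i := (1 : Fin 2)) (j := 0)).1 h3
      simp at this) h0 h1
    rw [← hq, ← hq] at this
    rw [hKer, sup_assoc, sup_comm (RingHom.ker φ), ← sup_assoc]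
    apply mem_of_map_mem φ phi1_surj
    rw [Ideal.map_sup, Ideal.map_span, Ideal.map_span, Set.image_pair, Set.image_singleton]
    convert this using 4
    rw [Matrix.det_fin_two, map_sub, map_mul, map_mul]
  intro h hh
  rw [hI] at hh ⊢
  have h5 := step_lemma (X : Fin d ⊕ Fin 2 → MvPolynomial (Fin d ⊕ Fin 2) V) K (C (a i0)) Bm.det (Sum.inl i0) hregx
    (hrega _ dvd_rfl) hbase h hh
  have hle : Ideal.span {C (a i0) * Bm.det} ≤ Ideal.span {(dM a A Bm).det} := by
    rw [Ideal.span_singleton_le_span_singleton, dM, Matrix.det_fromBlocks_zero₁₂, Matrix.det_diagonal]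
    apply mul_dvd_mul_right
    rw [← Finset.mul_prod_erase _ _ (Finset.mem_univ i0)]
    have hu : IsUnit (∏ x ∈ Finset.univ.erase i0, (C (a x) : MvPolynomial (Fin d ⊕ Fin 2) V)) := by
      rw [IsUnit.prod_iff]
      intro k hk
      exact (hi0 k (by simpa using hk)).map C
    obtain ⟨u, hu⟩ := hu
    rw [← hu]
    exact (Units.mul_right_dvd).2 dvd_rfl
  have hle2 := sup_le_sup_left hle (K ⊔ Ideal.span {C (a i0) * X (Sum.inl i0)})
  exact hle2 h5

end Diag
end
end CI16

namespace CI16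
section

section Aut
variable {V σ : Type*} [CommRing V] [Fintype σ] [DecidableEq σ]

/-- linear substitution -/
def linSub (Q : Matrix σ σ V) : MvPolynomial σ V →ₐ[V] MvPolynomial σ V :=
  aeval (fun t => ∑ s, C (Q t s) * X s)

theorem linSub_X (Q : Matrix σ σ V) (t : σ) : linSub Q (X t) = ∑ s, C (Q t s) * X s := by
  simp [linSub]

theorem linSub_comp (Q Q' : Matrix σ σ V) : (linSub Q).comp (linSub Q') = linSub (Q' * Q) := by
  apply MvPolynomial.algHom_ext
  intro t
  simp only [AlgHom.comp_apply, linSub_X, map_sum, map_mul, algHom_C, Matrix.mul_apply]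
  simp only [MvPolynomial.algebraMap_eq, Finset.mul_sum, Finset.sum_mul]
  rw [Finset.sum_comm]
  refine Finset.sum_congr rfl fun s _ => Finset.sum_congr rfl fun r _ => ?_
  ring

theorem linSub_one : linSub (1 : Matrix σ σ V) = AlgHom.id V _ := by
  apply MvPolynomial.algHom_ext
  intro t
  simp [linSub_X, Matrix.one_apply]

/-- linear automorphism -/
def linAut (Q : Matrix σ σ V) (hQ : IsUnit Q.det) : MvPolynomial σ V ≃ₐ[V] MvPolynomial σ V :=
  AlgEquiv.ofAlgHom (linSub Q) (linSub Q⁻¹)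
    (by rw [linSub_comp, Matrix.nonsing_inv_mul _ hQ, linSub_one])
    (by rw [linSub_comp, Matrix.mul_nonsing_inv _ hQ, linSub_one])

theorem linAut_X (Q : Matrix σ σ V) (hQ : IsUnit Q.det) (t : σ) :
    linAut Q hQ (X t) = ∑ s, C (Q t s) * X s := linSub_X Q t

theorem linAut_C (Q : Matrix σ σ V) (hQ : IsUnit Q.det) (v : V) :
    linAut Q hQ (C v) = C v := by
  show linSub Q (C v) = C v
  simp [linSub]

end Aut

section Smith
variable {V : Type*} [CommRing V] [IsDomain V] [IsPrincipalIdealRing V] {d : ℕ}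

theorem smith (J : Matrix (Fin d) (Fin d ⊕ Fin 2) V) :
    ∃ (P : Matrix (Fin d) (Fin d) V) (Q : Matrix (Fin d ⊕ Fin 2) (Fin d ⊕ Fin 2) V) (a : Fin d → V),
      IsUnit P.det ∧ IsUnit Q.det ∧ P * J * Q = Matrix.fromCols (Matrix.diagonal a) 0 := by
  classical
  set L := J.mulVecLin with hL
  obtain ⟨n, bM, bN, f, a, snf⟩ := (LinearMap.range L).smithNormalForm (Pi.basisFun V (Fin d))
  obtain ⟨m, bK⟩ := Submodule.basisOfPid (Pi.basisFun V (Fin d ⊕ Fin 2)) (LinearMap.ker L)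
  have hw : ∀ i, ∃ w, L w = (bN i : Fin d → V) := fun i => (bN i).2
  choose w hw using hw
  have hnm : n + m = d + 2 := by
    have := Submodule.finrank_quotient_add_finrank (LinearMap.ker L)
    rw [L.quotKerEquivRange.finrank_eq, Module.finrank_eq_card_basis bN, Module.finrank_eq_card_basis bK] at this
    simpa using this
  let S : Finset (Fin d ⊕ Fin 2) := Finset.univ.image (fun i => Sum.inl (f i))
  have hS : S.card = n := by
    have := Finset.card_image_of_injective Finset.univ (Sum.inl_injective (α := Fin d) (β := Fin 2) |>.comp f.injective)
    rw [Finset.card_univ, Fintype.card_fin] at this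
    exact this
  have hcard : Fintype.card {t // t ∉ S} = Fintype.card (Fin m) := by
    rw [Fintype.card_subtype_compl]
    simp [hS]; omega
  let g := Fintype.equivOfCardEq hcard
  let q : Fin d ⊕ Fin 2 → (Fin d ⊕ Fin 2 → V) := fun t =>
    if h : t ∈ S then w ((Finset.mem_image.1 h).choose) else (bK (g ⟨t, h⟩) : _)
  have hq1 : ∀ i, q (Sum.inl (f i)) = w i := by
    intro i
    have h : Sum.inl (f i) ∈ S := Finset.mem_image.2 ⟨i, Finset.mem_univ _, rfl⟩
    simp only [q, dif_pos h]
    congr 1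
    have := (Finset.mem_image.1 h).choose_spec.2
    exact f.injective (Sum.inl_injective this)
  have hq2 : ∀ t (h : t ∉ S), q t = bK (g ⟨t, h⟩) := fun t h => by simp only [q, dif_neg h]
  have hspan : ⊤ ≤ Submodule.span V (Set.range q) := by
    intro v _
    have h1 : (⟨L v, ⟨v, rfl⟩⟩ : LinearMap.range L) ∈ Submodule.span V (Set.range bN) := by
      rw [bN.span_eq]; trivial
    obtain ⟨c, hc⟩ := (Submodule.mem_span_range_iff_exists_fun V).1 h1
    have h2 : v - ∑ i, c i • w i ∈ LinearMap.ker L := by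
      rw [LinearMap.mem_ker, map_sub, map_sum]
      have := congrArg Subtype.val hc
      simp only [Submodule.coe_sum, Submodule.coe_smul] at this
      rw [← this]
      simp [hw]
    have h3 : (⟨_, h2⟩ : LinearMap.ker L) ∈ Submodule.span V (Set.range bK) := by
      rw [bK.span_eq]; trivial
    obtain ⟨c2, hc2⟩ := (Submodule.mem_span_range_iff_exists_fun V).1 h3
    have hc3 := congrArg Subtype.val hc2
    simp only [Submodule.coe_sum, Submodule.coe_smul] at hc3
    have : v = ∑ i, c2 i • (bK i : Fin d ⊕ Fin 2 → V) + ∑ i, c i • w i := by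
      rw [hc3]; abel
    rw [this]
    refine Submodule.add_mem _ (Submodule.sum_mem _ fun i _ => Submodule.smul_mem _ _ ?_)
      (Submodule.sum_mem _ fun i _ => Submodule.smul_mem _ _ ?_)
    · refine Submodule.subset_span ⟨(g.symm i).1, ?_⟩
      rw [hq2 _ (g.symm i).2]
      simp
    · exact Submodule.subset_span ⟨_, hq1 i⟩
  let Q : Matrix (Fin d ⊕ Fin 2) (Fin d ⊕ Fin 2) V := Matrix.of fun s t => q t s
  have hQ : IsUnit Q.det := by
    have : ∀ r : Fin d ⊕ Fin 2, ∃ c : Fin d ⊕ Fin 2 → V, ∑ t, c t • q t = Pi.single r 1 := fun r =>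
      (Submodule.mem_span_range_iff_exists_fun V).1 (hspan trivial)
    choose c hc using this
    have hmul : Q * (Matrix.of fun t r => c r t) = 1 := by
      ext s r
      have := congrFun (hc r) s
      simp only [Finset.sum_apply, Pi.smul_apply, smul_eq_mul] at this
      simp only [Matrix.mul_apply, Q, Matrix.of_apply, Matrix.one_apply]
      rw [← Pi.single_apply, ← this]
      exact Finset.sum_congr rfl fun t _ => mul_comm _ _
    exact IsUnit.of_mul_eq_one _ (by rw [← Matrix.det_mul, hmul, Matrix.det_one])
  let P := bM.toMatrix (Pi.basisFun V (Fin d))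
  have hP : IsUnit P.det := by
    have : P * (Pi.basisFun V (Fin d)).toMatrix bM = 1 := Module.Basis.toMatrix_mul_toMatrix_flip _ _
    exact IsUnit.of_mul_eq_one _ (by rw [← Matrix.det_mul, this, Matrix.det_one])
  have hPv : ∀ v i, P.mulVec v i = bM.repr v i := by
    intro v i
    have := congrFun (Module.Basis.toMatrix_mulVec_repr (Pi.basisFun V (Fin d)) bM v) i
    rw [← this]
    rfl
  refine ⟨P, Q, Function.extend f a 0, hP, hQ, ?_⟩
  have hcol : ∀ t i, (P * J * Q) i t = bM.repr (L (q t)) i := by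
    intro t i
    rw [← hPv, Matrix.mul_assoc]
    simp [Matrix.mul_apply, Matrix.mulVec, dotProduct, L, Q]
  ext i t
  rw [hcol]
  by_cases ht : t ∈ S
  · obtain ⟨j, -, rfl⟩ := Finset.mem_image.1 ht
    rw [hq1, hw, snf]
    simp only [map_smul, Module.Basis.repr_self, Finsupp.smul_apply, Matrix.fromCols_apply_inl, Matrix.diagonal_apply,
      Finsupp.single_apply, smul_eq_mul]
    by_cases h : i = f j
    · simp [h, f.injective.extend_apply]
    · simp [h, Ne.symm h]
  · rw [hq2 t ht]
    have : L (bK (g ⟨t, ht⟩) : Fin d ⊕ Fin 2 → V) = 0 := (bK (g ⟨t, ht⟩)).2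
    rw [this]
    rcases t with k | k
    · simp only [map_zero, Matrix.fromCols_apply_inl, Matrix.diagonal_apply, Finsupp.coe_zero, Pi.zero_apply]
      by_cases hik : i = k
      · subst hik
        rw [Function.extend_apply']
        · simp
        · rintro ⟨j, rfl⟩
          exact ht (Finset.mem_image.2 ⟨j, Finset.mem_univ _, rfl⟩)
      · simp [hik]
    · simp

end Smith

section WieGen
variable {V : Type*} [CommRing V] [IsDomain V] [IsPrincipalIdealRing V] [IsLocalRing V] {d : ℕ}

/-- the matrix `[J; F; G]`. -/
def gM {V : Type*} [CommRing V] (J : Matrix (Fin d) (Fin d ⊕ Fin 2) V)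
    (F : Matrix (Fin 2) (Fin d ⊕ Fin 2) (MvPolynomial (Fin d ⊕ Fin 2) V)) :
    Matrix (Fin d ⊕ Fin 2) (Fin d ⊕ Fin 2) (MvPolynomial (Fin d ⊕ Fin 2) V) :=
  Matrix.fromRows (J.map C) F

theorem Wie_gM (hd : 1 ≤ d) (J : Matrix (Fin d) (Fin d ⊕ Fin 2) V)
    (F : Matrix (Fin 2) (Fin d ⊕ Fin 2) (MvPolynomial (Fin d ⊕ Fin 2) V))
    (hH : HH (d + 1) (Ideal.span (Set.range ((gM J F).mulVec X)))) :
    Wie X (gM J F) := by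
  obtain ⟨P, Q, a, hP, hQ, hPQ⟩ := smith J
  set α := linAut Q hQ with hα
  apply Wie.of_equiv (α : MvPolynomial (Fin d ⊕ Fin 2) V ≃+* MvPolynomial (Fin d ⊕ Fin 2) V)
  set P' : Matrix (Fin d ⊕ Fin 2) (Fin d ⊕ Fin 2) (MvPolynomial (Fin d ⊕ Fin 2) V) :=
    Matrix.fromBlocks (P.map C) 0 0 1 with hP'
  set Q' : Matrix (Fin d ⊕ Fin 2) (Fin d ⊕ Fin 2) (MvPolynomial (Fin d ⊕ Fin 2) V) := Q.map C with hQ'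
  have hmapdet : ∀ {m : Type} [Fintype m] [DecidableEq m] (N : Matrix m m V), IsUnit N.det → IsUnit (N.map (C : V →+* MvPolynomial (Fin d ⊕ Fin 2) V)).det := by
    intro m _ _ N hN
    have := hN.map (C : V →+* MvPolynomial (Fin d ⊕ Fin 2) V)
    rwa [RingHom.map_det] at this
  have hP'u : IsUnit P'.det := by
    rw [hP', Matrix.det_fromBlocks_zero₁₂, Matrix.det_one, mul_one]
    exact hmapdet P hP
  have hQ'u : IsUnit Q'.det := hmapdet Q hQ
  have hmapM : (gM J F).map α = Matrix.fromRows (J.map C) (F.map α) := by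
    ext1 i j
    rcases i with i | i
    · simp [gM, Matrix.map_apply, hα, linAut_C]
    · simp [gM, Matrix.map_apply]
  have hX : (fun i => α (X i)) = Q'.mulVec X := by
    funext t
    rw [hα, linAut_X]
    rfl
  have hprod : P' * (gM J F).map α * Q' = dM a (F.map α * Q').toCols₁ (F.map α * Q').toCols₂ := by
    rw [hmapM, hP', ← Matrix.fromRows_fromCols_eq_fromBlocks]
    rw [Matrix.fromRows_mul, Matrix.fromCols_mul_fromRows, Matrix.fromCols_mul_fromRows, Matrix.fromRows_mul]
    simp only [Matrix.zero_mul, Matrix.one_mul, add_zero, zero_add]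
    have h1 : P.map (C : V →+* MvPolynomial (Fin d ⊕ Fin 2) V) * J.map (C : V →+* MvPolynomial (Fin d ⊕ Fin 2) V) * Q' = (Matrix.fromCols (Matrix.diagonal a) 0 : Matrix (Fin d) (Fin d ⊕ Fin 2) V).map
        (C : V →+* MvPolynomial (Fin d ⊕ Fin 2) V) := by
      rw [← hPQ, hQ', Matrix.map_mul, Matrix.map_mul]
    rw [h1]
    ext1 i j
    rcases i with i | i <;> rcases j with j | j
    · by_cases h : i = j <;> simp [dM, Matrix.diagonal_apply, h]
    · simp [dM]
    · simp [dM]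
    · simp [dM]
  apply Wie.of_mul P' Q' hP'u hQ'u (x' := X) hX
  have hprod' : P' * (gM J F).map (α : MvPolynomial (Fin d ⊕ Fin 2) V ≃+* MvPolynomial (Fin d ⊕ Fin 2) V) * Q' = dM a (F.map α * Q').toCols₁ (F.map α * Q').toCols₂ := hprod
  rw [hprod']
  apply Wie_diag hd
  have h3 := hH.map_equiv (α : MvPolynomial (Fin d ⊕ Fin 2) V ≃+* MvPolynomial (Fin d ⊕ Fin 2) V)
  convert h3 using 1
  rw [← hprod, ← Matrix.mulVec_mulVec, ← hX, ← Matrix.mulVec_mulVec, span_mulVec_eq P' hP'u, Ideal.map_span,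
    ← Set.range_comp]
  congr 2
  funext i
  simp [Matrix.mulVec, dotProduct]

end WieGen
end
end CI16

namespace CI16
section

section Pm
variable {R R' : Type*} [CommRing R] [CommRing R'] {d : ℕ}

/-- Plücker coordinate `det [J; e_p; e_q]`. -/
def Pm (J : Matrix (Fin d) (Fin d ⊕ Fin 2) R) (p q : Fin d ⊕ Fin 2) : R :=
  (Matrix.fromRows J (Matrix.of ![Pi.single p 1, Pi.single q 1])).det

theorem Pm_map (h : R →+* R') (J : Matrix (Fin d) (Fin d ⊕ Fin 2) R) (p q : Fin d ⊕ Fin 2) :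
    Pm (J.map h) p q = h (Pm J p q) := by
  unfold Pm
  rw [RingHom.map_det]
  congr 1
  ext i j
  rcases i with i | i
  · simp
  · fin_cases i
    · simp [Pi.single_apply, apply_ite h]
    · simp [Pi.single_apply, apply_ite h]

theorem det_two (J : Matrix (Fin d) (Fin d ⊕ Fin 2) R) (U : Matrix (Fin 2) (Fin d ⊕ Fin 2) R) :
    (Matrix.fromRows J U).det = ∑ p, ∑ q, U 0 p * U 1 q * Pm J p q := by
  rw [Matrix.det_eq_sum_mul_adjugate_row _ (Sum.inr 0)]
  refine Finset.sum_congr rfl fun p _ => ?_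
  rw [Matrix.adjugate_apply, Matrix.det_eq_sum_mul_adjugate_row _ (Sum.inr 1), Finset.mul_sum]
  refine Finset.sum_congr rfl fun q _ => ?_
  rw [Matrix.adjugate_apply]
  have h1 : ((Matrix.fromRows J U).updateRow (Sum.inr 0) (Pi.single p 1)) (Sum.inr 1) q = U 1 q := by
    rw [Matrix.updateRow_ne (by simp)]; rfl
  rw [h1, Matrix.fromRows_apply_inr, mul_assoc]
  congr 2
  unfold Pm
  congr 1
  ext i j
  rcases i with i | i
  · simp [Matrix.updateRow_apply]
  · fin_cases i
    · simp [Matrix.updateRow_apply]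
    · simp [Matrix.updateRow_apply]

end Pm

section Morley
variable {T : Type*} [CommRing T] {d : ℕ}

/-- linear forms `F_t = ∑_s a_{ts} x_s`. -/
def FM (a : Fin 2 → Matrix (Fin d ⊕ Fin 2) (Fin d ⊕ Fin 2) T) :
    Matrix (Fin 2) (Fin d ⊕ Fin 2) (MvPolynomial (Fin d ⊕ Fin 2) T) :=
  Matrix.of fun i t => ∑ s, C (a i t s) * X s

/-- transposed version -/
def aT (a : Fin 2 → Matrix (Fin d ⊕ Fin 2) (Fin d ⊕ Fin 2) T) :
    Fin 2 → Matrix (Fin d ⊕ Fin 2) (Fin d ⊕ Fin 2) T := fun i => (a i).transpose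

/-- The ideal `L`. -/
def LL (J : Matrix (Fin d) (Fin d ⊕ Fin 2) T) (a : Fin 2 → Matrix (Fin d ⊕ Fin 2) (Fin d ⊕ Fin 2) T) :
    Ideal (MvPolynomial (Fin d ⊕ Fin 2) T) := Ideal.span (Set.range ((gM J (FM a)).mulVec X))

/-- the Sylvester form -/
def syl (J : Matrix (Fin d) (Fin d ⊕ Fin 2) T) (a : Fin 2 → Matrix (Fin d ⊕ Fin 2) (Fin d ⊕ Fin 2) T) :
    MvPolynomial (Fin d ⊕ Fin 2) T := (gM J (FM a)).det

theorem syl_eq (J : Matrix (Fin d) (Fin d ⊕ Fin 2) T) (a) :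
    syl J a = ∑ p, ∑ q, FM a 0 p * FM a 1 q * C (Pm J p q) := by
  unfold syl gM
  rw [det_two]
  simp only [Pm_map]

theorem X_mul_syl_mem (J : Matrix (Fin d) (Fin d ⊕ Fin 2) T) (a) (r : Fin d ⊕ Fin 2) :
    X r * syl J a ∈ LL J a := by
  have h : (gM J (FM a)).adjugate.mulVec ((gM J (FM a)).mulVec X) = (gM J (FM a)).det • X := by
    rw [Matrix.mulVec_mulVec, Matrix.adjugate_mul, Matrix.smul_mulVec, Matrix.one_mulVec]
  have h1 := congrFun h r
  have h2 : X r * syl J a = (gM J (FM a)).adjugate.mulVec ((gM J (FM a)).mulVec X) r := by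
    rw [h1]; simp [syl, mul_comm]
  rw [h2]
  exact span_mulVec_le _ _ (Ideal.subset_span ⟨r, rfl⟩)

/-- Good functionals. -/
structure Good (J : Matrix (Fin d) (Fin d ⊕ Fin 2) T) (a : Fin 2 → Matrix (Fin d ⊕ Fin 2) (Fin d ⊕ Fin 2) T)
    (θ : MvPolynomial (Fin d ⊕ Fin 2) T →ₗ[T] T) : Prop where
  kill : ∀ p ∈ LL J a, θ p = 0
  deg : ∀ α : (Fin d ⊕ Fin 2) →₀ ℕ, α.degree ≠ 2 → θ (monomial α 1) = 0

theorem Good.homog {J : Matrix (Fin d) (Fin d ⊕ Fin 2) T} {a} {θ : MvPolynomial (Fin d ⊕ Fin 2) T →ₗ[T] T}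
    (h : Good J a θ) {p} {n : ℕ} (hp : p.IsHomogeneous n) (hn : n ≠ 2) : θ p = 0 := by
  rw [p.as_sum, map_sum]
  refine Finset.sum_eq_zero fun α hα => ?_
  have : monomial α (coeff α p) = coeff α p • monomial α (1 : T) := by simp [smul_monomial]
  rw [this, map_smul, h.deg, smul_zero]
  have := hp (mem_support_iff.1 hα)
  intro h2
  apply hn
  exact this.symm.trans (Eq.trans (by rw [Finsupp.degree_eq_weight_one]; rfl) h2)

/-- extension of `θ` to `T[x][z]`. -/
def bigθ (θ : MvPolynomial (Fin d ⊕ Fin 2) T →ₗ[T] T) :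
    MvPolynomial (Fin d ⊕ Fin 2) (MvPolynomial (Fin d ⊕ Fin 2) T) →ₗ[MvPolynomial (Fin d ⊕ Fin 2) T]
      MvPolynomial (Fin d ⊕ Fin 2) T :=
  (basisMonomials (Fin d ⊕ Fin 2) (MvPolynomial (Fin d ⊕ Fin 2) T)).constr (MvPolynomial (Fin d ⊕ Fin 2) T)
    (fun α => (C (θ (monomial α 1)) : MvPolynomial (Fin d ⊕ Fin 2) T))

theorem bigθ_mono (θ : MvPolynomial (Fin d ⊕ Fin 2) T →ₗ[T] T) (α) :
    bigθ θ (monomial α 1) = C (θ (monomial α 1)) := by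
  have := (basisMonomials (Fin d ⊕ Fin 2) (MvPolynomial (Fin d ⊕ Fin 2) T)).constr_basis
    (MvPolynomial (Fin d ⊕ Fin 2) T) (fun α => (C (θ (monomial α 1)) : MvPolynomial (Fin d ⊕ Fin 2) T)) α
  rw [coe_basisMonomials] at this
  exact this

theorem bigθ_C_mul (θ : MvPolynomial (Fin d ⊕ Fin 2) T →ₗ[T] T) (c) (b) :
    bigθ θ (C c * b) = c * bigθ θ b := by
  rw [← smul_eq_C_mul, map_smul, smul_eq_mul]

theorem bigθ_map (θ : MvPolynomial (Fin d ⊕ Fin 2) T →ₗ[T] T) (p) :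
    bigθ θ (map C p) = C (θ p) := by
  rw [p.as_sum, map_sum, map_sum, map_sum, map_sum]
  refine Finset.sum_congr rfl fun α _ => ?_
  have hθ : θ (monomial α (coeff α p)) = coeff α p * θ (monomial α 1) := by
    rw [← smul_eq_mul, ← map_smul, smul_monomial, smul_eq_mul, mul_one]
  have e : (monomial α (C (coeff α p)) : MvPolynomial (Fin d ⊕ Fin 2) (MvPolynomial (Fin d ⊕ Fin 2) T)) =
      C (C (coeff α p)) * monomial α 1 := by rw [C_mul_monomial, mul_one]
  rw [hθ, map_monomial, e, bigθ_C_mul, bigθ_mono, C_mul]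

/-- the ideal `(L(x), L(z))`. -/
def LZ (I : Ideal (MvPolynomial (Fin d ⊕ Fin 2) T)) :
    Ideal (MvPolynomial (Fin d ⊕ Fin 2) (MvPolynomial (Fin d ⊕ Fin 2) T)) :=
  I.map C ⊔ I.map (map C)

theorem bigθ_LZ {J : Matrix (Fin d) (Fin d ⊕ Fin 2) T} {a} {θ : MvPolynomial (Fin d ⊕ Fin 2) T →ₗ[T] T}
    (h : Good J a θ) : ∀ b ∈ LZ (LL J a), bigθ θ b ∈ LL J a := by
  intro b hb
  obtain ⟨b1, hb1, b2, hb2, rfl⟩ := Submodule.mem_sup.1 hb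
  rw [map_add]
  refine Ideal.add_mem _ ?_ ?_
  · refine Submodule.span_induction (p := fun b _ => bigθ θ b ∈ LL J a) ?_ ?_ ?_ ?_ hb1
    · rintro _ ⟨l, hl, rfl⟩
      have := bigθ_C_mul θ l 1
      rw [mul_one] at this
      rw [this]; exact Ideal.mul_mem_right _ _ hl
    · simp
    · intro x y _ _ hx hy; rw [map_add]; exact Ideal.add_mem _ hx hy
    · intro c x hx _
      -- need general statement; use mem_map_C_iff instead
      have hx' : c • x ∈ (LL J a).map C := Ideal.mul_mem_left _ _ hx
      rw [mem_map_C_iff] at hx'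
      rw [(c • x).as_sum, map_sum]
      refine Ideal.sum_mem _ fun α _ => ?_
      have e : monomial α (coeff α (c • x)) = C (coeff α (c • x)) * monomial α 1 := by
        rw [C_mul_monomial, mul_one]
      rw [e, bigθ_C_mul]
      exact Ideal.mul_mem_right _ _ (hx' α)
  · have key : ∀ l ∈ LL J a, ∀ b, bigθ θ (b * map C l) = 0 := by
      intro l hl b
      rw [b.as_sum, Finset.sum_mul, map_sum]
      refine Finset.sum_eq_zero fun α _ => ?_
      have e : monomial α (coeff α b) * map C l = C (coeff α b) * (map C (monomial α 1 * l)) := by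
        rw [map_mul, map_monomial, ← mul_assoc, C_mul_monomial, map_one, mul_one]
      rw [e, bigθ_C_mul, bigθ_map, h.kill _ (Ideal.mul_mem_left _ _ hl)]
      simp
    have : bigθ θ b2 = 0 := by
      have hb2' : b2 ∈ Submodule.span _ ((map C : MvPolynomial (Fin d ⊕ Fin 2) T →+*
        MvPolynomial (Fin d ⊕ Fin 2) (MvPolynomial (Fin d ⊕ Fin 2) T)) '' (LL J a : Set _)) := hb2
      obtain ⟨n, f, g, hfg⟩ := Submodule.mem_span_set'.1 hb2'
      rw [← hfg, map_sum]
      refine Finset.sum_eq_zero fun i _ => ?_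
      obtain ⟨l, hl, hl2⟩ := (g i).2
      rw [← hl2, smul_eq_mul]
      exact key l hl _
    rw [this]; exact Ideal.zero_mem _

/-- Morley matrix -/
def NM (J : Matrix (Fin d) (Fin d ⊕ Fin 2) T) (a : Fin 2 → Matrix (Fin d ⊕ Fin 2) (Fin d ⊕ Fin 2) T) :
    Matrix (Fin d ⊕ Fin 2) (Fin d ⊕ Fin 2) (MvPolynomial (Fin d ⊕ Fin 2) (MvPolynomial (Fin d ⊕ Fin 2) T)) :=
  Matrix.fromRows (J.map ((C : MvPolynomial (Fin d ⊕ Fin 2) T →+* _).comp C))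
    ((FM a).map C + (FM (aT a)).map (map C))

theorem NM_mulVec (J : Matrix (Fin d) (Fin d ⊕ Fin 2) T) (a) (i) :
    (NM J a).mulVec (fun r => C (X r) - X r) i =
      C ((gM J (FM a)).mulVec X i) - map C ((gM J (FM a)).mulVec X i) := by
  rcases i with i | i
  · simp [NM, gM, Matrix.mulVec, dotProduct, mul_sub, Finset.sum_sub_distrib]
  · simp only [NM, gM, Matrix.mulVec, dotProduct, Matrix.fromRows_apply_inr, Matrix.add_apply, Matrix.map_apply,
      FM, aT, Matrix.of_apply, Matrix.transpose_apply, map_sum, map_mul, map_C, map_X]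
    have e1 : ∀ t : Fin d ⊕ Fin 2, ((∑ s, C (C (a i t s)) * C (X s)) + ∑ s, C (C (a i s t)) * X s) * (C (X t) - X t) =
      ((∑ s, C (C (a i t s)) * C (X s)) * C (X t) - (∑ s, C (C (a i t s)) * C (X s)) * X t) + 
      ((∑ s, C (C (a i s t)) * X s) * C (X t) - (∑ s, C (C (a i s t)) * X s) * (X t : MvPolynomial (Fin d ⊕ Fin 2) (MvPolynomial (Fin d ⊕ Fin 2) T))) := by
      intro t; ring
    rw [Finset.sum_congr rfl fun t _ => e1 t, Finset.sum_add_distrib, Finset.sum_sub_distrib, Finset.sum_sub_distrib]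
    have e2 : ∑ t : Fin d ⊕ Fin 2, (∑ s, C (C (a i t s)) * C (X s)) * (X t : MvPolynomial (Fin d ⊕ Fin 2) (MvPolynomial (Fin d ⊕ Fin 2) T)) =
      ∑ t : Fin d ⊕ Fin 2, (∑ s, C (C (a i s t)) * X s) * C (X t) := by
      simp only [Finset.sum_mul]
      rw [Finset.sum_comm]
      exact Finset.sum_congr rfl fun _ _ => Finset.sum_congr rfl fun _ _ => by ring
    have e3 : ∑ t : Fin d ⊕ Fin 2, (∑ s, C (C (a i s t)) * X s) * (X t : MvPolynomial (Fin d ⊕ Fin 2) (MvPolynomial (Fin d ⊕ Fin 2) T)) =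
      ∑ t : Fin d ⊕ Fin 2, (∑ s, C (C (a i t s)) * X s) * X t := by
      simp only [Finset.sum_mul]
      rw [Finset.sum_comm]
      exact Finset.sum_congr rfl fun _ _ => Finset.sum_congr rfl fun _ _ => by ring
    rw [e2, e3]; ring

theorem NM_mem (J : Matrix (Fin d) (Fin d ⊕ Fin 2) T) (a) (r) :
    (C (X r) - X r) * (NM J a).det ∈ LZ (LL J a) := by
  have h : (NM J a).adjugate.mulVec ((NM J a).mulVec (fun r => C (X r) - X r)) = (NM J a).det • (fun r => C (X r) - X r) := by
    rw [Matrix.mulVec_mulVec, Matrix.adjugate_mul, Matrix.smul_mulVec, Matrix.one_mulVec]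
  have h1 := congrFun h r
  have h2 : (C (X r) - X r) * (NM J a).det = (NM J a).adjugate.mulVec ((NM J a).mulVec (fun r => C (X r) - X r)) r := by
    rw [h1]; simp [mul_comm]
  rw [h2]
  refine (Ideal.span_le.2 ?_) (span_mulVec_le _ _ (Ideal.subset_span ⟨r, rfl⟩))
  rintro _ ⟨i, rfl⟩
  rw [NM_mulVec]
  have hi : (gM J (FM a)).mulVec X i ∈ LL J a := Ideal.subset_span ⟨i, rfl⟩
  exact Ideal.sub_mem _ (Ideal.mem_sup_left (Ideal.mem_map_of_mem _ hi)) (Ideal.mem_sup_right (Ideal.mem_map_of_mem _ hi))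

theorem FM_homog (a : Fin 2 → Matrix (Fin d ⊕ Fin 2) (Fin d ⊕ Fin 2) T) (i p) : (FM a i p).IsHomogeneous 1 := by
  show (∑ s, C (a i p s) * X s).IsHomogeneous 1
  apply IsHomogeneous.sum
  intro s _
  have := (isHomogeneous_C (Fin d ⊕ Fin 2) (a i p s)).mul (isHomogeneous_X T s)
  simpa using this

theorem NM_det (J : Matrix (Fin d) (Fin d ⊕ Fin 2) T) (a) :
    (NM J a).det = C (syl J a) + map C (syl J (aT a)) +
      (∑ p, ∑ q, C (FM a 0 p * C (Pm J p q)) * map C (FM (aT a) 1 q)) +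
      (∑ p, ∑ q, C (FM a 1 q * C (Pm J p q)) * map C (FM (aT a) 0 p)) := by
  unfold NM
  rw [det_two, syl_eq, syl_eq]
  simp only [map_sum, map_mul, Pm_map, RingHom.comp_apply, map_C, ← Finset.sum_add_distrib]
  refine Finset.sum_congr rfl fun p _ => Finset.sum_congr rfl fun q _ => ?_
  simp only [Matrix.add_apply, Matrix.map_apply]
  ring

theorem morley {J : Matrix (Fin d) (Fin d ⊕ Fin 2) T} {a} {θ : MvPolynomial (Fin d ⊕ Fin 2) T →ₗ[T] T}
    (h : Good J a θ) (s t : Fin d ⊕ Fin 2) :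
    C (θ (syl J (aT a))) * (X s * X t) - C (θ (X s * X t)) * syl J a ∈ LL J a := by
  have h1 : (C (X s * X t) - X s * X t) * (NM J a).det ∈ LZ (LL J a) := by
    have : (C (X s * X t) - X s * X t) * (NM J a).det = C (X s) * ((C (X t) - X t) * (NM J a).det) +
      X t * ((C (X s) - X s) * (NM J a).det) := by rw [C_mul]; ring
    rw [this]
    exact Ideal.add_mem _ (Ideal.mul_mem_left _ _ (NM_mem J a t)) (Ideal.mul_mem_left _ _ (NM_mem J a s))
  have h2 := bigθ_LZ h _ h1
  have hmul : ∀ c p q, bigθ θ (map C p * (C c * map C q)) = c * C (θ (p * q)) := by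
    intro c p q
    rw [mul_left_comm, bigθ_C_mul, ← map_mul, bigθ_map]
  have e1 : bigθ θ (C (X s * X t) * (NM J a).det) = X s * X t * C (θ (syl J (aT a))) := by
    rw [bigθ_C_mul, NM_det, map_add, map_add, map_add, bigθ_map, map_sum, map_sum]
    have z1 : bigθ θ (C (syl J a)) = 0 := by
      have := hmul (syl J a) 1 1
      simp only [map_one, one_mul, mul_one] at this
      rw [this, h.homog (isHomogeneous_one _ _) (by norm_num)]; simp
    rw [z1, Finset.sum_eq_zero, Finset.sum_eq_zero]
    · ring
    · intro p _
      rw [map_sum]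
      refine Finset.sum_eq_zero fun q _ => ?_
      rw [bigθ_C_mul, bigθ_map, h.homog (FM_homog _ _ _) (by norm_num)]; simp
    · intro p _
      rw [map_sum]
      refine Finset.sum_eq_zero fun q _ => ?_
      rw [bigθ_C_mul, bigθ_map, h.homog (FM_homog _ _ _) (by norm_num)]; simp
  have hXX : (X s * X t : MvPolynomial (Fin d ⊕ Fin 2) T).IsHomogeneous 2 := (isHomogeneous_X T s).mul (isHomogeneous_X T t)
  have hsyl : ∀ a, (syl J a).IsHomogeneous 2 := by
    intro a
    rw [syl_eq]
    refine IsHomogeneous.sum _ _ _ fun p _ => IsHomogeneous.sum _ _ _ fun q _ => ?_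
    have := ((FM_homog a 0 p).mul (FM_homog a 1 q)).mul (isHomogeneous_C _ (Pm J p q))
    simpa using this
  have e2 : bigθ θ (X s * X t * (NM J a).det) = C (θ (X s * X t)) * syl J a := by
    have hm : (X s * X t : MvPolynomial (Fin d ⊕ Fin 2) (MvPolynomial (Fin d ⊕ Fin 2) T)) = map C (X s * X t) := by
      rw [map_mul, map_X, map_X]
    rw [hm, NM_det, mul_add, mul_add, mul_add, map_add, map_add, map_add, Finset.mul_sum, Finset.mul_sum, map_sum, map_sum]
    have z1 : bigθ θ (map C (X s * X t) * C (syl J a)) = syl J a * C (θ (X s * X t)) := by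
      have := hmul (syl J a) (X s * X t) 1
      simpa only [map_one, mul_one] using this
    have z2 : bigθ θ (map C (X s * X t) * map C (syl J (aT a))) = 0 := by
      rw [← map_mul, bigθ_map, h.homog (hXX.mul (hsyl _)) (by norm_num)]; simp
    rw [z1, z2, Finset.sum_eq_zero, Finset.sum_eq_zero]
    · ring
    · intro p _
      rw [Finset.mul_sum, map_sum]
      refine Finset.sum_eq_zero fun q _ => ?_
      rw [hmul, h.homog (hXX.mul (FM_homog _ _ _)) (by norm_num)]; simp
    · intro p _
      rw [Finset.mul_sum, map_sum]
      refine Finset.sum_eq_zero fun q _ => ?_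
      rw [hmul, h.homog (hXX.mul (FM_homog _ _ _)) (by norm_num)]; simp
  rw [sub_mul, map_sub, e1, e2] at h2
  convert h2 using 2
  ring

theorem syl_homog (J : Matrix (Fin d) (Fin d ⊕ Fin 2) T) (a) : (syl J a).IsHomogeneous 2 := by
  rw [syl_eq]
  refine IsHomogeneous.sum _ _ _ fun p _ => IsHomogeneous.sum _ _ _ fun q _ => ?_
  have := ((FM_homog a 0 p).mul (FM_homog a 1 q)).mul (isHomogeneous_C _ (Pm J p q))
  simpa using this

end Morley
end
end CI16

namespace CI16
section

section Ext
variable {T V : Type*} [CommRing T] [CommRing V] {d : ℕ} (h : T →+* V)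

/-- base change of matrices -/
def aMap (a : Fin 2 → Matrix (Fin d ⊕ Fin 2) (Fin d ⊕ Fin 2) T) :
    Fin 2 → Matrix (Fin d ⊕ Fin 2) (Fin d ⊕ Fin 2) V := fun i => (a i).map h

theorem gM_map (J : Matrix (Fin d) (Fin d ⊕ Fin 2) T) (a) :
    (gM J (FM a)).map (map h) = gM (J.map h) (FM (aMap h a)) := by
  ext1 i j
  rcases i with i | i
  · simp [gM]
  · simp [gM, FM, aMap]

theorem LL_map (J : Matrix (Fin d) (Fin d ⊕ Fin 2) T) (a) :
    (LL J a).map (map h) = LL (J.map h) (aMap h a) := by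
  unfold LL
  rw [Ideal.map_span, ← Set.range_comp, ← gM_map]
  congr 2
  funext i
  simp [Matrix.mulVec, dotProduct]

theorem syl_map (J : Matrix (Fin d) (Fin d ⊕ Fin 2) T) (a) :
    map h (syl J a) = syl (J.map h) (aMap h a) := by
  unfold syl
  rw [RingHom.map_det, ← gM_map]
  rfl

theorem aT_aMap (a : Fin 2 → Matrix (Fin d ⊕ Fin 2) (Fin d ⊕ Fin 2) T) :
    aT (aMap h a) = aMap h (aT a) := rfl

/-- extension of functionals -/
def extθ (θ : MvPolynomial (Fin d ⊕ Fin 2) T →ₗ[T] T) :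
    MvPolynomial (Fin d ⊕ Fin 2) V →ₗ[V] V :=
  (basisMonomials (Fin d ⊕ Fin 2) V).constr V (fun α => h (θ (monomial α 1)))

theorem extθ_mono (θ : MvPolynomial (Fin d ⊕ Fin 2) T →ₗ[T] T) (α) :
    extθ h θ (monomial α 1) = h (θ (monomial α 1)) := by
  have := (basisMonomials (Fin d ⊕ Fin 2) V).constr_basis V (fun α => h (θ (monomial α 1))) α
  rw [coe_basisMonomials] at this
  exact this

theorem lin_monomial (θ : MvPolynomial (Fin d ⊕ Fin 2) T →ₗ[T] T) (α t) :
    θ (monomial α t) = t * θ (monomial α 1) := by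
  rw [← smul_eq_mul, ← map_smul, smul_monomial, smul_eq_mul, mul_one]

theorem lin_C_mul (θ : MvPolynomial (Fin d ⊕ Fin 2) T →ₗ[T] T) (c p) :
    θ (C c * p) = c * θ p := by
  rw [← smul_eq_C_mul, map_smul, smul_eq_mul]

theorem extθ_map (θ : MvPolynomial (Fin d ⊕ Fin 2) T →ₗ[T] T) (p) :
    extθ h θ (map h p) = h (θ p) := by
  rw [p.as_sum, map_sum, map_sum, map_sum, map_sum]
  refine Finset.sum_congr rfl fun α _ => ?_
  rw [lin_monomial θ, map_monomial, lin_monomial (extθ h θ), extθ_mono, map_mul]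

theorem Good.ext {J : Matrix (Fin d) (Fin d ⊕ Fin 2) T} {a} {θ : MvPolynomial (Fin d ⊕ Fin 2) T →ₗ[T] T}
    (hg : Good J a θ) : Good (J.map h) (aMap h a) (extθ h θ) := by
  constructor
  · intro p hp
    rw [← LL_map] at hp
    obtain ⟨n, f, g, hfg⟩ := Submodule.mem_span_set'.1 hp
    rw [← hfg, map_sum]
    refine Finset.sum_eq_zero fun i _ => ?_
    obtain ⟨l, hl, hl2⟩ := (g i).2
    rw [← hl2, smul_eq_mul, (f i).as_sum, Finset.sum_mul, map_sum]
    refine Finset.sum_eq_zero fun α _ => ?_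
    have e : monomial α (coeff α (f i)) * map h l = C (coeff α (f i)) * (map h (monomial α 1 * l)) := by
      rw [map_mul, map_monomial, ← mul_assoc, C_mul_monomial, map_one, mul_one]
    rw [e, lin_C_mul, extθ_map, hg.kill _ (Ideal.mul_mem_left _ _ hl), map_zero, mul_zero]
  · intro α hα
    rw [extθ_mono, hg.deg α hα, map_zero]

end Ext

section CoreV
variable {V : Type*} [CommRing V] [IsDomain V] {d : ℕ}

theorem good_syl_eq {J : Matrix (Fin d) (Fin d ⊕ Fin 2) V} {a} {θ : MvPolynomial (Fin d ⊕ Fin 2) V →ₗ[V] V}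
    (hg : Good J a θ) {s t} (hst : θ (X s * X t) ≠ 0) : θ (syl J (aT a)) = θ (syl J a) := by
  have := hg.kill _ (morley hg s t)
  rw [map_sub, lin_C_mul, lin_C_mul, sub_eq_zero, mul_comm] at this
  exact mul_left_cancel₀ hst this

theorem sub_C_syl_mem (J : Matrix (Fin d) (Fin d ⊕ Fin 2) V) (a) (b : MvPolynomial (Fin d ⊕ Fin 2) V) :
    b * syl J a - C (coeff 0 b) * syl J a ∈ LL J a := by
  induction b using MvPolynomial.induction_on with
  | C c => simp
  | add p q hp hq =>
    rw [coeff_add, C_add]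
    convert Ideal.add_mem _ hp hq using 1
    ring
  | mul_X p r hp =>
    have : coeff 0 (p * X r) = 0 := by
      rw [← constantCoeff_eq]; simp
    rw [this, C_0, zero_mul, sub_zero, mul_assoc]
    exact Ideal.mul_mem_left _ _ (X_mul_syl_mem J a r)

theorem wie_C {J : Matrix (Fin d) (Fin d ⊕ Fin 2) V} {a} (hW : Wie X (gM J (FM a)))
    (p) (hp : ∀ r, p * X r ∈ LL J a) : ∃ b : V, p - C b * syl J a ∈ LL J a := by
  obtain ⟨l, hl, w, hw, hlw⟩ := Submodule.mem_sup.1 (hW p hp)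
  obtain ⟨b, rfl⟩ := Ideal.mem_span_singleton'.1 hw
  refine ⟨coeff 0 b, ?_⟩
  have : l + (b * syl J a - C (coeff 0 b) * syl J a) ∈ LL J a := Ideal.add_mem _ hl (sub_C_syl_mem J a b)
  convert this using 1
  rw [← hlw]; unfold syl; ring

/-- torsion condition -/
def Tor (J : Matrix (Fin d) (Fin d ⊕ Fin 2) V) (a : Fin 2 → Matrix (Fin d ⊕ Fin 2) (Fin d ⊕ Fin 2) V) (t : V) (N : ℕ) : Prop :=
  ∀ μ : (Fin d ⊕ Fin 2) →₀ ℕ, μ.degree = N → monomial μ t ∈ LL J a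

theorem Tor.succ {J : Matrix (Fin d) (Fin d ⊕ Fin 2) V} {a} {t : V} {N : ℕ} (h : Tor J a t N) :
    Tor J a t (N + 1) := by
  intro μ hμ
  have : μ ≠ 0 := by rintro rfl; simp at hμ
  obtain ⟨r, hr⟩ := Finsupp.ne_iff.1 this
  have h1 : Finsupp.single r 1 ≤ μ := by
    rw [Finsupp.single_le_iff]; exact Nat.one_le_iff_ne_zero.2 hr
  have h2 : monomial μ t = monomial (μ - Finsupp.single r 1) t * X r := by
    rw [X, monomial_mul, mul_one, tsub_add_cancel_of_le h1]
  rw [h2]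
  refine Ideal.mul_mem_right _ _ (h _ ?_)
  have h3 : (μ - Finsupp.single r 1 + Finsupp.single r 1).degree = N + 1 := by
    rw [tsub_add_cancel_of_le h1, hμ]
  rw [map_add, Finsupp.degree_single] at h3
  omega

theorem Tor.le {J : Matrix (Fin d) (Fin d ⊕ Fin 2) V} {a} {t : V} {N M : ℕ} (h : Tor J a t N) (hM : N ≤ M) :
    Tor J a t M := by
  induction M, hM using Nat.le_induction with
  | base => exact h
  | succ M _ ih => exact ih.succ

theorem Tor.wie {J : Matrix (Fin d) (Fin d ⊕ Fin 2) V} {a} (hW : Wie X (gM J (FM a))) {t : V} {N : ℕ}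
    (h : Tor J a t (N + 1)) (μ : (Fin d ⊕ Fin 2) →₀ ℕ) (hμ : μ.degree = N) :
    ∃ b : V, monomial μ t - C b * syl J a ∈ LL J a := by
  apply wie_C hW
  intro r
  rw [X, monomial_mul, mul_one]
  apply h
  rw [map_add, hμ, Finsupp.degree_single]

theorem core_V {J : Matrix (Fin d) (Fin d ⊕ Fin 2) V} {a} (hW : Wie X (gM J (FM a)))
    {θ : MvPolynomial (Fin d ⊕ Fin 2) V →ₗ[V] V} (hg : Good J a θ) {s u} (hsu : IsUnit (θ (X s * X u)))
    {t : V} {N : ℕ} (ht : Tor J a t N) : θ (syl J (aT a)) ∣ t := by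
  have hsyl := good_syl_eq hg hsu.ne_zero
  have key : ∀ j, Tor J a t (j + 3) := by
    have h0 : Tor J a t (N + 3) := ht.le (by omega)
    have hdown : ∀ j, Tor J a t (j + 3 + 1) → Tor J a t (j + 3) := by
      intro j hj μ hμ
      obtain ⟨b, hb⟩ := hj.wie hW μ hμ
      have h1 := hg.kill _ hb
      rw [map_sub, lin_C_mul, lin_monomial, hg.deg μ (by omega), mul_zero, zero_sub, neg_eq_zero] at h1
      have h2 : C b * syl J a ∈ LL J a := by
        rcases mul_eq_zero.1 h1 with h1 | h1
        · rw [h1]; simp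
        · have h3 := morley hg s u
          rw [hsyl, h1, C_0, zero_mul, zero_sub] at h3
          have h4 := Ideal.mul_mem_left _ (C (hsu.unit⁻¹ : Vˣ).1) ((Submodule.neg_mem_iff _).1 h3)
          rw [← mul_assoc, ← C_mul] at h4
          have h5 : ((hsu.unit⁻¹ : Vˣ) : V) * θ (X s * X u) = 1 := hsu.val_inv_mul
          rw [h5, C_1, one_mul] at h4
          exact Ideal.mul_mem_left _ _ h4
      have := Ideal.add_mem _ hb h2
      rwa [sub_add_cancel] at this
    intro j
    by_cases hjN : N ≤ j
    · exact h0.le (by omega)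
    · have : ∀ i, i ≤ N → Tor J a t (N - i + 3) := by
        intro i
        induction i with
        | zero => intro _; exact h0
        | succ i ih =>
          intro hi
          apply hdown
          have := ih (by omega)
          rwa [show N - (i + 1) + 3 + 1 = N - i + 3 by omega]
      have h2 := this (N - j) (by omega)
      rwa [show N - (N - j) = j by omega] at h2
  obtain ⟨b, hb⟩ := (key 0 : Tor J a t (2 + 1)).wie hW (Finsupp.single s 1 + Finsupp.single u 1)
    (by rw [map_add, Finsupp.degree_single, Finsupp.degree_single])
  have h1 := hg.kill _ hb
  have e : (monomial (Finsupp.single s 1 + Finsupp.single u 1) t : MvPolynomial (Fin d ⊕ Fin 2) V) = C t * (X s * X u) := by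
    rw [X, X, monomial_mul, C_mul_monomial]; simp
  rw [e, map_sub, lin_C_mul, lin_C_mul, sub_eq_zero, ← hsyl] at h1
  have h2 : θ (syl J (aT a)) ∣ t * θ (X s * X u) := ⟨b, by rw [h1, mul_comm]⟩
  exact (hsu.dvd_mul_right).1 h2

end CoreV

section Core
variable {T : Type*} [CommRing T] [IsDomain T] [IsNoetherianRing T] {d : ℕ}

/-- height hypothesis -/
def HT (J : Matrix (Fin d) (Fin d ⊕ Fin 2) T) (a : Fin 2 → Matrix (Fin d ⊕ Fin 2) (Fin d ⊕ Fin 2) T) : Prop :=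
  ∀ Q : Ideal (MvPolynomial (Fin d ⊕ Fin 2) T), Q.IsPrime → LL J a ≤ Q → ((d + 2 : ℕ) : ℕ∞) ≤ Q.height

theorem HH_loc {J : Matrix (Fin d) (Fin d ⊕ Fin 2) T} {a} (hT : HT J a) (M : Submonoid T)
    (V : Type*) [CommRing V] [Algebra T V] [IsLocalization M V] :
    HH (d + 1) (LL (J.map (algebraMap T V)) (aMap (algebraMap T V) a)) := by
  intro s hs hle
  by_contra hne
  haveI : IsNoetherianRing V := IsLocalization.isNoetherianRing M V inferInstance
  obtain ⟨P, hP⟩ := Ideal.nonempty_minimalPrimes hne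
  have hPp : P.IsPrime := hP.1.1
  have h1 := Ideal.height_le_card_of_mem_minimalPrimes_span_finset hP
  letI : Algebra (MvPolynomial (Fin d ⊕ Fin 2) T) (MvPolynomial (Fin d ⊕ Fin 2) V) := (map (algebraMap T V)).toAlgebra
  haveI : IsLocalization (M.map (C : T →+* MvPolynomial (Fin d ⊕ Fin 2) T)) (MvPolynomial (Fin d ⊕ Fin 2) V) :=
    MvPolynomial.isLocalization M V
  have h2 := IsLocalization.height_under (M.map (C : T →+* MvPolynomial (Fin d ⊕ Fin 2) T)) P
  have h3 := hT (P.under _) inferInstance (by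
    rw [Ideal.under, ← Ideal.map_le_iff_le_comap]
    show (LL J a).map (map (algebraMap T V)) ≤ P
    rw [LL_map]
    exact hle.trans hP.1.2)
  rw [h2] at h3
  have := (h3.trans h1).trans (Nat.cast_le.2 hs)
  rw [Nat.cast_le] at this
  omega

theorem Wie_loc (hd : 1 ≤ d) {J : Matrix (Fin d) (Fin d ⊕ Fin 2) T} {a} (hT : HT J a) (M : Submonoid T)
    (V : Type*) [CommRing V] [IsDomain V] [IsLocalRing V] [IsPrincipalIdealRing V] [Algebra T V] [IsLocalization M V] :
    Wie X (gM (J.map (algebraMap T V)) (FM (aMap (algebraMap T V) a))) :=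
  Wie_gM hd _ _ (HH_loc hT M V)

variable [UniqueFactorizationMonoid T]

theorem Tor.map {V : Type*} [CommRing V] [IsDomain V] (h : T →+* V) {J : Matrix (Fin d) (Fin d ⊕ Fin 2) T} {a} {t : T} {N : ℕ}
    (ht : Tor J a t N) : Tor (J.map h) (aMap h a) (h t) N := by
  intro μ hμ
  rw [← LL_map, ← map_monomial]
  exact Ideal.mem_map_of_mem _ (ht μ hμ)

theorem pid_loc {π : T} (hπ : Prime π) (P : Ideal T) [P.IsPrime] (hP : P = Ideal.span {π}) :
    IsPrincipalIdealRing (Localization.AtPrime P) := by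
  have h := (tfae_of_isNoetherianRing_of_isLocalRing_of_isDomain (Localization.AtPrime P)).out 0 4
  rw [h, ← Localization.AtPrime.map_eq_maximalIdeal]
  have : Ideal.map (algebraMap T (Localization.AtPrime P)) P = Ideal.map (algebraMap T (Localization.AtPrime P)) (Ideal.span {π}) :=
    congrArg _ hP
  rw [this, Ideal.map_span, Set.image_singleton]
  exact ⟨_, rfl⟩

theorem dvd_of_loc {t₁ t : T} (h : ∀ π : T, Prime π → ∃ s, ¬ π ∣ s ∧ t₁ ∣ s * t) (h0 : t₁ ≠ 0 ∨ ∃ s, s ≠ 0 ∧ t₁ ∣ s * t) : t₁ ∣ t := by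
  by_cases ht1 : t₁ = 0
  · obtain ⟨s, hs, h2⟩ := h0.resolve_left (by simpa using ht1)
    rw [ht1, zero_dvd_iff] at h2 ⊢
    exact (mul_eq_zero.1 h2).resolve_left hs
  clear h0
  revert t
  suffices H : ∀ t, (∀ π : T, Prime π → ∃ s, ¬ π ∣ s ∧ t₁ ∣ s * t) → t₁ ∣ t by
    intro t h; exact H t h
  revert ht1
  refine UniqueFactorizationMonoid.induction_on_prime t₁ ?_ ?_ ?_
  · intro h; exact absurd rfl h
  · intro x hx _ t _; exact hx.dvd
  · intro a p ha hp ih _ t h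
    have hpt : p ∣ t := by
      obtain ⟨s, hs, h2⟩ := h p hp
      exact (hp.dvd_or_dvd ((dvd_mul_right p a).trans h2)).resolve_left hs
    obtain ⟨t, rfl⟩ := hpt
    refine mul_dvd_mul_left p (ih ha t ?_)
    intro π hπ
    obtain ⟨s, hs, h2⟩ := h π hπ
    refine ⟨s, hs, ?_⟩
    rw [mul_left_comm] at h2
    exact (mul_dvd_mul_iff_left hp.ne_zero).1 h2

theorem core (hd : 1 ≤ d) {J : Matrix (Fin d) (Fin d ⊕ Fin 2) T} {a} (hT : HT J a)
    {θ : MvPolynomial (Fin d ⊕ Fin 2) T →ₗ[T] T} (hg : Good J a θ)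
    (hprim : ∀ π : T, Prime π → ∃ s u, ¬ π ∣ θ (X s * X u)) (hne : ∃ s u, θ (X s * X u) ≠ 0) (t : T) :
    (∃ N, Tor J a t N) ↔ θ (syl J (aT a)) ∣ t := by
  constructor
  · rintro ⟨N, ht⟩
    apply dvd_of_loc
    · intro π hπ
      haveI : (Ideal.span {π}).IsPrime := (Ideal.span_singleton_prime hπ.ne_zero).2 hπ
      set V := Localization.AtPrime (Ideal.span {π})
      haveI : IsPrincipalIdealRing V := pid_loc hπ _ rfl
      have hW : Wie X (gM (J.map (algebraMap T V)) (FM (aMap (algebraMap T V) a))) :=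
        Wie_loc hd hT (Ideal.span {π}).primeCompl V
      obtain ⟨s, u, hsu⟩ := hprim π hπ
      have hu : IsUnit (extθ (algebraMap T V) θ (X s * X u)) := by
        have e : (X s * X u : MvPolynomial (Fin d ⊕ Fin 2) V) = MvPolynomial.map (algebraMap T V) (X s * X u) := by simp
        rw [e, extθ_map]
        exact IsLocalization.map_units V (⟨_, by rw [Ideal.mem_primeCompl_iff, Ideal.mem_span_singleton]; exact hsu⟩ : (Ideal.span {π}).primeCompl)
      have h1 := core_V hW (hg.ext _) hu (ht.map _)
      rw [aT_aMap, ← syl_map, extθ_map] at h1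
      obtain ⟨b, hb⟩ := h1
      obtain ⟨⟨b', s'⟩, hb'⟩ := IsLocalization.surj (Ideal.span {π}).primeCompl b
      refine ⟨s'.1, ?_, b', ?_⟩
      · have := s'.2
        rwa [Ideal.mem_primeCompl_iff, Ideal.mem_span_singleton] at this
      · apply IsLocalization.injective V (Ideal.primeCompl_le_nonZeroDivisors (Ideal.span {π}))
        rw [_root_.map_mul, _root_.map_mul, hb, ← hb']; ring
    · right
      set V := FractionRing T
      have hW : Wie X (gM (J.map (algebraMap T V)) (FM (aMap (algebraMap T V) a))) :=
        Wie_loc hd hT (nonZeroDivisors T) V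
      obtain ⟨s, u, hsu⟩ := hne
      have hu : IsUnit (extθ (algebraMap T V) θ (X s * X u)) := by
        have e : (X s * X u : MvPolynomial (Fin d ⊕ Fin 2) V) = MvPolynomial.map (algebraMap T V) (X s * X u) := by simp
        rw [e, extθ_map]
        exact IsLocalization.map_units V (⟨_, mem_nonZeroDivisors_of_ne_zero hsu⟩ : nonZeroDivisors T)
      have h1 := core_V hW (hg.ext _) hu (ht.map _)
      rw [aT_aMap, ← syl_map, extθ_map] at h1
      obtain ⟨b, hb⟩ := h1
      obtain ⟨⟨b', s'⟩, hb'⟩ := IsLocalization.surj (nonZeroDivisors T) b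
      refine ⟨s'.1, nonZeroDivisors.ne_zero s'.2, b', ?_⟩
      apply IsFractionRing.injective T V
      rw [_root_.map_mul, _root_.map_mul, hb, ← hb']; ring
  · rintro ⟨c, rfl⟩
    refine ⟨3, ?_⟩
    have h2 : Tor J a (θ (syl J (aT a))) 3 := by
      intro μ hμ
      have hμ' : ∃ r s u, μ = Finsupp.single r 1 + (Finsupp.single s 1 + Finsupp.single u 1) := by
        have step : ∀ (n : ℕ) (ν : (Fin d ⊕ Fin 2) →₀ ℕ), ν.degree = n + 1 → ∃ r ν', ν = Finsupp.single r 1 + ν' ∧ ν'.degree = n := by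
          intro n ν hν
          have : ν ≠ 0 := by rintro rfl; simp at hν
          obtain ⟨r, hr⟩ := Finsupp.ne_iff.1 this
          have h1 : Finsupp.single r 1 ≤ ν := by
            rw [Finsupp.single_le_iff]; exact Nat.one_le_iff_ne_zero.2 hr
          refine ⟨r, ν - Finsupp.single r 1, (add_tsub_cancel_of_le h1).symm, ?_⟩
          have h3 : (Finsupp.single r 1 + (ν - Finsupp.single r 1)).degree = n + 1 := by
            rw [add_tsub_cancel_of_le h1, hν]
          rw [map_add, Finsupp.degree_single] at h3
          omega
        obtain ⟨r, ν, rfl, hν⟩ := step 2 μ hμ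
        obtain ⟨s, ν, rfl, hν1⟩ := step 1 ν hν
        obtain ⟨u, ν, rfl, hν2⟩ := step 0 ν hν1
        rw [Finsupp.degree_eq_zero_iff] at hν2
        exact ⟨r, s, u, by rw [hν2, add_zero]⟩
      obtain ⟨r, s, u, rfl⟩ := hμ'
      have e : (monomial (Finsupp.single r 1 + (Finsupp.single s 1 + Finsupp.single u 1)) (θ (syl J (aT a))) : MvPolynomial (Fin d ⊕ Fin 2) T)
          = X r * (C (θ (syl J (aT a))) * (X s * X u) - C (θ (X s * X u)) * syl J a) + C (θ (X s * X u)) * (X r * syl J a) := by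
        have : (monomial (Finsupp.single r 1 + (Finsupp.single s 1 + Finsupp.single u 1)) (θ (syl J (aT a))) : MvPolynomial (Fin d ⊕ Fin 2) T) = C (θ (syl J (aT a))) * (X r * (X s * X u)) := by
          rw [X, X, X, monomial_mul, monomial_mul, C_mul_monomial]; simp
        rw [this]; ring
      rw [e]
      exact Ideal.add_mem _ (Ideal.mul_mem_left _ _ (morley hg s u)) (Ideal.mul_mem_left _ _ (X_mul_syl_mem J a r))
    intro μ hμ
    have := Ideal.mul_mem_right (C c) _ (h2 μ hμ)
    rwa [mul_comm, C_mul_monomial, mul_comm] at this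

end Core
end
end CI16

namespace CI16
section

theorem deg_succ {σ : Type*} (n : ℕ) (ν : σ →₀ ℕ) (hν : ν.degree = n + 1) :
    ∃ r ν', ν = Finsupp.single r 1 + ν' ∧ ν'.degree = n := by
  have : ν ≠ 0 := by rintro rfl; simp at hν
  obtain ⟨r, hr⟩ := Finsupp.ne_iff.1 this
  have h1 : Finsupp.single r 1 ≤ ν := by
    rw [Finsupp.single_le_iff]; exact Nat.one_le_iff_ne_zero.2 hr
  refine ⟨r, ν - Finsupp.single r 1, (add_tsub_cancel_of_le h1).symm, ?_⟩
  have h3 : (Finsupp.single r 1 + (ν - Finsupp.single r 1)).degree = n + 1 := by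
    rw [add_tsub_cancel_of_le h1, hν]
  rw [map_add, Finsupp.degree_single] at h3
  omega

theorem mono_two {σ T : Type*} [CommRing T] (α : σ →₀ ℕ) (hα : α.degree = 2) :
    ∃ s u, (monomial α 1 : MvPolynomial σ T) = X s * X u := by
  obtain ⟨s, β, rfl, h1⟩ := deg_succ 1 α hα
  obtain ⟨u, γ, rfl, h2⟩ := deg_succ 0 β h1
  rw [Finsupp.degree_eq_zero_iff] at h2
  refine ⟨s, u, ?_⟩
  rw [h2, add_zero, X, X, monomial_mul, one_mul]

section Desc
variable {T K : Type*} [CommRing T] [CommRing K] {d : ℕ}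

theorem descend (h : T →+* K) (hi : Function.Injective h) {J : Matrix (Fin d) (Fin d ⊕ Fin 2) T}
    {a : Fin 2 → Matrix (Fin d ⊕ Fin 2) (Fin d ⊕ Fin 2) T}
    {θ0 : MvPolynomial (Fin d ⊕ Fin 2) K →ₗ[K] K} (hg : Good (J.map h) (aMap h a) θ0) (c : K)
    (hw : ∀ s u, ∃ w, h w = c * θ0 (X s * X u)) :
    ∃ θ : MvPolynomial (Fin d ⊕ Fin 2) T →ₗ[T] T, Good J a θ ∧ ∀ p, h (θ p) = c * θ0 (map h p) := by
  have hv : ∀ α, ∃ w, h w = c * θ0 (monomial α 1) := by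
    intro α
    by_cases hα : α.degree = 2
    · obtain ⟨s, u, e⟩ := mono_two (T := K) α hα
      rw [e]; exact hw s u
    · exact ⟨0, by rw [hg.deg α hα]; simp⟩
  choose v hv using hv
  have hθ : ∃ θ : MvPolynomial (Fin d ⊕ Fin 2) T →ₗ[T] T, ∀ α, θ (monomial α 1) = v α := by
    refine ⟨(basisMonomials (Fin d ⊕ Fin 2) T).constr T v, fun α => ?_⟩
    have := (basisMonomials (Fin d ⊕ Fin 2) T).constr_basis T v α
    rw [coe_basisMonomials] at this
    exact this
  obtain ⟨θ, hθ⟩ := hθ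
  have key : ∀ p, h (θ p) = c * θ0 (map h p) := by
    intro p
    rw [p.as_sum, map_sum, map_sum, map_sum, map_sum, Finset.mul_sum]
    refine Finset.sum_congr rfl fun α _ => ?_
    rw [lin_monomial θ, map_monomial, lin_monomial θ0, hθ, map_mul, hv]; ring
  refine ⟨θ, ⟨?_, ?_⟩, key⟩
  · intro p hp
    apply hi
    rw [key, hg.kill _ (by rw [← LL_map]; exact Ideal.mem_map_of_mem _ hp), mul_zero, map_zero]
  · intro α hα
    apply hi
    rw [key, map_monomial, map_one, hg.deg α hα, mul_zero, map_zero]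

theorem good_div [IsDomain T] {J : Matrix (Fin d) (Fin d ⊕ Fin 2) T}
    {a : Fin 2 → Matrix (Fin d ⊕ Fin 2) (Fin d ⊕ Fin 2) T}
    {θ : MvPolynomial (Fin d ⊕ Fin 2) T →ₗ[T] T} (hg : Good J a θ) (c : T) (hc : c ≠ 0)
    (hw : ∀ s u, c ∣ θ (X s * X u)) :
    ∃ θ' : MvPolynomial (Fin d ⊕ Fin 2) T →ₗ[T] T, Good J a θ' ∧ ∀ p, θ p = c * θ' p := by
  have hi := IsFractionRing.injective T (FractionRing T)
  have hc' : algebraMap T (FractionRing T) c ≠ 0 := by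
    intro h0; exact hc (hi (by rw [h0, map_zero]))
  obtain ⟨θ', h1, h2⟩ := descend (algebraMap T (FractionRing T)) hi
    (hg.ext _) (algebraMap T (FractionRing T) c)⁻¹ (by
      intro s u
      obtain ⟨w, hw⟩ := hw s u
      refine ⟨w, ?_⟩
      have e : (X s * X u : MvPolynomial (Fin d ⊕ Fin 2) (FractionRing T)) = MvPolynomial.map (algebraMap T (FractionRing T)) (X s * X u) := by simp
      rw [e, extθ_map, hw, map_mul, inv_mul_cancel_left₀ hc'])
  refine ⟨θ', h1, fun p => hi ?_⟩
  rw [map_mul, h2, extθ_map, mul_inv_cancel_left₀ hc']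

theorem LL_homog (J : Matrix (Fin d) (Fin d ⊕ Fin 2) T)
    (a : Fin 2 → Matrix (Fin d ⊕ Fin 2) (Fin d ⊕ Fin 2) T) {p} (hp : p ∈ LL J a) (n : ℕ) :
    homogeneousComponent n p ∈ LL J a := by
  letI : GradedAlgebra (homogeneousSubmodule (Fin d ⊕ Fin 2) T) := MvPolynomial.gradedAlgebra
  have : (LL J a).IsHomogeneous (homogeneousSubmodule (Fin d ⊕ Fin 2) T) := by
    apply Ideal.homogeneous_span
    rintro _ ⟨i, rfl⟩
    rcases i with i | i
    · refine ⟨1, ?_⟩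
      rw [mem_homogeneousSubmodule]
      simp only [gM, Matrix.mulVec, dotProduct, Matrix.fromRows_apply_inl, Matrix.map_apply]
      apply IsHomogeneous.sum
      intro s _
      have := (isHomogeneous_C (Fin d ⊕ Fin 2) (J i s)).mul (isHomogeneous_X T s)
      simpa using this
    · refine ⟨2, ?_⟩
      rw [mem_homogeneousSubmodule]
      simp only [gM, Matrix.mulVec, dotProduct, Matrix.fromRows_apply_inr]
      apply IsHomogeneous.sum
      intro s _
      exact (FM_homog a i s).mul (isHomogeneous_X T s)
  exact (mem_iff_homogeneousComponent_mem this p).1 hp n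

theorem LL_const (J : Matrix (Fin d) (Fin d ⊕ Fin 2) T)
    (a : Fin 2 → Matrix (Fin d ⊕ Fin 2) (Fin d ⊕ Fin 2) T) {p} (hp : p ∈ LL J a) : constantCoeff p = 0 := by
  have : LL J a ≤ RingHom.ker (constantCoeff : MvPolynomial (Fin d ⊕ Fin 2) T →+* T) := by
    refine (span_mulVec_le _ _).trans ?_
    rw [Ideal.span_le]
    rintro _ ⟨i, rfl⟩
    simp
  exact this hp

end Desc

section Part1
variable {T : Type*} [CommRing T] [IsDomain T] [IsNoetherianRing T] [UniqueFactorizationMonoid T] {d : ℕ}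

theorem syl_notMem {K : Type*} [Field K] {J : Matrix (Fin d) (Fin d ⊕ Fin 2) K}
    {a : Fin 2 → Matrix (Fin d ⊕ Fin 2) (Fin d ⊕ Fin 2) K} (hW : Wie X (gM J (FM a)))
    {t : K} (ht : t ≠ 0) {N : ℕ} (hN : Tor J a t N) : syl J a ∉ LL J a := by
  intro hs
  have hdown : ∀ j, Tor J a t (j + 1) → Tor J a t j := by
    intro j hj μ hμ
    obtain ⟨b, hb⟩ := hj.wie hW μ hμ
    have := Ideal.add_mem _ hb (Ideal.mul_mem_left _ (C b) hs)
    rwa [sub_add_cancel] at this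
  have h0 : Tor J a t 0 := by
    induction N with
    | zero => exact hN
    | succ N ih => exact ih (hdown N hN)
  have := LL_const J a (h0 0 (by simp))
  simp at this
  exact ht this

theorem exists_good_field {K : Type*} [Field K] {J : Matrix (Fin d) (Fin d ⊕ Fin 2) K}
    {a : Fin 2 → Matrix (Fin d ⊕ Fin 2) (Fin d ⊕ Fin 2) K} (hs : syl J a ∉ LL J a) :
    ∃ θ, Good J a θ ∧ θ (syl J a) ≠ 0 := by
  obtain ⟨l, h1, h2⟩ := Submodule.exists_le_ker_of_notMem (K := K) (p := (LL J a).restrictScalars K) (v := syl J a) hs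
  refine ⟨l ∘ₗ homogeneousComponent 2, ⟨?_, ?_⟩, ?_⟩
  · intro p hp
    exact h2 (LL_homog J a hp 2)
  · intro α hα
    rw [LinearMap.comp_apply, homogeneousComponent_of_mem (n := α.degree) (isHomogeneous_monomial _ rfl), if_neg (by omega), map_zero]
  · rw [LinearMap.comp_apply, homogeneousComponent_of_mem (m := 2) (syl_homog J a), if_pos rfl]
    exact h1

theorem exists_good (hd : 1 ≤ d) {J : Matrix (Fin d) (Fin d ⊕ Fin 2) T} {a} (hT : HT J a)
    {t : T} (ht : t ≠ 0) {N : ℕ} (hN : Tor J a t N) :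
    ∃ θ, Good J a θ ∧ (∀ π : T, Prime π → ∃ s u, ¬ π ∣ θ (X s * X u)) ∧ (∃ s u, θ (X s * X u) ≠ 0) := by
  classical
  set K := FractionRing T
  set h := algebraMap T K
  have hi : Function.Injective h := IsFractionRing.injective T K
  have hW : Wie X (gM (J.map h) (FM (aMap h a))) := Wie_loc hd hT (nonZeroDivisors T) K
  have hs := syl_notMem hW (t := h t) (by intro h0; exact ht (hi (by rw [h0, map_zero]))) (hN.map h)
  obtain ⟨θ0, hg0, hθ0⟩ := exists_good_field hs
  obtain ⟨c, hc⟩ := IsLocalization.exist_integer_multiples_of_finite (nonZeroDivisors T)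
    (fun su : (Fin d ⊕ Fin 2) × (Fin d ⊕ Fin 2) => θ0 (X su.1 * X su.2))
  have hc0 : h c ≠ 0 := by
    intro h0; exact nonZeroDivisors.ne_zero c.2 (hi (by rw [h0, map_zero]))
  obtain ⟨θ1, hg1, hθ1⟩ := descend h hi hg0 (h c) (by
    intro s u
    obtain ⟨w, hw⟩ := hc (s, u)
    exact ⟨w, by rw [hw, Algebra.smul_def]⟩)
  have hne1 : ∃ s u, θ1 (X s * X u) ≠ 0 := by
    by_contra hall
    push Not at hall
    have hz : ∀ α, θ1 (monomial α 1) = 0 := by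
      intro α
      by_cases hα : α.degree = 2
      · obtain ⟨s, u, e⟩ := mono_two (T := T) α hα
        rw [e, hall]
      · exact hg1.deg α hα
    have hz2 : θ1 (syl J a) = 0 := by
      rw [(syl J a).as_sum, map_sum]
      refine Finset.sum_eq_zero fun α _ => ?_
      rw [lin_monomial, hz, mul_zero]
    have := hθ1 (syl J a)
    rw [hz2, syl_map, map_zero] at this
    exact (mul_ne_zero hc0 hθ0) this.symm
  letI : StrongNormalizationMonoid T := UniqueFactorizationMonoid.normalizationMonoid
  letI : NormalizedGCDMonoid T := UniqueFactorizationMonoid.toNormalizedGCDMonoid T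
  obtain ⟨g, hg, hg'⟩ := Finset.extract_gcd (s := Finset.univ)
    (fun su : (Fin d ⊕ Fin 2) × (Fin d ⊕ Fin 2) => θ1 (X su.1 * X su.2)) ⟨(Sum.inr 0, Sum.inr 0), Finset.mem_univ _⟩
  set D := Finset.univ.gcd (fun su : (Fin d ⊕ Fin 2) × (Fin d ⊕ Fin 2) => θ1 (X su.1 * X su.2)) with hD
  have hD0 : D ≠ 0 := by
    intro h0
    obtain ⟨s, u, hsu⟩ := hne1
    have := hg (s, u) (Finset.mem_univ _)
    rw [h0, zero_mul] at this
    exact hsu this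
  obtain ⟨θ, hgood, hθ⟩ := good_div hg1 D hD0 (fun s u => ⟨g (s, u), hg (s, u) (Finset.mem_univ _)⟩)
  have hθg : ∀ s u, θ (X s * X u) = g (s, u) := by
    intro s u
    apply mul_left_cancel₀ hD0
    rw [← hθ]; exact hg (s, u) (Finset.mem_univ _)
  refine ⟨θ, hgood, ?_, ?_⟩
  · intro π hπ
    by_contra hall
    push Not at hall
    have : π ∣ Finset.univ.gcd g := by
      rw [Finset.dvd_gcd_iff]
      rintro ⟨s, u⟩ _
      rw [← hθg]; exact hall s u
    rw [hg'] at this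
    exact hπ.not_unit (isUnit_of_dvd_one this)
  · obtain ⟨s, u, hsu⟩ := hne1
    refine ⟨s, u, fun h0 => hsu ?_⟩
    rw [hθ, h0, mul_zero]

end Part1
end
end CI16

namespace CI16
section

section Gen
variable {R : Type*} [CommRing R] {d : ℕ}

/-- quadric -/
def quad (a : Matrix (Fin d ⊕ Fin 2) (Fin d ⊕ Fin 2) R) : MvPolynomial (Fin d ⊕ Fin 2) R :=
  ∑ t, ∑ s, C (a t s) * (X t * X s)

theorem gM_quad (J : Matrix (Fin d) (Fin d ⊕ Fin 2) R)
    (a : Fin 2 → Matrix (Fin d ⊕ Fin 2) (Fin d ⊕ Fin 2) R) (i) :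
    (gM J (FM a)).mulVec X (Sum.inr i) = quad (a i) := by
  simp only [gM, Matrix.mulVec, dotProduct, Matrix.fromRows_apply_inr, FM, Matrix.of_apply, quad, Finset.sum_mul]
  exact Finset.sum_congr rfl fun _ _ => Finset.sum_congr rfl fun _ _ => by ring

theorem gM_lin (J : Matrix (Fin d) (Fin d ⊕ Fin 2) R)
    (a : Fin 2 → Matrix (Fin d ⊕ Fin 2) (Fin d ⊕ Fin 2) R) (i) :
    (gM J (FM a)).mulVec X (Sum.inl i) = ∑ s, C (J i s) * X s := by
  simp [gM, Matrix.mulVec, dotProduct]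

theorem quad_homog (a : Matrix (Fin d ⊕ Fin 2) (Fin d ⊕ Fin 2) R) : (quad a).IsHomogeneous 2 := by
  refine IsHomogeneous.sum _ _ _ fun t _ => IsHomogeneous.sum _ _ _ fun s _ => ?_
  have := (isHomogeneous_C (Fin d ⊕ Fin 2) (a t s)).mul ((isHomogeneous_X R t).mul (isHomogeneous_X R s))
  simpa using this

theorem lin_quad (Λ : MvPolynomial (Fin d ⊕ Fin 2) R →ₗ[R] R) (a : Matrix (Fin d ⊕ Fin 2) (Fin d ⊕ Fin 2) R) :
    Λ (quad a) = ∑ t, ∑ s, a t s * Λ (X t * X s) := by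
  simp only [quad, map_sum, lin_C_mul]

/-- functionals on degree two killing linear forms -/
structure PreGood (J : Matrix (Fin d) (Fin d ⊕ Fin 2) R)
    (Λ : MvPolynomial (Fin d ⊕ Fin 2) R →ₗ[R] R) : Prop where
  deg : ∀ n p, p.IsHomogeneous n → n ≠ 2 → Λ p = 0
  lin : ∀ i p, Λ (p * ∑ s, C (J i s) * X s) = 0

theorem PreGood.good {J : Matrix (Fin d) (Fin d ⊕ Fin 2) R} {a}
    {Λ : MvPolynomial (Fin d ⊕ Fin 2) R →ₗ[R] R} (h : PreGood J Λ) (h0 : ∀ i, Λ (quad (a i)) = 0) :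
    Good J a Λ := by
  constructor
  · intro p hp
    obtain ⟨c, rfl⟩ := (Ideal.mem_span_range_iff_exists_fun).1 hp
    rw [map_sum]
    refine Finset.sum_eq_zero fun i _ => ?_
    rcases i with i | i
    · rw [gM_lin]; exact h.lin _ _
    · rw [gM_quad]
      generalize c (Sum.inr i) = G
      rw [G.as_sum, Finset.sum_mul, map_sum]
      refine Finset.sum_eq_zero fun α _ => ?_
      by_cases hα : α = 0
      · subst hα
        rw [show monomial 0 (coeff 0 G) = C (coeff 0 G) from rfl, lin_C_mul, h0, mul_zero]
      · refine h.deg _ _ ((isHomogeneous_monomial (coeff α G) rfl).mul (quad_homog _)) ?_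
        intro h2
        apply hα
        rw [← Finsupp.degree_eq_zero_iff]
        omega
  · intro α hα
    exact h.deg _ _ (isHomogeneous_monomial _ rfl) hα

theorem PreGood.sum {J : Matrix (Fin d) (Fin d ⊕ Fin 2) R} {ι : Type*} [Fintype ι]
    {q : ι → MvPolynomial (Fin d ⊕ Fin 2) R →ₗ[R] R} (h : ∀ i, PreGood J (q i)) (c : ι → R) :
    PreGood J (∑ i, c i • q i) := by
  constructor
  · intro n p hp hn
    simp [LinearMap.sum_apply, (h _).deg n p hp hn]
  · intro i p
    rw [LinearMap.sum_apply]
    exact Finset.sum_eq_zero fun j _ => by rw [LinearMap.smul_apply, (h j).lin i p, smul_zero]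

/-- substitution -/
def sb {m : ℕ} (b : Fin m → (Fin d ⊕ Fin 2) → R) : MvPolynomial (Fin d ⊕ Fin 2) R →ₐ[R] MvPolynomial (Fin m) R :=
  aeval fun s => ∑ i, C (b i s) * X i

/-- coefficient functional -/
def qf {m : ℕ} (b : Fin m → (Fin d ⊕ Fin 2) → R) (α : Fin m →₀ ℕ) : MvPolynomial (Fin d ⊕ Fin 2) R →ₗ[R] R :=
  (lcoeff R α) ∘ₗ (sb b).toLinearMap

theorem qf_apply {m : ℕ} (b : Fin m → (Fin d ⊕ Fin 2) → R) (α : Fin m →₀ ℕ) (p) :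
    qf b α p = coeff α (sb b p) := rfl

theorem sb_lin {m : ℕ} (b : Fin m → (Fin d ⊕ Fin 2) → R) (v : (Fin d ⊕ Fin 2) → R) :
    sb b (∑ s, C (v s) * X s) = ∑ i, C (∑ s, v s * b i s) * X i := by
  simp only [sb, map_sum, map_mul, aeval_X, aeval_C, algebraMap_eq, Finset.mul_sum, Finset.sum_mul]
  rw [Finset.sum_comm]
  exact Finset.sum_congr rfl fun _ _ => Finset.sum_congr rfl fun _ _ => by ring

theorem qf_preGood {m : ℕ} {J : Matrix (Fin d) (Fin d ⊕ Fin 2) R} (b : Fin m → (Fin d ⊕ Fin 2) → R)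
    (hb : ∀ i, J.mulVec (b i) = 0) (α : Fin m →₀ ℕ) (hα : α.degree = 2) : PreGood J (qf b α) := by
  constructor
  · intro n p hp hn
    rw [qf_apply]
    have h1 : (sb b p).IsHomogeneous (1 * n) := by
      refine hp.aeval _ fun s => IsHomogeneous.sum _ _ _ fun i _ => ?_
      have := (isHomogeneous_C (Fin m) (b i s)).mul (isHomogeneous_X R i)
      simpa using this
    exact h1.coeff_eq_zero (by omega)
  · intro i p
    rw [qf_apply, map_mul, sb_lin]
    have : ∀ j, ∑ s, J i s * b j s = 0 := fun j => congrFun (hb j) i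
    simp [this]

theorem coeff_XX {m : ℕ} (α : Fin m →₀ ℕ) (i j) :
    coeff α (X i * X j : MvPolynomial (Fin m) R) = if Finsupp.single i 1 + Finsupp.single j 1 = α then 1 else 0 := by
  rw [X, X, monomial_mul, coeff_monomial, one_mul]

end Gen

section Field
variable {K : Type*} [Field K] {d : ℕ}

/-- proportionality of good functionals -/
def Prop2 (J : Matrix (Fin d) (Fin d ⊕ Fin 2) K) (a : Fin 2 → Matrix (Fin d ⊕ Fin 2) (Fin d ⊕ Fin 2) K) : Prop :=
  ∀ l l' : MvPolynomial (Fin d ⊕ Fin 2) K →ₗ[K] K, Good J a l → Good J a l' → ∀ p p', l p * l' p' = l p' * l' p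

theorem ker_small {J : Matrix (Fin d) (Fin d ⊕ Fin 2) K} {a} (hp : Prop2 J a) {m : ℕ}
    (q : Fin m → MvPolynomial (Fin d ⊕ Fin 2) K →ₗ[K] K) (hq : ∀ i, PreGood J (q i))
    (h : Fin m → MvPolynomial (Fin d ⊕ Fin 2) K) (e : Fin m → K) (he : ∀ i, e i ≠ 0)
    (hqh : ∀ i j, q i (h j) = if i = j then e i else 0) :
    m ≤ (Matrix.of fun (r : Fin 2) (i : Fin m) => q i (quad (a r))).rank + 1 := by
  set N : Matrix (Fin 2) (Fin m) K := Matrix.of fun (r : Fin 2) (i : Fin m) => q i (quad (a r)) with hN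
  have hgood : ∀ c, N.mulVec c = 0 → Good J a (∑ i, c i • q i) := by
    intro c hc
    apply (PreGood.sum hq c).good
    intro i
    have := congrFun hc i
    simp only [Matrix.mulVec, dotProduct, hN, Matrix.of_apply, Pi.zero_apply] at this
    rw [LinearMap.sum_apply, ← this]
    exact Finset.sum_congr rfl fun _ _ => by simp [mul_comm]
  have hval : ∀ (c : Fin m → K) j, (∑ i, c i • q i) (h j) = c j * e j := by
    intro c j
    rw [LinearMap.sum_apply]
    simp [hqh]
  have hprop : ∀ c c', N.mulVec c = 0 → N.mulVec c' = 0 → ∀ i j, c i * c' j = c j * c' i := by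
    intro c c' hc hc' i j
    have := hp _ _ (hgood c hc) (hgood c' hc') (h i) (h j)
    rw [hval, hval, hval, hval] at this
    have h2 : (e i * e j) * (c i * c' j) = (e i * e j) * (c j * c' i) := by linear_combination this
    exact mul_left_cancel₀ (mul_ne_zero (he i) (he j)) h2
  have hker : Module.finrank K (LinearMap.ker N.mulVecLin) ≤ 1 := by
    by_cases hz : ∀ c : LinearMap.ker N.mulVecLin, c = 0
    · apply finrank_le_one (0 : LinearMap.ker N.mulVecLin)
      intro w; exact ⟨0, by rw [hz w, smul_zero]⟩
    · push Not at hz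
      obtain ⟨v, hv⟩ := hz
      apply finrank_le_one v
      intro w
      have hv' : (v : Fin m → K) ≠ 0 := by simpa using hv
      obtain ⟨i, hi⟩ := Function.ne_iff.1 hv'
      refine ⟨w.1 i / v.1 i, ?_⟩
      ext j
      have := hprop w.1 v.1 (LinearMap.mem_ker.1 w.2) (LinearMap.mem_ker.1 v.2) i j
      simp only [Submodule.coe_smul, Pi.smul_apply, smul_eq_mul]
      have hi' : v.1 i ≠ 0 := hi
      rw [div_mul_eq_mul_div, div_eq_iff hi', this]
  have := LinearMap.finrank_range_add_finrank_ker N.mulVecLin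
  rw [Module.finrank_fin_fun] at this
  have h3 : N.rank = Module.finrank K (LinearMap.range N.mulVecLin) := rfl
  omega

/-- exponents -/
def ex4 : Fin 4 → (Fin 3 →₀ ℕ) := ![Finsupp.single 0 1 + Finsupp.single 0 1, Finsupp.single 0 1 + Finsupp.single 1 1,
  Finsupp.single 1 1 + Finsupp.single 1 1, Finsupp.single 0 1 + Finsupp.single 2 1]

theorem no_three {J : Matrix (Fin d) (Fin d ⊕ Fin 2) K} {a} (hp : Prop2 J a)
    (b : Fin 3 → (Fin d ⊕ Fin 2) → K) (hb : ∀ i, J.mulVec (b i) = 0) (hli : LinearIndependent K b) : False := by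
  -- dual vectors
  have hdual : ∃ v : Fin 3 → (Fin d ⊕ Fin 2) → K, ∀ i j, ∑ s, v i s * b j s = if i = j then 1 else 0 := by
    obtain ⟨g, hg⟩ := LinearMap.exists_leftInverse_of_injective (Fintype.linearCombination K b)
      (LinearMap.ker_eq_bot.2 hli.fintypeLinearCombination_injective)
    refine ⟨fun i s => g (Pi.single s 1) i, fun i j => ?_⟩
    have h1 := congrFun (LinearMap.congr_fun hg (Pi.single j 1)) i
    rw [LinearMap.comp_apply, Fintype.linearCombination_apply_single, one_smul] at h1
    have h2 : b j = ∑ s, b j s • (Pi.single s 1 : (Fin d ⊕ Fin 2) → K) := by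
      ext t; simp [Finset.sum_apply, Pi.single_apply]
    rw [h2, map_sum, Finset.sum_apply] at h1
    simp only [map_smul, Pi.smul_apply, smul_eq_mul, LinearMap.id_apply, Pi.single_apply] at h1
    rw [← h1]
    exact Finset.sum_congr rfl fun s _ => mul_comm _ _
  obtain ⟨v, hv⟩ := hdual
  set l : Fin 3 → MvPolynomial (Fin d ⊕ Fin 2) K := fun i => ∑ s, C (v i s) * X s with hl
  have hsl : ∀ i, sb b (l i) = X i := by
    intro i
    rw [hl]; simp only
    rw [sb_lin]
    simp [hv]
  have := ker_small hp (m := 4) (fun i => qf b (ex4 i)) (fun i => qf_preGood b hb _ (by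
      fin_cases i <;> simp [ex4, map_add, Finsupp.degree_single]))
    (![l 0 * l 0, l 0 * l 1, l 1 * l 1, l 0 * l 2]) (fun _ => 1) (fun _ => one_ne_zero) (by
      intro i j
      fin_cases j <;> fin_cases i <;>
      simp [qf_apply, hsl, coeff_XX, ex4, Finsupp.ext_iff, Fin.forall_fin_succ, Finsupp.single_apply])
  have h2 := Matrix.rank_le_height (Matrix.of fun (r : Fin 2) (i : Fin 4) => qf b (ex4 i) (quad (a r)))
  omega

end Field
end
end CI16

namespace CI16
section

section Theta
variable {R R' : Type*} [CommRing R] [CommRing R'] {d : ℕ}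

/-- exponents -/
def ex3 : Fin 3 → (Fin 2 →₀ ℕ) := ![Finsupp.single 0 1 + Finsupp.single 0 1, Finsupp.single 0 1 + Finsupp.single 1 1,
  Finsupp.single 1 1 + Finsupp.single 1 1]

theorem ex3_deg (i) : (ex3 i).degree = 2 := by
  fin_cases i <;> simp [ex3, map_add, Finsupp.degree_single]

theorem sb_XX (b : Fin 2 → (Fin d ⊕ Fin 2) → R) (s u) :
    sb b (X s * X u) = C (b 0 s * b 0 u) * (X 0 * X 0) + C (b 0 s * b 1 u + b 1 s * b 0 u) * (X 0 * X 1) +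
      C (b 1 s * b 1 u) * (X 1 * X 1) := by
  simp only [sb, map_mul, aeval_X, Fin.sum_univ_two, map_add]
  ring

theorem qf0 (b : Fin 2 → (Fin d ⊕ Fin 2) → R) (s u) : qf b (ex3 0) (X s * X u) = b 0 s * b 0 u := by
  rw [qf_apply, sb_XX]
  simp only [coeff_add, coeff_C_mul, coeff_XX]
  simp [ex3, Finsupp.ext_iff, Fin.forall_fin_succ, Finsupp.single_apply]

theorem qf1 (b : Fin 2 → (Fin d ⊕ Fin 2) → R) (s u) :
    qf b (ex3 1) (X s * X u) = b 0 s * b 1 u + b 1 s * b 0 u := by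
  rw [qf_apply, sb_XX]
  simp only [coeff_add, coeff_C_mul, coeff_XX]
  simp [ex3, Finsupp.ext_iff, Fin.forall_fin_succ, Finsupp.single_apply]

theorem qf2 (b : Fin 2 → (Fin d ⊕ Fin 2) → R) (s u) : qf b (ex3 2) (X s * X u) = b 1 s * b 1 u := by
  rw [qf_apply, sb_XX]
  simp only [coeff_add, coeff_C_mul, coeff_XX]
  simp [ex3, Finsupp.ext_iff, Fin.forall_fin_succ, Finsupp.single_apply]

/-- coefficients -/
def crs (x y : Fin 3 → R) : Fin 3 → R := ![x 1 * y 2 - x 2 * y 1, x 2 * y 0 - x 0 * y 2, x 0 * y 1 - x 1 * y 0]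

/-- The determinantal functional. -/
def thb (a : Fin 2 → Matrix (Fin d ⊕ Fin 2) (Fin d ⊕ Fin 2) R) (b : Fin 2 → (Fin d ⊕ Fin 2) → R) :
    MvPolynomial (Fin d ⊕ Fin 2) R →ₗ[R] R :=
  ∑ i, crs (fun i => qf b (ex3 i) (quad (a 0))) (fun i => qf b (ex3 i) (quad (a 1))) i • qf b (ex3 i)

theorem thb_apply (a : Fin 2 → Matrix (Fin d ⊕ Fin 2) (Fin d ⊕ Fin 2) R) (b : Fin 2 → (Fin d ⊕ Fin 2) → R) (p) :
    thb a b p = ∑ i, crs (fun i => qf b (ex3 i) (quad (a 0))) (fun i => qf b (ex3 i) (quad (a 1))) i * qf b (ex3 i) p := by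
  rw [thb, LinearMap.sum_apply]; rfl

theorem thb_good {J : Matrix (Fin d) (Fin d ⊕ Fin 2) R} (a) (b : Fin 2 → (Fin d ⊕ Fin 2) → R)
    (hb : ∀ i, J.mulVec (b i) = 0) : Good J a (thb a b) := by
  apply (PreGood.sum (fun i => qf_preGood b hb (ex3 i) (ex3_deg i)) _).good
  intro i
  have : ∀ i, thb a b (quad (a i)) = 0 := by
    intro i
    rw [thb_apply, Fin.sum_univ_three]
    fin_cases i <;> simp [crs] <;> ring
  exact this i

theorem lin_quad_zero (Λ : MvPolynomial (Fin d ⊕ Fin 2) R →ₗ[R] R) (a : Matrix (Fin d ⊕ Fin 2) (Fin d ⊕ Fin 2) R)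
    (h : ∀ s u, Λ (X s * X u) = 0) : Λ (quad a) = 0 := by
  rw [lin_quad]; simp [h]

theorem thb_change (a : Fin 2 → Matrix (Fin d ⊕ Fin 2) (Fin d ⊕ Fin 2) R) (b b' : Fin 2 → (Fin d ⊕ Fin 2) → R)
    (m00 m01 m10 m11 : R) (h0 : ∀ s, b' 0 s = m00 * b 0 s + m01 * b 1 s) (h1 : ∀ s, b' 1 s = m10 * b 0 s + m11 * b 1 s)
    (s u) : thb a b' (X s * X u) = (m00 * m11 - m01 * m10) ^ 3 * thb a b (X s * X u) := by
  have e0 : ∀ i, qf b' (ex3 0) (quad (a i)) = m00 ^ 2 * qf b (ex3 0) (quad (a i)) + m00 * m01 * qf b (ex3 1) (quad (a i)) +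
      m01 ^ 2 * qf b (ex3 2) (quad (a i)) := by
    intro i
    have := lin_quad_zero (qf b' (ex3 0) - (m00 ^ 2 • qf b (ex3 0) + (m00 * m01) • qf b (ex3 1) +
      m01 ^ 2 • qf b (ex3 2))) (a i) (by
        intro s u
        simp only [LinearMap.sub_apply, LinearMap.add_apply, LinearMap.smul_apply, smul_eq_mul, qf0, qf1, qf2, h0, h1]
        ring)
    simp only [LinearMap.sub_apply, LinearMap.add_apply, LinearMap.smul_apply, smul_eq_mul] at this
    linear_combination this
  have e1 : ∀ i, qf b' (ex3 1) (quad (a i)) = 2 * m00 * m10 * qf b (ex3 0) (quad (a i)) +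
      (m00 * m11 + m01 * m10) * qf b (ex3 1) (quad (a i)) + 2 * m01 * m11 * qf b (ex3 2) (quad (a i)) := by
    intro i
    have := lin_quad_zero (qf b' (ex3 1) - ((2 * m00 * m10) • qf b (ex3 0) + (m00 * m11 + m01 * m10) • qf b (ex3 1) +
      (2 * m01 * m11) • qf b (ex3 2))) (a i) (by
        intro s u
        simp only [LinearMap.sub_apply, LinearMap.add_apply, LinearMap.smul_apply, smul_eq_mul, qf0, qf1, qf2, h0, h1]
        ring)
    simp only [LinearMap.sub_apply, LinearMap.add_apply, LinearMap.smul_apply, smul_eq_mul] at this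
    linear_combination this
  have e2 : ∀ i, qf b' (ex3 2) (quad (a i)) = m10 ^ 2 * qf b (ex3 0) (quad (a i)) + m10 * m11 * qf b (ex3 1) (quad (a i)) +
      m11 ^ 2 * qf b (ex3 2) (quad (a i)) := by
    intro i
    have := lin_quad_zero (qf b' (ex3 2) - (m10 ^ 2 • qf b (ex3 0) + (m10 * m11) • qf b (ex3 1) +
      m11 ^ 2 • qf b (ex3 2))) (a i) (by
        intro s u
        simp only [LinearMap.sub_apply, LinearMap.add_apply, LinearMap.smul_apply, smul_eq_mul, qf0, qf1, qf2, h0, h1]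
        ring)
    simp only [LinearMap.sub_apply, LinearMap.add_apply, LinearMap.smul_apply, smul_eq_mul] at this
    linear_combination this
  rw [thb_apply, thb_apply, Fin.sum_univ_three, Fin.sum_univ_three]
  simp only [crs, Matrix.cons_val_zero, Matrix.cons_val_one, Matrix.cons_val, e0, e1, e2, qf0, qf1, qf2, h0, h1]
  ring

theorem qf_map (h : R →+* R') {m : ℕ} (b : Fin m → (Fin d ⊕ Fin 2) → R) (α p) :
    qf (fun i s => h (b i s)) α (map h p) = h (qf b α p) := by
  rw [qf_apply, qf_apply, ← coeff_map]
  congr 1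
  induction p using MvPolynomial.induction_on with
  | C r => simp [sb]
  | add p q hp hq => rw [map_add, map_add, map_add, hp, hq, map_add]
  | mul_X p s hp => rw [map_mul, map_mul, map_mul, hp, map_mul]; congr 1; simp [sb]

theorem quad_map (h : R →+* R') (a : Matrix (Fin d ⊕ Fin 2) (Fin d ⊕ Fin 2) R) :
    map h (quad a) = quad (a.map h) := by
  simp [quad]

theorem thb_map (h : R →+* R') (a : Fin 2 → Matrix (Fin d ⊕ Fin 2) (Fin d ⊕ Fin 2) R) (b : Fin 2 → (Fin d ⊕ Fin 2) → R) (p) :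
    thb (aMap h a) (fun i s => h (b i s)) (map h p) = h (thb a b p) := by
  rw [thb_apply, thb_apply, map_sum]
  refine Finset.sum_congr rfl fun i _ => ?_
  rw [map_mul, qf_map]
  congr 1
  have : ∀ j i, qf (fun i s => h (b i s)) (ex3 i) (quad (aMap h a j)) = h (qf b (ex3 i) (quad (a j))) := by
    intro j i
    rw [← qf_map, quad_map]; rfl
  simp only [this]
  fin_cases i <;> simp [crs]

end Theta

section Plu
variable {R R' : Type*} [CommRing R] [CommRing R'] {d : ℕ}

theorem Pm_self (J : Matrix (Fin d) (Fin d ⊕ Fin 2) R) (p) : Pm J p p = 0 := by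
  unfold Pm
  apply Matrix.det_zero_of_row_eq (i := Sum.inr 0) (j := Sum.inr 1) (by simp)
  ext j; simp

theorem Pm_J (J : Matrix (Fin d) (Fin d ⊕ Fin 2) R) (p r) : ∑ q, J r q * Pm J p q = 0 := by
  have h := det_two J (Matrix.of ![Pi.single p 1, J r])
  have h0 : (Matrix.fromRows J (Matrix.of ![Pi.single p 1, J r])).det = 0 := by
    apply Matrix.det_zero_of_row_eq (i := Sum.inr 1) (j := Sum.inl r) (by simp)
    ext j; simp
  rw [h0] at h
  rw [h]
  symm
  rw [Finset.sum_eq_single p]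
  · simp
  · intro b _ hb; simp [hb]
  · simp

theorem Pm_anti (J : Matrix (Fin d) (Fin d ⊕ Fin 2) R) (p q) : Pm J p q = - Pm J q p := by
  have h := det_two J (Matrix.of ![Pi.single p 1 + Pi.single q 1, Pi.single p 1 + Pi.single q 1])
  have h0 : (Matrix.fromRows J (Matrix.of ![Pi.single p (1:R) + Pi.single q 1, Pi.single p 1 + Pi.single q 1])).det = 0 := by
    apply Matrix.det_zero_of_row_eq (i := Sum.inr 1) (j := Sum.inr 0) (by simp)
    ext j; simp
  rw [h0] at h
  simp [Pi.single_apply, add_mul, mul_add, Finset.sum_add_distrib, Pm_self] at h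
  linear_combination -h

theorem plucker [IsDomain R] (J : Matrix (Fin d) (Fin d ⊕ Fin 2) R) {i j} (h : Pm J i j ≠ 0) (k l) :
    Pm J i j * Pm J k l = Pm J k j * Pm J i l + Pm J i k * Pm J j l := by
  set v : (Fin d ⊕ Fin 2) → R := fun l => Pm J i j * Pm J k l - (Pm J k j * Pm J i l + Pm J i k * Pm J j l) with hv
  have h0 : v = 0 := by
    apply Matrix.eq_zero_of_mulVec_eq_zero (M := Matrix.fromRows J (Matrix.of ![Pi.single i 1, Pi.single j 1])) h
    ext r
    rcases r with r | r
    · simp only [Matrix.mulVec, dotProduct, Matrix.fromRows_apply_inl, hv, Pi.zero_apply]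
      have : ∑ x, J r x * (Pm J i j * Pm J k x - (Pm J k j * Pm J i x + Pm J i k * Pm J j x)) =
        Pm J i j * (∑ x, J r x * Pm J k x) - (Pm J k j * (∑ x, J r x * Pm J i x) + Pm J i k * ∑ x, J r x * Pm J j x) := by
        simp only [Finset.mul_sum, ← Finset.sum_add_distrib, ← Finset.sum_sub_distrib]
        exact Finset.sum_congr rfl fun _ _ => by ring
      rw [this, Pm_J, Pm_J, Pm_J]; ring
    · fin_cases r
      · simp [Matrix.mulVec, dotProduct, Pi.single_apply, hv, Pm_self]
        rw [Pm_anti J k i, Pm_anti J j i]; ring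
      · simp [Matrix.mulVec, dotProduct, Pi.single_apply, hv, Pm_self]
        ring
  have := congrFun h0 l
  simp only [hv, Pi.zero_apply] at this
  linear_combination this

/-- kernel vectors -/
def kap (J : Matrix (Fin d) (Fin d ⊕ Fin 2) R) (i j : Fin d ⊕ Fin 2) : Fin 2 → (Fin d ⊕ Fin 2) → R := ![Pm J i, Pm J j]

theorem kap_ker (J : Matrix (Fin d) (Fin d ⊕ Fin 2) R) (i j) (r) : J.mulVec (kap J i j r) = 0 := by
  ext s
  fin_cases r
  · exact Pm_J J i s
  · exact Pm_J J j s

theorem thb_kap [IsDomain R] (J : Matrix (Fin d) (Fin d ⊕ Fin 2) R) (a) {i j} (h : Pm J i j ≠ 0) (k l s u) :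
    Pm J i j ^ 3 * thb a (kap J k l) (X s * X u) = Pm J k l ^ 3 * thb a (kap J i j) (X s * X u) := by
  have h1 := thb_change a (kap J i j) (fun r s => Pm J i j * kap J k l r s) (Pm J k j) (Pm J i k) (Pm J l j) (Pm J i l)
    (fun s => by simp only [kap, Matrix.cons_val_zero, Matrix.cons_val_one]; exact plucker J h k s)
    (fun s => by simp only [kap, Matrix.cons_val_zero, Matrix.cons_val_one]; exact plucker J h l s) s u
  have h2 := thb_change a (kap J k l) (fun r s => Pm J i j * kap J k l r s) (Pm J i j) 0 0 (Pm J i j)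
    (fun s => by simp) (fun s => by simp) s u
  have h3 : Pm J k j * Pm J i l - Pm J i k * Pm J l j = Pm J i j * Pm J k l := by
    rw [plucker J h k l, Pm_anti J j l]; ring
  rw [h3] at h1
  rw [h1] at h2
  have h4 : Pm J i j ^ 3 * (Pm J i j ^ 3 * thb a (kap J k l) (X s * X u)) =
    Pm J i j ^ 3 * (Pm J k l ^ 3 * thb a (kap J i j) (X s * X u)) := by linear_combination -h2
  exact mul_left_cancel₀ (pow_ne_zero 3 h) h4

end Plu
end
end CI16

namespace CI16
section

section Field
variable {K : Type*} [Field K] {d : ℕ}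

theorem exists_Pm {J : Matrix (Fin d) (Fin d ⊕ Fin 2) K} {a} (hp : Prop2 J a) : ∃ i j, Pm J i j ≠ 0 := by
  by_cases hli : LinearIndependent K J.row
  · set W := Submodule.span K (Set.range J.row)
    have hfW : Module.finrank K W = d := by
      rw [finrank_span_eq_card hli]; simp
    have hq : Module.finrank K (((Fin d ⊕ Fin 2) → K) ⧸ W) = 2 := by
      have := Submodule.finrank_quotient_add_finrank W
      rw [hfW, Module.finrank_fintype_fun_eq_card] at this
      simp at this
      omega
    obtain ⟨g', hg'⟩ := exists_linearIndependent_of_le_finrank (R := K) (M := ((Fin d ⊕ Fin 2) → K) ⧸ W) (n := 2) hq.ge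
    choose g hg using fun i => Submodule.Quotient.mk_surjective W (g' i)
    have h1 : LinearIndependent K (Submodule.Quotient.mk (p := W) ∘ g) := by
      have : Submodule.Quotient.mk (p := W) ∘ g = g' := funext hg
      rw [this]; exact hg'
    have h2 := LinearIndependent.sumElim_of_quotient (linearIndependent_span hli) g h1
    have h3 : (Matrix.fromRows J (Matrix.of g)).det ≠ 0 := by
      have h4 : LinearIndependent K (Matrix.fromRows J (Matrix.of g)).row := by
        have e : (Matrix.fromRows J (Matrix.of g)).row = Sum.elim J.row g := by
          ext i j
          rcases i with i | i <;> rfl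
        rw [e]; exact h2
      have := (Matrix.isUnit_iff_isUnit_det _).1 (Matrix.linearIndependent_rows_iff_isUnit.1 h4)
      exact this.ne_zero
    by_contra hc
    push Not at hc
    apply h3
    rw [det_two]
    simp [hc]
  · exfalso
    have hr : J.rank < d := by
      rw [linearIndependent_iff_card_le_finrank_span] at hli
      rw [Matrix.rank_eq_finrank_span_row]
      simpa [Set.finrank] using hli
    have hk : 3 ≤ Module.finrank K (LinearMap.ker J.mulVecLin) := by
      have := LinearMap.finrank_range_add_finrank_ker J.mulVecLin
      rw [Module.finrank_fintype_fun_eq_card] at this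
      have h3 : J.rank = Module.finrank K (LinearMap.range J.mulVecLin) := rfl
      simp at this
      omega
    obtain ⟨b, hb⟩ := exists_linearIndependent_of_le_finrank hk
    refine no_three hp (fun i => (b i).1) (fun i => LinearMap.mem_ker.1 (b i).2) ?_
    exact hb.map' (Submodule.subtype _) (Submodule.ker_subtype _)

theorem exists_thb {J : Matrix (Fin d) (Fin d ⊕ Fin 2) K} {a} (hp : Prop2 J a) {i j} (hij : Pm J i j ≠ 0) :
    ∃ s u, thb a (kap J i j) (X s * X u) ≠ 0 := by
  by_contra hc
  push Not at hc
  have k0i : kap J i j 0 i = 0 := Pm_self J i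
  have k0j : kap J i j 0 j = Pm J i j := rfl
  have k1i : kap J i j 1 i = - Pm J i j := Pm_anti J j i
  have k1j : kap J i j 1 j = 0 := Pm_self J j
  have hval : ∀ r s, qf (kap J i j) (ex3 r) ((![X j * X j, X i * X j, X i * X i] : Fin 3 → MvPolynomial (Fin d ⊕ Fin 2) K) s) =
      if r = s then (![Pm J i j ^ 2, - Pm J i j ^ 2, Pm J i j ^ 2] : Fin 3 → K) r else 0 := by
    intro r s
    fin_cases r <;> fin_cases s <;> simp [qf0, qf1, qf2, k0i, k0j, k1i, k1j, pow_two]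
  have he : ∀ r, (![Pm J i j ^ 2, - Pm J i j ^ 2, Pm J i j ^ 2] : Fin 3 → K) r ≠ 0 := by
    intro r; fin_cases r <;> simp [hij]
  have := ker_small hp (m := 3) (fun r => qf (kap J i j) (ex3 r)) (fun r => qf_preGood _ (kap_ker J i j) _ (ex3_deg r))
    (![X j * X j, X i * X j, X i * X i]) (![Pm J i j ^ 2, - Pm J i j ^ 2, Pm J i j ^ 2])
    he hval
  set x : Fin 3 → K := fun r => qf (kap J i j) (ex3 r) (quad (a 0)) with hx
  set y : Fin 3 → K := fun r => qf (kap J i j) (ex3 r) (quad (a 1)) with hy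
  have hcr : ∀ r, crs x y r = 0 := by
    intro r
    have h1 : thb a (kap J i j) ((![X j * X j, X i * X j, X i * X i] : Fin 3 → MvPolynomial (Fin d ⊕ Fin 2) K) r) = 0 := by
      fin_cases r
      · exact hc j j
      · exact hc i j
      · exact hc i i
    rw [thb_apply] at h1
    simp only [hval] at h1
    simp only [mul_ite, mul_zero, Finset.sum_ite_eq', Finset.mem_univ, if_true] at h1
    exact (mul_eq_zero.1 h1).resolve_right (he r)
  have hli : LinearIndependent K ![x, y] := by
    rw [linearIndependent_iff_card_le_finrank_span]
    have h2 : 2 ≤ (Matrix.of ![x, y]).rank := by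
      have e : (Matrix.of ![x, y]) = Matrix.of fun (r : Fin 2) (s : Fin 3) => qf (kap J i j) (ex3 s) (quad (a r)) := by
        ext r s; fin_cases r <;> simp [hx, hy]
      rw [e]; omega
    rw [Matrix.rank_eq_finrank_span_row] at h2
    rw [Fintype.card_fin]; exact h2
  rw [← crossProduct_ne_zero_iff_linearIndependent] at hli
  apply hli
  ext r
  have := hcr r
  rw [cross_apply]
  fin_cases r <;> simpa [crs] using this
end Field

section Main
variable {T : Type*} [CommRing T] [IsDomain T] [IsNoetherianRing T] [UniqueFactorizationMonoid T] {d : ℕ}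

theorem part_two (hd : 1 ≤ d) {J : Matrix (Fin d) (Fin d ⊕ Fin 2) T} {a} (hT : HT J a)
    (hpr : ∃ π : T, Prime π) {t₀ : T} (ht₀ : t₀ ≠ 0) {N : ℕ} (hN : Tor J a t₀ N)
    (hD : ∀ π : T, Prime π → ∃ (K : Type) (_ : Field K) (h : T →+* K), (∀ t, h t = 0 ↔ π ∣ t) ∧
      Prop2 (J.map h) (aMap h a)) :
    ∃ i j, Pm J i j ≠ 0 ∧ ∃ θ : MvPolynomial (Fin d ⊕ Fin 2) T →ₗ[T] T,
      (∀ p, thb a (kap J i j) p = Pm J i j ^ 3 * θ p) ∧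
      ∀ t, (∃ N, Tor J a t N) ↔ θ (syl J (aT a)) ∣ t := by
  -- local data
  have hloc : ∀ π : T, Prime π → ∃ i j, ¬ π ∣ Pm J i j ∧ ∃ s u, ¬ π ∣ thb a (kap J i j) (X s * X u) := by
    intro π hπ
    obtain ⟨K, _, h, h0, hP⟩ := hD π hπ
    obtain ⟨i, j, hij⟩ := exists_Pm hP
    obtain ⟨s, u, hsu⟩ := exists_thb hP hij
    refine ⟨i, j, ?_, s, u, ?_⟩
    · rw [← h0, ← Pm_map]; exact hij
    · rw [← h0, ← thb_map]
      have e : (fun r s => h (kap J i j r s)) = kap (J.map h) i j := by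
        ext r s
        fin_cases r
        · exact (Pm_map h J i s).symm
        · exact (Pm_map h J j s).symm
      rw [e, map_mul, map_X, map_X]
      exact hsu
  -- some Pm nonzero
  have hex : ∃ i j, Pm J i j ≠ 0 := by
    obtain ⟨θ, h1, h2, h3⟩ := exists_good hd hT ht₀ hN
    have h4 := (core hd hT h1 h2 h3 t₀).1 ⟨N, hN⟩
    by_contra hc
    push Not at hc
    apply ht₀
    rw [syl_eq] at h4
    simpa [hc] using h4
  obtain ⟨i, j, hij⟩ := hex
  have hdiv : ∀ s u, Pm J i j ^ 3 ∣ thb a (kap J i j) (X s * X u) := by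
    intro s u
    apply dvd_of_loc
    · intro π hπ
      obtain ⟨k, l, h1, -⟩ := hloc π hπ
      refine ⟨Pm J k l ^ 3, fun h2 => h1 (hπ.dvd_of_dvd_pow h2), ?_⟩
      rw [← thb_kap J a hij]
      exact dvd_mul_right _ _
    · exact Or.inl (pow_ne_zero 3 hij)
  obtain ⟨θ, hg, hθ⟩ := good_div (thb_good a _ (kap_ker J i j)) _ (pow_ne_zero 3 hij) hdiv
  have hall : ∀ k l s u, thb a (kap J k l) (X s * X u) = Pm J k l ^ 3 * θ (X s * X u) := by
    intro k l s u
    apply mul_left_cancel₀ (pow_ne_zero 3 hij)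
    rw [thb_kap J a hij, hθ]; ring
  have hprim : ∀ π : T, Prime π → ∃ s u, ¬ π ∣ θ (X s * X u) := by
    intro π hπ
    obtain ⟨k, l, -, s, u, h⟩ := hloc π hπ
    refine ⟨s, u, fun h2 => h ?_⟩
    rw [hall]; exact Dvd.dvd.mul_left h2 _
  have hne : ∃ s u, θ (X s * X u) ≠ 0 := by
    obtain ⟨π, hπ⟩ := hpr
    obtain ⟨s, u, h⟩ := hprim π hπ
    exact ⟨s, u, fun h0 => h (h0 ▸ dvd_zero _)⟩
  exact ⟨i, j, hij, θ, hθ, core hd hT hg hprim hne⟩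

end Main
end
end CI16

namespace CI16
section

section Deg
variable {k : Type*} [Field k] {τ : Type*} {d : ℕ}

theorem homog_of_mul {P h : MvPolynomial τ k} {p c : ℕ} (hP : P.IsHomogeneous p) (hP0 : P ≠ 0)
    (hm : (P * h).IsHomogeneous (p + c)) : h.IsHomogeneous c := by
  have key : ∀ j, j ≠ c → homogeneousComponent j h = 0 := by
    intro j hj
    have h1 : homogeneousComponent (p + j) (P * h) = 0 := by
      rw [homogeneousComponent_of_mem (n := p + c) hm, if_neg (by omega)]
    have h2 : homogeneousComponent (p + j) (P * h) = P * homogeneousComponent j h := by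
      by_cases hj2 : j ≤ h.totalDegree
      · conv_lhs => rw [← sum_homogeneousComponent h, Finset.mul_sum, map_sum]
        rw [Finset.sum_eq_single j]
        · rw [homogeneousComponent_of_mem (n := p + j) (hP.mul (homogeneousComponent_isHomogeneous j h)), if_pos rfl]
        · intro i _ hi
          rw [homogeneousComponent_of_mem (n := p + i) (hP.mul (homogeneousComponent_isHomogeneous i h)), if_neg (by omega)]
        · intro hn
          exact absurd (Finset.mem_range.2 (by omega)) hn
      · rw [homogeneousComponent_eq_zero j h (by omega), mul_zero]
        apply homogeneousComponent_eq_zero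
        have h4 := totalDegree_mul P h
        have h5 := hP.totalDegree_le
        omega
    rw [h1] at h2
    exact (mul_eq_zero.1 h2.symm).resolve_left hP0
  have : h = homogeneousComponent c h := by
    conv_lhs => rw [← sum_homogeneousComponent h]
    by_cases hc : c ≤ h.totalDegree
    · rw [Finset.sum_eq_single c (fun i _ hi => key i hi) (fun hn => absurd (Finset.mem_range.2 (by omega)) hn)]
    · rw [homogeneousComponent_eq_zero c h (by omega)]
      exact Finset.sum_eq_zero fun i hi => key i (by have := Finset.mem_range.1 hi; omega)
  rw [this]; exact homogeneousComponent_isHomogeneous c h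

theorem Pm_homog {J : Matrix (Fin d) (Fin d ⊕ Fin 2) (MvPolynomial τ k)} (hJ : ∀ i s, (J i s).IsHomogeneous 1) (p q) :
    (Pm J p q).IsHomogeneous d := by
  unfold Pm
  rw [Matrix.det_apply]
  refine IsHomogeneous.sum _ _ _ fun σ _ => ?_
  have h1 : ∀ i s, ((Matrix.fromRows J (Matrix.of ![Pi.single p 1, Pi.single q 1])) i s).IsHomogeneous
      (Sum.elim (fun _ : Fin d => 1) (fun _ : Fin 2 => 0) i) := by
    intro i s
    rcases i with i | i
    · exact hJ i s
    · have : ∀ p, ((Pi.single p 1 : (Fin d ⊕ Fin 2) → MvPolynomial τ k) s).IsHomogeneous 0 := by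
        intro p
        rw [Pi.single_apply]
        split_ifs
        · exact isHomogeneous_one _ _
        · exact isHomogeneous_zero _ _ _
      fin_cases i
      · exact this p
      · exact this q
  have h2 := IsHomogeneous.prod Finset.univ (fun i => (Matrix.fromRows J (Matrix.of ![Pi.single p 1, Pi.single q 1])) (σ i) i) _
    (fun i _ => h1 (σ i) i)
  have h3 : ∑ i, (Sum.elim (fun _ : Fin d => 1) (fun _ : Fin 2 => 0) (σ i)) = d := by
    rw [Equiv.sum_comp σ (Sum.elim (fun _ : Fin d => 1) (fun _ : Fin 2 => 0))]
    simp
  rw [h3] at h2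
  rcases Int.units_eq_one_or (Equiv.Perm.sign σ) with h | h
  · rw [h, one_smul]; exact h2
  · rw [h, Units.neg_smul, one_smul]; exact h2.neg

theorem qf_homog {b : Fin 2 → (Fin d ⊕ Fin 2) → MvPolynomial τ k} {c : ℕ} (hb : ∀ i s, (b i s).IsHomogeneous c) (r s u) :
    (qf b (ex3 r) (X s * X u)).IsHomogeneous (c + c) := by
  fin_cases r
  · show (qf b (ex3 0) _).IsHomogeneous _
    rw [qf0]; exact (hb _ _).mul (hb _ _)
  · show (qf b (ex3 1) _).IsHomogeneous _
    rw [qf1]; exact ((hb _ _).mul (hb _ _)).add ((hb _ _).mul (hb _ _))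
  · show (qf b (ex3 2) _).IsHomogeneous _
    rw [qf2]; exact (hb _ _).mul (hb _ _)

theorem thb_homog {b : Fin 2 → (Fin d ⊕ Fin 2) → MvPolynomial τ k} {c : ℕ} (hb : ∀ i s, (b i s).IsHomogeneous c)
    {a : Fin 2 → Matrix (Fin d ⊕ Fin 2) (Fin d ⊕ Fin 2) (MvPolynomial τ k)} (ha : ∀ i s u, (a i s u).IsHomogeneous 0) (s u) :
    (thb a b (X s * X u)).IsHomogeneous (6 * c) := by
  have hq : ∀ r i, (qf b (ex3 r) (quad (a i))).IsHomogeneous (c + c) := by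
    intro r i
    rw [lin_quad]
    refine IsHomogeneous.sum _ _ _ fun t _ => IsHomogeneous.sum _ _ _ fun s _ => ?_
    have := (ha i t s).mul (qf_homog hb r t s)
    rwa [zero_add] at this
  rw [thb_apply]
  refine IsHomogeneous.sum _ _ _ fun r _ => ?_
  rw [show 6 * c = ((c + c) + (c + c)) + (c + c) by ring]
  refine IsHomogeneous.mul ?_ (qf_homog hb r s u)
  fin_cases r
  · exact ((hq _ _).mul (hq _ _)).sub ((hq _ _).mul (hq _ _))
  · exact ((hq _ _).mul (hq _ _)).sub ((hq _ _).mul (hq _ _))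
  · exact ((hq _ _).mul (hq _ _)).sub ((hq _ _).mul (hq _ _))

theorem gen_homog {J : Matrix (Fin d) (Fin d ⊕ Fin 2) (MvPolynomial τ k)} (hJ : ∀ i s, (J i s).IsHomogeneous 1)
    {a : Fin 2 → Matrix (Fin d ⊕ Fin 2) (Fin d ⊕ Fin 2) (MvPolynomial τ k)} (ha : ∀ i s u, (a i s u).IsHomogeneous 0)
    {i j} (hij : Pm J i j ≠ 0)
    (θ : MvPolynomial (Fin d ⊕ Fin 2) (MvPolynomial τ k) →ₗ[MvPolynomial τ k] MvPolynomial τ k)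
    (hθ : ∀ p, thb a (kap J i j) p = Pm J i j ^ 3 * θ p) : (θ (syl J (aT a))).IsHomogeneous (4 * d) := by
  have h1 : ∀ s u, (θ (X s * X u)).IsHomogeneous (3 * d) := by
    intro s u
    apply homog_of_mul ((Pm_homog hJ i j).pow 3) (pow_ne_zero 3 hij)
    rw [← hθ]
    have := thb_homog (b := kap J i j) (c := d) (fun r s => by
      fin_cases r
      · exact Pm_homog hJ _ _
      · exact Pm_homog hJ _ _) ha s u
    convert this using 1
    ring
  have h2 : ∀ p q, θ (FM (aT a) 0 p * FM (aT a) 1 q) = ∑ s, ∑ u, aT a 0 p s * aT a 1 q u * θ (X s * X u) := by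
    intro p q
    simp only [FM, Matrix.of_apply, Finset.sum_mul_sum, map_sum]
    refine Finset.sum_congr rfl fun s _ => Finset.sum_congr rfl fun u _ => ?_
    have h3 := lin_C_mul θ (aT a 0 p s * aT a 1 q u) (X s * X u)
    rw [← h3, C_mul]
    have h4 : (C (aT a 0 p s) * X s * (C (aT a 1 q u) * X u) : MvPolynomial (Fin d ⊕ Fin 2) (MvPolynomial τ k)) =
      C (aT a 0 p s) * C (aT a 1 q u) * (X s * X u) := by ring
    rw [h4]
  rw [syl_eq, map_sum]
  refine IsHomogeneous.sum _ _ _ fun p _ => ?_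
  rw [map_sum]
  refine IsHomogeneous.sum _ _ _ fun q _ => ?_
  rw [mul_comm, lin_C_mul θ (Pm J p q), h2, show 4 * d = d + 3 * d by ring]
  refine (Pm_homog hJ p q).mul ?_
  refine IsHomogeneous.sum _ _ _ fun s _ => IsHomogeneous.sum _ _ _ fun u _ => ?_
  have := ((ha 0 s p).mul (ha 1 u q)).mul (h1 s u)
  rwa [zero_add, zero_add] at this

end Deg
end
end CI16

namespace CI16
section

theorem prop_of_finrank {K ι : Type*} [Field K] [Finite ι] (W : Submodule K (ι → K)) (h : Module.finrank K W ≤ 1)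
    {c c' : ι → K} (hc : c ∈ W) (hc' : c' ∈ W) (i j) : c i * c' j = c j * c' i := by
  obtain ⟨v, hv⟩ := finrank_le_one_iff.1 h
  obtain ⟨r, hr⟩ := hv ⟨c, hc⟩
  obtain ⟨r', hr'⟩ := hv ⟨c', hc'⟩
  have e1 : c = r • v.1 := by rw [← Submodule.coe_smul, hr]
  have e2 : c' = r' • v.1 := by rw [← Submodule.coe_smul, hr']
  rw [e1, e2]
  simp only [Pi.smul_apply, smul_eq_mul]; ring

theorem fitting {T : Type} [CommRing T] [IsDomain T] {N : Type*} [AddCommGroup N] [Module T N]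
    {ι κ : Type} [Fintype ι] [Fintype κ] [DecidableEq ι] [DecidableEq κ] (ρ : Matrix ι κ T)
    (πρ : (ι → T) →ₗ[T] N) (hs : Function.Surjective πρ) (hk : LinearMap.ker πρ = LinearMap.range ρ.mulVecLin)
    {t₁ : T} (ht₁ : t₁ ≠ 0) (s : N) (hN : ∀ z : N, ∃ α : T, t₁ • z = α • s)
    {K : Type*} [Field K] (h : T →+* K) (f : Fin ρ.rank → ι) (g : Fin ρ.rank → κ)
    (hm : h (ρ.submatrix f g).det ≠ 0) (l l' : N →ₛₗ[h] K) (z z' : N) : l z * l' z' = l z' * l' z := by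
  -- rank of N
  have hrN : Module.finrank T N ≤ 1 := by
    by_contra hc
    obtain ⟨b, hb⟩ := exists_linearIndependent_of_le_finrank (R := T) (M := N) (n := 2) (by omega)
    obtain ⟨α, hα⟩ := hN (b 0)
    obtain ⟨β, hβ⟩ := hN (b 1)
    have h1 : (β * t₁) • b 0 + (- (α * t₁)) • b 1 = 0 := by
      rw [mul_smul, hα, neg_smul, mul_smul, hβ, smul_smul, smul_smul, mul_comm, add_neg_cancel]
    have h2 := (LinearIndependent.pair_iff.1 (by
      have e : b = ![b 0, b 1] := by ext i; fin_cases i <;> rfl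
      rw [e] at hb; exact hb)) _ _ h1
    have h3 : β = 0 := (mul_eq_zero.1 h2.1).resolve_right ht₁
    have h4 : t₁ • b 1 = 0 := by rw [hβ, h3, zero_smul]
    have h5 := (LinearIndependent.pair_iff.1 (by
      have e : b = ![b 0, b 1] := by ext i; fin_cases i <;> rfl
      rw [e] at hb; exact hb)) 0 t₁ (by rw [zero_smul, zero_add, h4])
    exact ht₁ h5.2
  have hcard : Fintype.card ι ≤ ρ.rank + 1 := by
    have h1 := Submodule.finrank_quotient_add_finrank (LinearMap.ker πρ)
    rw [Module.finrank_fintype_fun_eq_card, (πρ.quotKerEquivOfSurjective hs).finrank_eq, hk] at h1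
    have h3 : ρ.rank = Module.finrank T (LinearMap.range ρ.mulVecLin) := rfl
    omega
  have hrk : ρ.rank ≤ (ρ.map h).rank := by
    have h1 : ((ρ.map h).submatrix f g).rank = ρ.rank := by
      rw [Matrix.rank_of_det_ne_zero, Fintype.card_fin]
      rw [Matrix.submatrix_map, ← RingHom.mapMatrix_apply, ← RingHom.map_det]
      exact hm
    exact h1 ▸ Matrix.rank_submatrix_le (ρ.map h) f g
  have hW : Module.finrank K (LinearMap.ker (ρ.map h).transpose.mulVecLin) ≤ 1 := by
    have h1 := LinearMap.finrank_range_add_finrank_ker (ρ.map h).transpose.mulVecLin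
    rw [Module.finrank_fintype_fun_eq_card] at h1
    have h3 : (ρ.map h).transpose.rank = Module.finrank K (LinearMap.range (ρ.map h).transpose.mulVecLin) := rfl
    rw [Matrix.rank_transpose] at h3
    omega
  have hval : ∀ (l : N →ₛₗ[h] K) (x : ι → T), l (πρ x) = ∑ i, h (x i) * l (πρ (Pi.single i 1)) := by
    intro l x
    conv_lhs => rw [pi_eq_sum_univ' x]
    rw [map_sum, map_sum]
    refine Finset.sum_congr rfl fun i _ => ?_
    rw [map_smul, LinearMap.map_smulₛₗ, smul_eq_mul]
  have hc : ∀ l : N →ₛₗ[h] K, (fun i => l (πρ (Pi.single i 1))) ∈ LinearMap.ker (ρ.map h).transpose.mulVecLin := by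
    intro l
    rw [LinearMap.mem_ker]
    ext j
    have h1 : πρ (ρ.mulVecLin (Pi.single j 1)) = 0 := by
      rw [← LinearMap.mem_ker, hk]; exact ⟨_, rfl⟩
    have h2 := hval l (ρ.mulVecLin (Pi.single j 1))
    rw [h1, map_zero] at h2
    simp only [Matrix.mulVecLin_apply, Matrix.mulVec, dotProduct, Matrix.transpose_apply, Matrix.map_apply, Pi.zero_apply]
    rw [h2]
    exact Finset.sum_congr rfl fun i _ => by simp [Matrix.mulVec, dotProduct, Pi.single_apply]
  obtain ⟨x, rfl⟩ := hs z
  obtain ⟨x', rfl⟩ := hs z'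
  rw [hval l x, hval l' x', hval l x', hval l' x, Finset.sum_mul_sum, Finset.sum_mul_sum, Finset.sum_comm]
  refine Finset.sum_congr rfl fun i _ => Finset.sum_congr rfl fun j _ => ?_
  have := prop_of_finrank _ hW (hc l) (hc l') j i
  linear_combination h (x j) * h (x' i) * this

theorem prop2_mono {K : Type*} [Field K] {d : ℕ} {J : Matrix (Fin d) (Fin d ⊕ Fin 2) K} {a}
    (h : ∀ l l' : MvPolynomial (Fin d ⊕ Fin 2) K →ₗ[K] K, Good J a l → Good J a l' → ∀ s u s' u',
      l (X s * X u) * l' (X s' * X u') = l (X s' * X u') * l' (X s * X u)) : Prop2 J a := by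
  intro l l' hl hl' p p'
  have hm : ∀ α β : (Fin d ⊕ Fin 2) →₀ ℕ, l (monomial α 1) * l' (monomial β 1) = l (monomial β 1) * l' (monomial α 1) := by
    intro α β
    by_cases hα : α.degree = 2
    · by_cases hβ : β.degree = 2
      · obtain ⟨s, u, h1⟩ := mono_two (T := K) α hα
        obtain ⟨s', u', h2⟩ := mono_two (T := K) β hβ
        rw [h1, h2]; exact h l l' hl hl' _ _ _ _
      · rw [hl.deg β hβ, hl'.deg β hβ]; ring
    · rw [hl.deg α hα, hl'.deg α hα]; ring
  have hs : ∀ (l : MvPolynomial (Fin d ⊕ Fin 2) K →ₗ[K] K) (p : MvPolynomial (Fin d ⊕ Fin 2) K),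
      l p = ∑ α ∈ p.support, coeff α p * l (monomial α 1) := by
    intro l p
    conv_lhs => rw [p.as_sum]
    rw [map_sum]
    exact Finset.sum_congr rfl fun α _ => by rw [lin_monomial]
  rw [hs l p, hs l' p', hs l p', hs l' p, Finset.sum_mul_sum, Finset.sum_mul_sum, Finset.sum_comm]
  refine Finset.sum_congr rfl fun i _ => Finset.sum_congr rfl fun j _ => ?_
  linear_combination coeff j p * coeff i p' * hm j i

theorem morley_homog {T : Type*} [CommRing T] {d : ℕ} {J : Matrix (Fin d) (Fin d ⊕ Fin 2) T} {a}
    {θ : MvPolynomial (Fin d ⊕ Fin 2) T →ₗ[T] T} (hg : Good J a θ) {p : MvPolynomial (Fin d ⊕ Fin 2) T}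
    (hp : p.IsHomogeneous 2) : C (θ (syl J (aT a))) * p - C (θ p) * syl J a ∈ LL J a := by
  have e : C (θ (syl J (aT a))) * p - C (θ p) * syl J a = ∑ α ∈ p.support, C (coeff α p) *
      (C (θ (syl J (aT a))) * monomial α 1 - C (θ (monomial α 1)) * syl J a) := by
    have h1 : p = ∑ α ∈ p.support, C (coeff α p) * monomial α 1 := by
      conv_lhs => rw [p.as_sum]
      exact Finset.sum_congr rfl fun α _ => by rw [C_mul_monomial, mul_one]
    have h2 : θ p = ∑ α ∈ p.support, coeff α p * θ (monomial α 1) := by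
      conv_lhs => rw [h1]
      rw [map_sum]
      exact Finset.sum_congr rfl fun α _ => by rw [lin_C_mul]
    have h3 : C (θ (syl J (aT a))) * p = ∑ α ∈ p.support, C (θ (syl J (aT a))) * (C (coeff α p) * monomial α 1) := by
      rw [← Finset.mul_sum, ← h1]
    rw [h2, h3]
    rw [map_sum, Finset.sum_mul, ← Finset.sum_sub_distrib]
    exact Finset.sum_congr rfl fun α _ => by rw [C_mul]; ring
  rw [e]
  refine Ideal.sum_mem _ fun α hα => Ideal.mul_mem_left _ _ ?_
  have hd : α.degree = 2 := by
    have := hp (mem_support_iff.1 hα)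
    rw [Finsupp.degree_eq_weight_one]; exact this
  obtain ⟨s, u, h1⟩ := mono_two (T := T) α hd
  rw [h1]; exact morley hg s u

theorem prop2_fit {T : Type} [CommRing T] [IsDomain T] {d : ℕ} {J : Matrix (Fin d) (Fin d ⊕ Fin 2) T} {a}
    {N : Type*} [AddCommGroup N] [Module T N] (j : N →+ (MvPolynomial (Fin d ⊕ Fin 2) T ⧸ LL J a))
    (hjs : ∀ t n, j (t • n) = Ideal.Quotient.mk _ (C t) * j n)
    (hj : Function.Injective j)
    (hr : ∀ z, (∃ n, j n = z) ↔ ∃ p : MvPolynomial (Fin d ⊕ Fin 2) T, p.IsHomogeneous 2 ∧ Ideal.Quotient.mk _ p = z)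
    {θ : MvPolynomial (Fin d ⊕ Fin 2) T →ₗ[T] T} (hg : Good J a θ) (ht : θ (syl J (aT a)) ≠ 0)
    {ι κ : Type} [Fintype ι] [Fintype κ] [DecidableEq ι] [DecidableEq κ] (ρ : Matrix ι κ T)
    (πρ : (ι → T) →ₗ[T] N) (hs : Function.Surjective πρ) (hk : LinearMap.ker πρ = LinearMap.range ρ.mulVecLin)
    {K : Type*} [Field K] (h : T →+* K) (f : Fin ρ.rank → ι) (g : Fin ρ.rank → κ)
    (hm : h (ρ.submatrix f g).det ≠ 0) : Prop2 (J.map h) (aMap h a) := by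
  apply prop2_mono
  intro l l' hl hl' s u s' u'
  obtain ⟨σ, hσ⟩ := (hr (Ideal.Quotient.mk _ (syl J a))).2 ⟨_, syl_homog J a, rfl⟩
  have hN : ∀ z : N, ∃ α : T, θ (syl J (aT a)) • z = α • σ := by
    intro z
    obtain ⟨p, hp, hpz⟩ := (hr (j z)).1 ⟨z, rfl⟩
    refine ⟨θ p, hj ?_⟩
    rw [hjs, hjs, hσ, ← hpz]
    rw [← map_mul, ← map_mul, Ideal.Quotient.mk_eq_mk_iff_sub_mem]
    exact morley_homog hg hp
  have hdesc : ∀ l : MvPolynomial (Fin d ⊕ Fin 2) K →ₗ[K] K, Good (J.map h) (aMap h a) l →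
      ∃ L : N →ₛₗ[h] K, ∀ n p, j n = Ideal.Quotient.mk _ p → L n = l (map h p) := by
    intro l hl
    have hwd : ∀ p q : MvPolynomial (Fin d ⊕ Fin 2) T, (Ideal.Quotient.mk (LL J a) p) = Ideal.Quotient.mk _ q →
        l (map h p) = l (map h q) := by
      intro p q hpq
      rw [Ideal.Quotient.mk_eq_mk_iff_sub_mem] at hpq
      have h1 : map h (p - q) ∈ LL (J.map h) (aMap h a) := by
        rw [← LL_map]; exact Ideal.mem_map_of_mem _ hpq
      have h2 := hl.kill _ h1
      rw [map_sub, map_sub, sub_eq_zero] at h2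
      exact h2
    choose P hP using fun n => Ideal.Quotient.mk_surjective (I := LL J a) (j n)
    refine ⟨⟨⟨fun n => l (map h (P n)), ?_⟩, ?_⟩, ?_⟩
    · intro x y
      rw [← map_add, ← map_add]
      apply hwd
      rw [hP, map_add, map_add, hP, hP]
    · intro t x
      have h3 := lin_C_mul l (h t) (map h (P x))
      show l (map h (P (t • x))) = h t * l (map h (P x))
      rw [← h3, ← map_C, ← _root_.map_mul]
      apply hwd
      rw [hP, hjs, _root_.map_mul, hP]
    · intro n p hn
      exact hwd _ _ (by rw [hP, hn])
  obtain ⟨Λ, hΛ⟩ := hdesc l hl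
  obtain ⟨Λ', hΛ'⟩ := hdesc l' hl'
  have hXX : ∀ s u, ∃ n, j n = Ideal.Quotient.mk _ (X s * X u) := fun s u =>
    (hr _).2 ⟨_, (isHomogeneous_X T s).mul (isHomogeneous_X T u), rfl⟩
  obtain ⟨n, hn⟩ := hXX s u
  obtain ⟨n', hn'⟩ := hXX s' u'
  have := fitting ρ πρ hs hk ht σ hN h f g hm Λ Λ' n n'
  rw [hΛ _ _ hn, hΛ' _ _ hn', hΛ _ _ hn', hΛ' _ _ hn] at this
  simpa using this

end
end CI16

namespace CI16
section

/-- The linear form with coefficient vector `w`. -/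
def lform {K σ : Type*} [CommSemiring K] [Fintype σ] (w : σ → K) : MvPolynomial σ K :=
  ∑ j, C (w j) * X j

theorem lform_add {K σ : Type*} [CommSemiring K] [Fintype σ] (w w' : σ → K) :
    lform (w + w') = lform w + lform w' := by
  simp [lform, add_mul, Finset.sum_add_distrib]

theorem lform_smul {K σ : Type*} [CommSemiring K] [Fintype σ] (c : K) (w : σ → K) :
    lform (c • w) = C c * lform w := by
  simp [lform, Finset.mul_sum, mul_assoc]

/-- The ideal generated by the linear forms in `W`. -/
def IW {K σ : Type*} [Field K] [Fintype σ] (W : Submodule K (σ → K)) : Ideal (MvPolynomial σ K) :=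
  Ideal.span (lform '' (W : Set (σ → K)))

theorem IW_ker {K σ : Type*} [Field K] [Fintype σ] [DecidableEq σ] (W : Submodule K (σ → K)) :
    ∃ (g : MvPolynomial σ K →ₐ[K] MvPolynomial σ K), RingHom.ker g = IW W ∧
      ∀ w, g (lform w) = 0 → w ∈ W := by
  obtain ⟨W', hW'⟩ := W.exists_isCompl
  set pr : (σ → K) →ₗ[K] (σ → K) := W'.subtype ∘ₗ Submodule.projectionOnto W' W hW'.symm with hpr
  have hk : ∀ w, pr w = 0 ↔ w ∈ W := by
    intro w
    rw [hpr, LinearMap.comp_apply, Submodule.subtype_apply, ZeroMemClass.coe_eq_zero,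
      Submodule.projectionOnto_apply_eq_zero_iff]
  have hsub : ∀ w, w - pr w ∈ W := by
    intro w
    rw [← hk, map_sub, sub_eq_zero, hpr, LinearMap.comp_apply, LinearMap.comp_apply, Submodule.subtype_apply, Submodule.subtype_apply,
      Submodule.projectionOnto_apply_left]
  set g : MvPolynomial σ K →ₐ[K] MvPolynomial σ K := aeval fun j => lform (pr (Pi.single j 1)) with hg
  have hgl : ∀ w, g (lform w) = lform (pr w) := by
    intro w
    have h1 : lform w = ∑ j, C (w j) * X j := rfl
    rw [h1, map_sum]
    have h2 : pr w = ∑ j, w j • pr (Pi.single j 1) := by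
      conv_lhs => rw [pi_eq_sum_univ' w]
      simp [map_sum]
    rw [h2]
    have h3 : ∀ s : Finset σ, lform (∑ j ∈ s, w j • pr (Pi.single j 1)) = ∑ j ∈ s, g (C (w j) * X j) := by
      intro s
      induction s using Finset.induction_on with
      | empty => simp [lform]
      | insert a s ha ih =>
        rw [Finset.sum_insert ha, Finset.sum_insert ha, lform_add, ih, lform_smul, map_mul, hg, aeval_X]
        simp
    exact (h3 _).symm
  have hinj : ∀ w : σ → K, lform w = 0 → w = 0 := by
    intro w hw
    funext j
    have := congrArg (coeff (Finsupp.single j 1)) hw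
    simpa [lform, coeff_sum, coeff_C_mul, coeff_X', Finsupp.single_left_inj] using this
  refine ⟨g, le_antisymm ?_ ?_, ?_⟩
  · intro p hp
    have h1 : ∀ p, p - g p ∈ IW W := by
      intro p
      have : (Ideal.Quotient.mkₐ K (IW W)).comp g = Ideal.Quotient.mkₐ K (IW W) := by
        ext j
        simp only [AlgHom.comp_apply, hg, aeval_X, Ideal.Quotient.mkₐ_eq_mk]
        rw [Ideal.Quotient.eq, ← neg_mem_iff, neg_sub]
        have h3 : X j - lform (pr (Pi.single j 1)) = lform (Pi.single j 1 - pr (Pi.single j 1)) := by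
          rw [sub_eq_iff_eq_add, ← lform_add, sub_add_cancel]
          simp [lform, Pi.single_apply]
        rw [h3]
        exact Ideal.subset_span ⟨_, hsub _, rfl⟩
      rw [← Ideal.Quotient.eq]
      have := DFunLike.congr_fun this p
      simpa using this.symm
    have := h1 p
    rwa [RingHom.mem_ker.1 hp, sub_zero] at this
  · rw [IW, Ideal.span_le]
    rintro _ ⟨w, hw, rfl⟩
    rw [SetLike.mem_coe, RingHom.mem_ker]
    change g (lform w) = 0
    rw [hgl, (hk w).2 hw]; simp [lform]
  · intro w hw
    rw [hgl] at hw
    exact (hk w).1 (hinj _ hw)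

theorem IW_prime {K σ : Type*} [Field K] [Fintype σ] [DecidableEq σ] (W : Submodule K (σ → K)) :
    (IW W).IsPrime := by
  obtain ⟨g, hg, -⟩ := IW_ker W
  rw [← hg]; exact RingHom.ker_isPrime _

theorem IW_lt {K σ : Type*} [Field K] [Fintype σ] [DecidableEq σ] {W W' : Submodule K (σ → K)} (h : W < W') :
    IW W < IW W' := by
  refine lt_of_le_not_ge (Ideal.span_mono (Set.image_mono h.le)) fun hle => ?_
  obtain ⟨w, hw, hw'⟩ := SetLike.exists_of_lt h
  obtain ⟨g, hg, hg'⟩ := IW_ker W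
  refine hw' (hg' w ?_)
  have : lform w ∈ IW W := hle (Ideal.subset_span ⟨w, hw, rfl⟩)
  rw [← hg] at this; exact this

theorem IW_height {K σ : Type*} [Field K] [Fintype σ] [DecidableEq σ] (r : ℕ) : ∀ (W : Submodule K (σ → K)),
    r ≤ Module.finrank K W → (r : ℕ∞) ≤ (IW W).height := by
  induction r with
  | zero => intros; simp
  | succ r ih =>
    intro W hW
    obtain ⟨V, hV, hf⟩ : ∃ V < W, r ≤ Module.finrank K V := by
      obtain ⟨v, hv⟩ := exists_linearIndependent_of_le_finrank hW
      refine ⟨Submodule.map W.subtype (Submodule.span K (Set.range fun i : Fin r => v i.castSucc)), ?_, ?_⟩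
      · refine lt_of_le_of_ne (Submodule.map_subtype_le _ _) fun he => ?_
        have h1 := finrank_range_le_card (R := K) (b := fun i : Fin r => v i.castSucc)
        have h2 : Module.finrank K (Submodule.map W.subtype (Submodule.span K (Set.range fun i : Fin r => v i.castSucc))) = _ :=
          LinearEquiv.finrank_eq (Submodule.equivMapOfInjective W.subtype (Submodule.injective_subtype _) _).symm
        rw [he] at h2
        simp only [Set.finrank, Fintype.card_fin] at h1
        omega
      · rw [LinearEquiv.finrank_eq (Submodule.equivMapOfInjective W.subtype (Submodule.injective_subtype _) _).symm]
        have := finrank_span_eq_card (hv.comp (Fin.castSucc) (Fin.castSucc_injective r))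
        simp only [Fintype.card_fin] at this
        exact this.ge
    have := IW_prime V
    have := IW_prime W
    push_cast
    exact (add_le_add (ih V hf) le_rfl).trans (Ideal.height_add_one_le_of_lt_of_isPrime (IW_lt hV))

/-- columns over the residue field -/
def colsp {S : Type*} [CommRing S] {n d : ℕ} (ψ : Matrix (Fin n) (Fin d) S) {K : Type*} [Field K] (h : S →+* K) :
    Submodule K (Fin n → K) := Submodule.span K (Set.range fun i => fun j => h (ψ j i))

theorem quotEquiv_symm {S σ : Type*} [CommRing S] (p : Ideal S) (x : MvPolynomial σ S) :
    (quotientEquivQuotientMvPolynomial (σ := σ) p).symm (Ideal.Quotient.mk _ x) = MvPolynomial.map (Ideal.Quotient.mk p) x := by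
  rw [AlgEquiv.symm_apply_eq]
  have h : ((quotientEquivQuotientMvPolynomial (σ := σ) p : MvPolynomial σ (S ⧸ p) →+* _)).comp (MvPolynomial.map (Ideal.Quotient.mk p)) =
      Ideal.Quotient.mk (Ideal.map C p) := by
    refine MvPolynomial.ringHom_ext ?_ ?_
    · intro r
      simp [quotientEquivQuotientMvPolynomial]
    · intro i
      simp [quotientEquivQuotientMvPolynomial]
  exact (RingHom.congr_fun h x).symm


theorem height_ge {S : Type*} [CommRing S] [IsNoetherianRing S] {n d : ℕ} (ψ : Matrix (Fin n) (Fin d) S)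
    (Q : Ideal (MvPolynomial (Fin n) S)) [Q.IsPrime] (hQ : ∀ i, ∑ j, C (ψ j i) * X j ∈ Q)
    (p : Ideal S) [p.IsPrime] (hp : p = Q.comap C) (r : ℕ)
    (hr : r ≤ Module.finrank (FractionRing (S ⧸ p)) (colsp ψ ((algebraMap (S ⧸ p) (FractionRing (S ⧸ p))).comp (Ideal.Quotient.mk p)))) :
    p.height + r ≤ Q.height := by
  haveI : Q.LiesOver p := ⟨hp⟩
  rw [Ideal.height_eq_height_add_of_liesOver_of_hasGoingDown p Q]
  gcongr
  change (r : ℕ∞) ≤ (Q.map (Ideal.Quotient.mk <| p.map (C : S →+* MvPolynomial (Fin n) S))).height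
  set e := (quotientEquivQuotientMvPolynomial (σ := Fin n) p).symm.toRingEquiv with he
  set q := Q.map (Ideal.Quotient.mk <| p.map (C : S →+* MvPolynomial (Fin n) S)) with hq
  rw [← e.height_map q]
  have hle : p.map (C : S →+* MvPolynomial (Fin n) S) ≤ Q := by
    rw [Ideal.map_le_iff_le_comap, hp]
  haveI : q.IsPrime := by
    refine Ideal.map_isPrime_of_surjective Ideal.Quotient.mk_surjective ?_
    rwa [Ideal.mk_ker]
  haveI : (q.map e).IsPrime := Ideal.map_isPrime_of_equiv e
  have hmem : ∀ x, x ∈ Q → MvPolynomial.map (Ideal.Quotient.mk p) x ∈ q.map e := by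
    intro x hx
    have h1 : MvPolynomial.map (Ideal.Quotient.mk p) x = e (Ideal.Quotient.mk _ x) := by
      exact (quotEquiv_symm p x).symm
    rw [h1]
    exact Ideal.mem_map_of_mem _ (Ideal.mem_map_of_mem _ hx)
  have hmem' : ∀ x, MvPolynomial.map (Ideal.Quotient.mk p) x ∈ q.map e → x ∈ Q := by
    intro x hx
    have h1 : MvPolynomial.map (Ideal.Quotient.mk p) x = e (Ideal.Quotient.mk _ x) := by
      exact (quotEquiv_symm p x).symm
    rw [h1] at hx
    obtain ⟨z, hz, hze⟩ := (Ideal.mem_map_of_equiv e _).1 hx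
    have hx' : Ideal.Quotient.mk _ x ∈ q := by rwa [← e.injective hze]
    rw [hq, Ideal.mem_quotient_iff_mem hle] at hx'
    exact hx'
  set K := FractionRing (S ⧸ p)
  have hdis : Disjoint ((Submonoid.map (C : S ⧸ p →+* MvPolynomial (Fin n) (S ⧸ p)) (nonZeroDivisors (S ⧸ p)) : Submonoid _) : Set (MvPolynomial (Fin n) (S ⧸ p)))
      (q.map e : Set (MvPolynomial (Fin n) (S ⧸ p))) := by
    rw [Set.disjoint_left]
    rintro _ ⟨s, hs, rfl⟩ hs'
    obtain ⟨s, rfl⟩ := Ideal.Quotient.mk_surjective s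
    have : C s ∈ Q := hmem' _ (by simpa using hs')
    have : s ∈ p := by rw [hp]; exact this
    rw [← Ideal.Quotient.eq_zero_iff_mem] at this
    rw [this] at hs
    exact zero_notMem_nonZeroDivisors hs
  letI : Algebra (MvPolynomial (Fin n) (S ⧸ p)) (MvPolynomial (Fin n) K) := MvPolynomial.algebraMvPolynomial
  rw [← IsLocalization.height_map_of_disjoint (S := MvPolynomial (Fin n) K) _ (q.map e) hdis]
  refine (IW_height r _ hr).trans (Ideal.height_mono ?_)
  rw [IW, Ideal.span_le]
  rintro _ ⟨w, hw, rfl⟩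
  rw [SetLike.mem_coe]
  induction hw using Submodule.span_induction with
  | mem x hx =>
    obtain ⟨i, rfl⟩ := hx
    have := Ideal.mem_map_of_mem (algebraMap _ (MvPolynomial (Fin n) K)) (hmem _ (hQ i))
    convert this using 1
    change _ = MvPolynomial.map (algebraMap (S ⧸ p) K) _
    rw [lform, map_sum, map_sum]
    refine Finset.sum_congr rfl fun j _ => ?_
    rw [_root_.map_mul, _root_.map_mul, map_C, map_C, map_X, map_X]
    rfl
  | zero => simp [lform]
  | add x y _ _ hx hy => rw [lform_add]; exact add_mem hx hy
  | smul c x _ hx => rw [lform_smul]; exact Ideal.mul_mem_left _ _ hx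

end
end CI16

namespace CI16
section

theorem ht_two {S : Type*} [CommRing S] [IsDomain S] [UniqueFactorizationMonoid S] {f g : S}
    (hf : f ≠ 0) (hreg : ∀ x, f ∣ g * x → f ∣ x) (p : Ideal S) [p.IsPrime] (hfp : f ∈ p) (hgp : g ∈ p) :
    (2 : ℕ∞) ≤ p.height := by
  obtain ⟨π, hπ, hπf, hπp⟩ : ∃ π, Prime π ∧ π ∣ f ∧ π ∈ p := by
    clear hreg hgp
    induction f using UniqueFactorizationMonoid.induction_on_prime with
    | h₁ => exact absurd rfl hf
    | h₂ x hx => exact absurd (p.eq_top_of_isUnit_mem hfp hx) (Ideal.IsPrime.ne_top ‹_›)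
    | h₃ a q ha hq ih =>
      rcases (‹p.IsPrime›).mem_or_mem hfp with h | h
      · exact ⟨q, hq, dvd_mul_right _ _, h⟩
      · obtain ⟨π, h1, h2, h3⟩ := ih ha h
        exact ⟨π, h1, h2.mul_left _, h3⟩
  haveI : (Ideal.span {π}).IsPrime := (Ideal.span_singleton_prime hπ.ne_zero).2 hπ
  have hlt0 : (⊥ : Ideal S) < Ideal.span {π} := by
    rw [bot_lt_iff_ne_bot, Ne, Ideal.span_singleton_eq_bot]; exact hπ.ne_zero
  have h1 := Ideal.height_add_one_le_of_lt_of_isPrime hlt0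
  have hle : Ideal.span {π} ≤ p := by rwa [Ideal.span_singleton_le_iff_mem]
  rcases hle.lt_or_eq with hlt | heq
  · have h2 := Ideal.height_add_one_le_of_lt_of_isPrime hlt
    refine le_trans ?_ ((add_le_add h1 le_rfl).trans h2)
    rw [add_assoc, one_add_one_eq_two]
    exact le_add_self
  · exfalso
    rw [← heq, Ideal.mem_span_singleton] at hgp
    obtain ⟨f', rfl⟩ := hπf
    obtain ⟨g', rfl⟩ := hgp
    obtain ⟨c, hc⟩ := hreg f' ⟨g', by ring⟩
    have hf' : f' ≠ 0 := right_ne_zero_of_mul hf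
    have : f' * 1 = f' * (π * c) := by rw [mul_one]; conv_lhs => rw [hc]
                                       ring
    exact hπ.not_unit (IsUnit.of_mul_eq_one c (mul_left_cancel₀ hf' this).symm)

theorem reg_dvd {S : Type*} [CommRing S] {f g : S} (h : RingTheory.Sequence.IsRegular S [f, g]) :
    IsSMulRegular S f ∧ ∀ x, f ∣ g * x → f ∣ x := by
  rw [RingTheory.Sequence.isRegular_cons_iff] at h
  refine ⟨h.1, fun x hx => ?_⟩
  have h2 := ((RingTheory.Sequence.isRegular_cons_iff _ _ _).1 h.2).1
  have key : ∀ y : S, (Submodule.Quotient.mk y : QuotSMulTop f S) = 0 ↔ f ∣ y := by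
    intro y
    rw [Submodule.Quotient.mk_eq_zero, Submodule.mem_smul_pointwise_iff_exists]
    constructor
    · rintro ⟨b, -, rfl⟩; exact ⟨b, rfl⟩
    · rintro ⟨b, rfl⟩; exact ⟨b, trivial, rfl⟩
  rw [← key]
  refine h2.right_eq_zero_of_smul ?_
  rw [← Submodule.Quotient.mk_smul, key]
  exact hx

theorem ht_quot {S : Type*} [CommRing S] (I : Ideal S) (h2 : ∀ p : Ideal S, p.IsPrime → I ≤ p → (2 : ℕ∞) ≤ p.height)
    (c : ℕ) : ∀ (q : Ideal (S ⧸ I)) [q.IsPrime], (c : ℕ∞) ≤ q.height →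
      ((c + 2 : ℕ) : ℕ∞) ≤ (q.comap (Ideal.Quotient.mk I)).height := by
  have hle : ∀ q : Ideal (S ⧸ I), I ≤ q.comap (Ideal.Quotient.mk I) := by
    intro q x hx
    rw [Ideal.mem_comap, Ideal.Quotient.eq_zero_iff_mem.2 hx]; exact zero_mem _
  induction c with
  | zero =>
    intro q hq _
    simpa using h2 _ (Ideal.comap_isPrime _ _) (hle q)
  | succ c ih =>
    intro q hq hc
    obtain ⟨q', hq', hlt, hc'⟩ : ∃ q' : Ideal (S ⧸ I), q'.IsPrime ∧ q' < q ∧ (c : ℕ∞) ≤ q'.height := by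
      by_contra hcon
      push Not at hcon
      have := Ideal.height_le_iff.2 hcon
      have := hc.trans this
      norm_cast at this
      omega
    have h1 := ih q' hc'
    have h3 : q'.comap (Ideal.Quotient.mk I) < q.comap (Ideal.Quotient.mk I) := by
      refine lt_of_le_not_ge (Ideal.comap_mono hlt.le) fun h => hlt.not_ge ?_
      exact (Ideal.comap_le_comap_iff_of_surjective _ Ideal.Quotient.mk_surjective _ _).1 h
    have h4 := Ideal.height_add_one_le_of_lt_of_isPrime h3
    refine le_trans ?_ h4
    refine le_trans ?_ (add_le_add h1 le_rfl)
    norm_cast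

theorem rank_zero {S : Type*} [CommRing S] (I p : Ideal S) [IsNoetherianRing (S ⧸ I)] [p.IsPrime]
    (q : Ideal (S ⧸ I)) [q.IsPrime] (hq : p = q.comap (Ideal.Quotient.mk I)) (h0 : q.height = 0)
    {n d : ℕ} (ψ : Matrix (Fin n) (Fin d) S) (φ : Matrix (Fin n) (Fin d) (S ⧸ I))
    (hφψ : ∀ i j, φ i j = Ideal.Quotient.mk _ (ψ i j)) (hinj : Function.Injective φ.mulVecLin) :
    d ≤ Module.finrank (FractionRing (S ⧸ p)) (colsp ψ ((algebraMap (S ⧸ p) (FractionRing (S ⧸ p))).comp (Ideal.Quotient.mk p))) := by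
  have hmin : q ∈ (Module.annihilator (S ⧸ I) (S ⧸ I)).minimalPrimes := by
    have : q ∈ minimalPrimes (S ⧸ I) := Ideal.height_eq_zero_iff.1 h0
    rw [Module.annihilator_eq_bot.2 inferInstance]
    exact this
  obtain ⟨-, t, ht⟩ := isAssociatedPrime_iff.1 (Module.associatedPrimes.minimalPrimes_annihilator_subset_associatedPrimes (S ⧸ I) (S ⧸ I) hmin)
  have ht : ∀ x, x ∈ q ↔ x * t = 0 := by
    intro x
    conv_lhs => rw [ht]
    simp [Submodule.mem_colon_singleton]
  set K := FractionRing (S ⧸ p)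
  have hli : LinearIndependent K (fun i : Fin d => fun j : Fin n => ((algebraMap (S ⧸ p) K).comp (Ideal.Quotient.mk p)) (ψ j i)) := by
    rw [← LinearIndependent.iff_fractionRing (S ⧸ p) K, Fintype.linearIndependent_iff]
    intro c hc
    choose s hs using fun i => Ideal.Quotient.mk_surjective (I := p) (c i)
    have h1 : ∀ j, ∑ i, s i * ψ j i ∈ p := by
      intro j
      have := congrFun hc j
      simp only [Finset.sum_apply, Pi.smul_apply, Pi.zero_apply] at this
      simp only [← hs, Algebra.smul_def, RingHom.comp_apply, ← _root_.map_mul, ← map_sum] at this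
      rw [← Ideal.Quotient.eq_zero_iff_mem]
      exact (FaithfulSMul.algebraMap_eq_zero_iff _ K).1 this
    have h2 : φ.mulVecLin (fun i => Ideal.Quotient.mk I (s i) * t) = 0 := by
      funext j
      rw [Matrix.mulVecLin_apply, Matrix.mulVec, dotProduct, Pi.zero_apply]
      have := h1 j
      rw [hq, Ideal.mem_comap, ht, map_sum, Finset.sum_mul] at this
      rw [← this]
      refine Finset.sum_congr rfl fun i _ => ?_
      rw [hφψ, _root_.map_mul]; ring
    have h3 := hinj (h2.trans (map_zero _).symm)
    intro i
    rw [← hs, Ideal.Quotient.eq_zero_iff_mem, hq, Ideal.mem_comap, ht]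
    exact congrFun h3 i
  have := finrank_span_eq_card hli
  rw [Fintype.card_fin] at this
  exact this.ge

theorem lift_zero {R E K : Type*} [CommRing R] [Field K] [Algebra R K] [AddCommGroup E] [Module R E] (q : Ideal R) [q.IsPrime]
    (hK : ∀ r, algebraMap R K r = 0 ↔ r ∈ q) (s : Finset (LocalizedModule q.primeCompl E))
    (hs : Submodule.span (Localization.AtPrime q) (s : Set (LocalizedModule q.primeCompl E)) = ⊤)
    (m : s → E) (t : s → q.primeCompl) (hm : ∀ z, z.1 = LocalizedModule.mk (m z) (t z))
    (L : E →ₗ[R] K) (hL : ∀ z, L (m z) = 0) : L = 0 := by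
  have hu : ∀ x : q.primeCompl, IsUnit ((algebraMap R (Module.End R K)) x) := by
    intro x
    have hx : algebraMap R K x ≠ 0 := fun h => x.2 ((hK _).1 h)
    rw [Module.End.isUnit_iff]
    constructor
    · intro a b hab
      simp only [Module.algebraMap_end_apply, Algebra.smul_def] at hab
      exact mul_left_cancel₀ hx hab
    · intro b
      refine ⟨(algebraMap R K x)⁻¹ * b, ?_⟩
      simp only [Module.algebraMap_end_apply, Algebra.smul_def]
      rw [mul_inv_cancel_left₀ hx]
  set F := LocalizedModule.lift q.primeCompl L hu with hF
  have h0 : ∀ z, F z = 0 := by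
    intro z
    have hz : z ∈ Submodule.span (Localization.AtPrime q) (s : Set (LocalizedModule q.primeCompl E)) := hs ▸ trivial
    induction hz using Submodule.span_induction with
    | mem x hx =>
      have := hm ⟨x, hx⟩
      simp only at this
      rw [this, hF, LocalizedModule.lift_mk, hL, map_zero]
    | zero => simp
    | add x y _ _ hx hy => rw [map_add, hx, hy, add_zero]
    | smul c x _ hx =>
      obtain ⟨r, u, rfl⟩ := IsLocalization.exists_mk'_eq q.primeCompl c
      have h1 : (u : R) • (IsLocalization.mk' (Localization.AtPrime q) r u • x) = r • x := by
        rw [← smul_assoc, Algebra.smul_def, IsLocalization.mk'_spec', algebraMap_smul]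
      have h2 := congrArg F h1
      rw [F.map_smul (u : R), F.map_smul r, hx, smul_zero, Algebra.smul_def] at h2
      rcases mul_eq_zero.1 h2 with h | h
      · exact absurd ((hK _).1 h) u.2
      · exact h
  ext x
  have := h0 (LocalizedModule.mk x 1)
  have h3 : F (LocalizedModule.mk x 1) = L x := by
    rw [hF]; exact LinearMap.congr_fun (LocalizedModule.lift_comp q.primeCompl L hu) x
  rw [← h3, this]; rfl

theorem rank_pos {S : Type} [CommRing S] (I p : Ideal S) [p.IsPrime]
    (q : Ideal (S ⧸ I)) [q.IsPrime] (hq : p = q.comap (Ideal.Quotient.mk I)) 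
    {n d : ℕ} (ψ : Matrix (Fin n) (Fin d) S) (φ : Matrix (Fin n) (Fin d) (S ⧸ I))
    (hφψ : ∀ i j, φ i j = Ideal.Quotient.mk _ (ψ i j))
    {E : Type} [AddCommGroup E] [Module (S ⧸ I) E] (π : (Fin n → S ⧸ I) →ₗ[S ⧸ I] E) (hsurj : Function.Surjective π)
    (hker : LinearMap.ker π = LinearMap.range φ.mulVecLin)
    (s : Finset (LocalizedModule q.primeCompl E))
    (hs : Submodule.span (Localization.AtPrime q) (s : Set (LocalizedModule q.primeCompl E)) = ⊤) :
    n ≤ s.card + Module.finrank (FractionRing (S ⧸ p)) (colsp ψ ((algebraMap (S ⧸ p) (FractionRing (S ⧸ p))).comp (Ideal.Quotient.mk p))) := by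
  set K := FractionRing (S ⧸ p)
  set h := (algebraMap (S ⧸ p) K).comp (Ideal.Quotient.mk p) with hh
  have hh0 : ∀ x, h x = 0 ↔ x ∈ p := by
    intro x
    rw [hh, RingHom.comp_apply, FaithfulSMul.algebraMap_eq_zero_iff, Ideal.Quotient.eq_zero_iff_mem]
  have hIp : ∀ x ∈ I, h x = 0 := by
    intro x hx
    rw [hh0, hq, Ideal.mem_comap, Ideal.Quotient.eq_zero_iff_mem.2 hx]; exact zero_mem _
  letI : Algebra (S ⧸ I) K := (Ideal.Quotient.lift I h hIp).toAlgebra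
  have hal : ∀ x, algebraMap (S ⧸ I) K (Ideal.Quotient.mk I x) = h x := fun x => Ideal.Quotient.lift_mk _ _ _
  have hK : ∀ r, algebraMap (S ⧸ I) K r = 0 ↔ r ∈ q := by
    intro r
    obtain ⟨r, rfl⟩ := Ideal.Quotient.mk_surjective r
    rw [hal, hh0, hq, Ideal.mem_comap]
  have hrep : ∀ z : s, ∃ (v : Fin n → S ⧸ I) (t : q.primeCompl), z.1 = LocalizedModule.mk (π v) t := by
    intro z
    induction z.1 using LocalizedModule.induction_on with
    | h m t =>
      obtain ⟨v, rfl⟩ := hsurj m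
      exact ⟨v, t, rfl⟩
  choose v t hvt using hrep
  set M : Matrix (Fin n) (Fin d) K := ψ.map h with hM
  have hrank : Module.finrank K (colsp ψ h) = M.rank := by
    rw [Matrix.rank_eq_finrank_span_cols]; rfl
  have hrank' : n = M.rank + Module.finrank K (LinearMap.ker M.transpose.mulVecLin) := by
    rw [← Matrix.rank_transpose, Matrix.rank, LinearMap.finrank_range_add_finrank_ker]; simp
  let G : LinearMap.ker M.transpose.mulVecLin →ₗ[K] (s → K) :=
    { toFun := fun u z => ∑ j, u.1 j * algebraMap (S ⧸ I) K (v z j)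
      map_add' := by intro a b; funext z; simp [add_mul, Finset.sum_add_distrib]
      map_smul' := by intro a b; funext z; simp [mul_assoc]; rw [Finset.mul_sum] }
  have hG : Function.Injective G := by
    rw [← LinearMap.ker_eq_bot, LinearMap.ker_eq_bot']
    intro u hu
    let L0 : (Fin n → S ⧸ I) →ₗ[S ⧸ I] K :=
      { toFun := fun v => ∑ j, u.1 j * algebraMap (S ⧸ I) K (v j)
        map_add' := by intro a b; simp [mul_add, Finset.sum_add_distrib]
        map_smul' := by
          intro a b
          simp only [Pi.smul_apply, smul_eq_mul, _root_.map_mul, RingHom.id_apply, Algebra.smul_def, Finset.mul_sum]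
          exact Finset.sum_congr rfl fun _ _ => by ring }
    have hL0 : LinearMap.ker π ≤ LinearMap.ker L0 := by
      rw [hker]
      rintro _ ⟨w, rfl⟩
      rw [LinearMap.mem_ker]
      have hu' := LinearMap.mem_ker.1 u.2
      change ∑ j, u.1 j * algebraMap (S ⧸ I) K (∑ i, φ j i * w i) = 0
      simp only [map_sum, Finset.mul_sum, _root_.map_mul]
      rw [Finset.sum_comm]
      refine Finset.sum_eq_zero fun i _ => ?_
      have h5 := congrFun hu' i
      simp only [Matrix.mulVecLin_apply, Matrix.mulVec, dotProduct, Matrix.transpose_apply, hM, Matrix.map_apply, Pi.zero_apply] at h5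
      have : ∀ j, u.1 j * (algebraMap (S ⧸ I) K (φ j i) * algebraMap (S ⧸ I) K (w i)) = h (ψ j i) * u.1 j * algebraMap (S ⧸ I) K (w i) := by
        intro j; rw [hφψ, hal]; ring
      simp only [this]
      rw [← Finset.sum_mul, h5, zero_mul]
    let L : E →ₗ[S ⧸ I] K := ((LinearMap.ker π).liftQ L0 hL0) ∘ₗ (π.quotKerEquivOfSurjective hsurj).symm.toLinearMap
    have hLπ : ∀ v, L (π v) = L0 v := by
      intro v
      have h6 : (π.quotKerEquivOfSurjective hsurj).symm (π v) = Submodule.Quotient.mk v := by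
        rw [LinearEquiv.symm_apply_eq]; rfl
      change ((LinearMap.ker π).liftQ L0 hL0) ((π.quotKerEquivOfSurjective hsurj).symm (π v)) = _
      rw [h6, Submodule.liftQ_apply]
    have hLz := lift_zero q hK s hs (fun z => π (v z)) t hvt L (fun z => by rw [hLπ]; exact congrFun hu z)
    ext j
    have h7 := hLπ (Pi.single j 1)
    rw [hLz] at h7
    change 0 = ∑ j', u.1 j' * algebraMap (S ⧸ I) K ((Pi.single j 1 : Fin n → S ⧸ I) j') at h7
    rw [Finset.sum_eq_single j] at h7
    · simpa using h7.symm
    · intro b _ hb; simp [hb]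
    · simp
  have := LinearMap.finrank_le_finrank_of_injective hG
  rw [Module.finrank_fintype_fun_eq_card, Fintype.card_coe] at this
  rw [hrank]
  omega


theorem height_all {S : Type} [CommRing S] [IsDomain S] [IsNoetherianRing S] [UniqueFactorizationMonoid S] {f g : S}
    (hfg : RingTheory.Sequence.IsRegular S [f, g]) (I : Ideal S) (hI : I = Ideal.span {f, g}) {d e : ℕ} (hd : 2 ≤ d)
    (ψ : Matrix (Fin (d + e)) (Fin d) S) (φ : Matrix (Fin (d + e)) (Fin d) (S ⧸ I))
    (hφψ : ∀ i j, φ i j = Ideal.Quotient.mk _ (ψ i j)) (hinj : Function.Injective φ.mulVecLin)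
    {E : Type} [AddCommGroup E] [Module (S ⧸ I) E]
    (π : (Fin (d + e) → S ⧸ I) →ₗ[S ⧸ I] E) (hsurj : Function.Surjective π)
    (hker : LinearMap.ker π = LinearMap.range φ.mulVecLin)
    (hGd : ∀ (p : Ideal (S ⧸ I)) (_ : p.IsPrime) (c : ℕ),
      ringKrullDim (Localization.AtPrime p) = (c : WithBot ℕ∞) → 1 ≤ c → c ≤ d - 1 →
      ∃ s : Finset (LocalizedModule p.primeCompl E), s.card ≤ c + e - 1 ∧
        Submodule.span (Localization.AtPrime p)
          (s : Set (LocalizedModule p.primeCompl E)) = ⊤)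
    (Q : Ideal (MvPolynomial (Fin (d + e)) S)) [Q.IsPrime] (hQ : ∀ i, ∑ j, C (ψ j i) * X j ∈ Q)
    (hfQ : C f ∈ Q) (hgQ : C g ∈ Q) : ((d + 2 : ℕ) : ℕ∞) ≤ Q.height := by
  obtain ⟨hf, hreg⟩ := reg_dvd hfg
  have hf0 : f ≠ 0 := by
    rintro rfl
    exact one_ne_zero (hf.right_eq_zero_of_smul (x := (1 : S)) (by simp))
  have h2 : ∀ p : Ideal S, p.IsPrime → I ≤ p → (2 : ℕ∞) ≤ p.height := by
    intro p hp hle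
    rw [hI] at hle
    exact ht_two hf0 hreg p (hle (Ideal.subset_span (by simp))) (hle (Ideal.subset_span (by simp)))
  set p : Ideal S := Q.comap C with hp
  haveI : p.IsPrime := Ideal.comap_isPrime _ _
  have hIp : I ≤ p := by
    rw [hI, Ideal.span_le]
    rintro x (rfl | rfl)
    · exact hfQ
    · exact hgQ
  set q : Ideal (S ⧸ I) := p.map (Ideal.Quotient.mk I) with hq
  have hqp : p = q.comap (Ideal.Quotient.mk I) := by
    rw [hq, Ideal.comap_map_of_surjective _ Ideal.Quotient.mk_surjective, ← RingHom.ker_eq_comap_bot, Ideal.mk_ker, sup_eq_left.2 hIp]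
  haveI : q.IsPrime := Ideal.map_isPrime_of_surjective Ideal.Quotient.mk_surjective (by rwa [Ideal.mk_ker])
  by_cases hdq : ((d : ℕ) : ℕ∞) ≤ q.height
  · have := ht_quot I h2 d q hdq
    rw [← hqp] at this
    refine this.trans ?_
    have := height_ge ψ Q hQ p rfl 0 (Nat.zero_le _)
    simpa using this
  · push Not at hdq
    obtain ⟨c, hc⟩ := ENat.ne_top_iff_exists.1 (ne_top_of_lt hdq)
    have hcd : c < d := by rw [← hc] at hdq; exact_mod_cast hdq
    have hpc := ht_quot I h2 c q hc.le
    rw [← hqp] at hpc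
    have key : d - c ≤ Module.finrank (FractionRing (S ⧸ p)) (colsp ψ ((algebraMap (S ⧸ p) (FractionRing (S ⧸ p))).comp (Ideal.Quotient.mk p))) := by
      rcases Nat.eq_zero_or_pos c with h0 | h0
      · subst h0
        exact rank_zero I p q hqp (by rw [← hc]; rfl) ψ φ hφψ hinj
      · have hdim : ringKrullDim (Localization.AtPrime q) = (c : WithBot ℕ∞) := by
          rw [IsLocalization.AtPrime.ringKrullDim_eq_height q, ← hc]; rfl
        obtain ⟨s, hs1, hs2⟩ := hGd q inferInstance c hdim h0 (by omega)
        have := rank_pos I p q hqp ψ φ hφψ π hsurj hker s hs2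
        omega
    have h5 := height_ge ψ Q hQ p rfl _ key
    refine le_trans ?_ ((add_le_add hpc le_rfl).trans h5)
    norm_cast
    omega

end
end CI16

namespace CI16
section

theorem main_one {T : Type} [CommRing T] [IsDomain T] [IsNoetherianRing T] [UniqueFactorizationMonoid T] {d : ℕ}
    (hd : 1 ≤ d) {J : Matrix (Fin d) (Fin d ⊕ Fin 2) T} {a} (hT : HT J a) :
    ∃ z : T, ∀ t, (∃ N, Tor J a t N) ↔ z ∣ t := by
  by_cases h : ∃ t : T, t ≠ 0 ∧ ∃ N, Tor J a t N
  · obtain ⟨t, ht, N, hN⟩ := h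
    obtain ⟨θ, hg, hp, hn⟩ := exists_good hd hT ht hN
    exact ⟨_, core hd hT hg hp hn⟩
  · push Not at h
    refine ⟨0, fun t => ?_⟩
    rw [zero_dvd_iff]
    constructor
    · rintro ⟨N, hN⟩
      by_contra ht
      exact h t ht N hN
    · rintro rfl
      exact ⟨0, fun μ _ => by simp⟩

theorem exists_minor {T : Type} [CommRing T] [IsDomain T] [IsNoetherianRing T] (D : Set T)
    (hD : ∀ p : Ideal T, p.IsPrime → D ⊆ p → (2 : ℕ∞) ≤ p.height) (π : T) (hπ : Prime π) : ∃ x ∈ D, ¬ π ∣ x := by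
  by_contra hcon
  push Not at hcon
  haveI hp : (Ideal.span {π}).IsPrime := (Ideal.span_singleton_prime hπ.ne_zero).2 hπ
  have h1 := hD (Ideal.span {π}) hp (fun x hx => Ideal.mem_span_singleton.2 (hcon x hx))
  have h2 := Ideal.height_le_card_of_mem_minimalPrimes_span_finset (s := {π}) (p := Ideal.span {π})
    (by
      rw [Finset.coe_singleton, Ideal.minimalPrimes_eq_subsingleton_self]; rfl)
  have := h1.trans h2
  simp at this

theorem main_two {k : Type} [Field k] {n d : ℕ} (hn : 1 ≤ n) (hd : 1 ≤ d)
    {J : Matrix (Fin d) (Fin d ⊕ Fin 2) (MvPolynomial (Fin n) k)} {a} (hT : HT J a)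
    (hJ : ∀ i s, (J i s).IsHomogeneous 1) (ha : ∀ i s u, (a i s u).IsHomogeneous 0)
    {N : Type*} [AddCommGroup N] [Module (MvPolynomial (Fin n) k) N]
    (j : N →+ (MvPolynomial (Fin d ⊕ Fin 2) (MvPolynomial (Fin n) k) ⧸ LL J a))
    (hjs : ∀ t n, j (t • n) = Ideal.Quotient.mk _ (C t) * j n)
    (hj : Function.Injective j)
    (hr : ∀ z, (∃ n, j n = z) ↔ ∃ p : MvPolynomial (Fin d ⊕ Fin 2) (MvPolynomial (Fin n) k), p.IsHomogeneous 2 ∧ Ideal.Quotient.mk _ p = z)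
    {ι κ : Type} [Fintype ι] [Fintype κ] [DecidableEq ι] [DecidableEq κ] (ρ : Matrix ι κ (MvPolynomial (Fin n) k))
    (πρ : (ι → MvPolynomial (Fin n) k) →ₗ[MvPolynomial (Fin n) k] N) (hs : Function.Surjective πρ) (hk : LinearMap.ker πρ = LinearMap.range ρ.mulVecLin)
    (hD : ∀ p : Ideal (MvPolynomial (Fin n) k), p.IsPrime →
      {x | ∃ (f : Fin ρ.rank → ι) (g : Fin ρ.rank → κ), x = (ρ.submatrix f g).det} ⊆ (p : Set (MvPolynomial (Fin n) k)) → (2 : ℕ∞) ≤ p.height) :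
    ∃ z : MvPolynomial (Fin n) k, z.IsHomogeneous (4 * d) ∧ ∀ t, (∃ N, Tor J a t N) ↔ z ∣ t := by
  by_cases h : ∃ t : MvPolynomial (Fin n) k, t ≠ 0 ∧ ∃ N, Tor J a t N
  · obtain ⟨t, ht, N, hN⟩ := h
    obtain ⟨θ, hg, hp, hne⟩ := exists_good hd hT ht hN
    have hdv := (core hd hT hg hp hne t).1 ⟨N, hN⟩
    have hnz : θ (syl J (aT a)) ≠ 0 := by
      intro h0; rw [h0, zero_dvd_iff] at hdv; exact ht hdv
    obtain ⟨i, j', hij, θ', h1, h2⟩ := part_two hd hT ⟨X ⟨0, hn⟩, MvPolynomial.X_prime⟩ ht hN (by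
      intro π hπ
      haveI hpp : (Ideal.span {π}).IsPrime := (Ideal.span_singleton_prime hπ.ne_zero).2 hπ
      obtain ⟨x, ⟨f, g, rfl⟩, hx⟩ := exists_minor _ hD π hπ
      have h0 : ∀ t, ((algebraMap (MvPolynomial (Fin n) k ⧸ Ideal.span {π}) (FractionRing (MvPolynomial (Fin n) k ⧸ Ideal.span {π}))).comp (Ideal.Quotient.mk _)) t = 0 ↔ π ∣ t := by
        intro t
        rw [RingHom.comp_apply, FaithfulSMul.algebraMap_eq_zero_iff, Ideal.Quotient.eq_zero_iff_mem, Ideal.mem_span_singleton]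
      refine ⟨FractionRing (MvPolynomial (Fin n) k ⧸ Ideal.span {π}), inferInstance, _, h0, ?_⟩
      exact prop2_fit j hjs hj hr hg hnz ρ πρ hs hk _ f g (fun h => hx ((h0 _).1 h)))
    exact ⟨_, gen_homog hJ ha hij θ' h1, h2⟩
  · push Not at h
    refine ⟨0, isHomogeneous_zero _ _ _, fun t => ?_⟩
    rw [zero_dvd_iff]
    constructor
    · rintro ⟨N, hN⟩
      by_contra ht
      exact h t ht N hN
    · rintro rfl
      exact ⟨0, fun μ _ => by simp⟩

end
end CI16

namespace CI16
section
section

variable {k : Type} [Field k] {d n : ℕ}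

/-- The identification of the bigraded ring with polynomials in `x` over `T`. -/
def EE (k : Type) [Field k] (d n : ℕ) : MvPolynomial (Fin (d + 2) ⊕ Fin n) k ≃+*
    MvPolynomial (Fin d ⊕ Fin 2) (MvPolynomial (Fin n) k) :=
  (sumAlgEquiv k (Fin (d + 2)) (Fin n)).toRingEquiv.trans
    (renameEquiv (MvPolynomial (Fin n) k) (finSumFinEquiv (m := d) (n := 2)).symm).toRingEquiv

theorem EE_inl (s) : EE k d n (X (Sum.inl s)) = X (finSumFinEquiv.symm s) := by
  simp [EE, sumAlgEquiv_X_inl]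

theorem EE_inr (s) : EE k d n (X (Sum.inr s)) = C (X s) := by
  simp [EE, sumAlgEquiv_X_inr]

theorem EE_C (c : k) : EE k d n (C c) = C (C c) := by
  have := sumAlgEquiv_C_inl (R := k) (S₁ := Fin (d+2)) (S₂ := Fin n)  c
  simp [EE, this]

theorem EE_rename (t : MvPolynomial (Fin n) k) : EE k d n (rename Sum.inr t) = C t := by
  have : ((EE k d n).toRingHom.comp (rename Sum.inr : MvPolynomial (Fin n) k →ₐ[k] _).toRingHom) = C := by
    ext i : 1
    · ext c; simp [EE_C]
    · simp [EE_inr]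
  exact RingHom.congr_fun this t

theorem EE_symm_C (t : MvPolynomial (Fin n) k) : (EE k d n).symm (C t) = rename Sum.inr t := by
  rw [RingEquiv.symm_apply_eq, EE_rename]

theorem EE_symm_X (s) : (EE k d n).symm (X s) = X (Sum.inl (finSumFinEquiv s)) := by
  rw [RingEquiv.symm_apply_eq, EE_inl]; simp

theorem rename_wx (t : MvPolynomial (Fin n) k) :
    (rename Sum.inr t : MvPolynomial (Fin (d + 2) ⊕ Fin n) k).IsWeightedHomogeneous (Stmt16.wx (d + 2) n) 0 := by
  rw [t.as_sum, map_sum]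
  refine IsWeightedHomogeneous.sum _ _ _ fun m _ => ?_
  rw [rename_monomial]
  apply isWeightedHomogeneous_monomial
  rw [Finsupp.weight_apply, Finsupp.sum_mapDomain_index (by simp) (by simp [add_mul])]
  simp [Stmt16.wx]

theorem EE_hom {p : MvPolynomial (Fin (d + 2) ⊕ Fin n) k} {j : ℕ}
    (hp : p.IsWeightedHomogeneous (Stmt16.wx (d + 2) n) j) : (EE k d n p).IsHomogeneous j := by
  rw [p.as_sum, map_sum]
  refine IsHomogeneous.sum _ _ _ fun m hm => ?_
  have hw := hp (mem_support_iff.1 hm)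
  rw [monomial_eq, _root_.map_mul, EE_C, Finsupp.prod, map_prod, ← hw, ← zero_add (Finsupp.weight _ _)]
  refine (isHomogeneous_C _ _).mul ?_
  rw [Finsupp.weight_apply, Finsupp.sum]
  refine IsHomogeneous.prod _ _ _ fun i _ => ?_
  rw [map_pow]
  rcases i with i | i
  · rw [EE_inl]
    simpa [Stmt16.wx] using (isHomogeneous_X _ _).pow (m (Sum.inl i))
  · rw [EE_inr]
    simpa [Stmt16.wx] using (isHomogeneous_C (Fin d ⊕ Fin 2) (X i : MvPolynomial (Fin n) k)).pow (m (Sum.inr i))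

theorem EE_symm_hom {q : MvPolynomial (Fin d ⊕ Fin 2) (MvPolynomial (Fin n) k)} {j : ℕ}
    (hq : q.IsHomogeneous j) : ((EE k d n).symm q).IsWeightedHomogeneous (Stmt16.wx (d + 2) n) j := by
  rw [q.as_sum, map_sum]
  refine IsWeightedHomogeneous.sum _ _ _ fun m hm => ?_
  have hw := hq (mem_support_iff.1 hm)
  rw [monomial_eq, _root_.map_mul, EE_symm_C, Finsupp.prod, map_prod, ← hw, ← zero_add (Finsupp.weight _ _)]
  refine (rename_wx _).mul ?_
  rw [Finsupp.weight_apply, Finsupp.sum]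
  refine IsWeightedHomogeneous.prod _ _ _ fun i _ => ?_
  rw [map_pow, EE_symm_X]
  simpa [Stmt16.wx] using (isWeightedHomogeneous_X k (Stmt16.wx (d + 2) n) (Sum.inl (finSumFinEquiv i))).pow (m i)

theorem deg_one {σ : Type} (m : σ →₀ ℕ) : m.degree = 1 ↔ ∃ s, m = Finsupp.single s 1 := by
  constructor
  · intro hm
    have h0 : m ≠ 0 := by rintro rfl; simp at hm
    obtain ⟨s, hs⟩ := Finsupp.ne_iff.1 h0
    have hs' : Finsupp.single s 1 ≤ m := by
      rw [Finsupp.single_le_iff]; simp at hs; omega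
    obtain ⟨m', rfl⟩ := exists_add_of_le hs'
    have : m'.degree = 0 := by
      rw [map_add, Finsupp.degree_single] at hm; omega
    rw [Finsupp.degree_eq_zero_iff] at this
    exact ⟨s, by simp [this]⟩
  · rintro ⟨s, rfl⟩; simp

theorem lin_form {σ : Type} [Fintype σ] {f : MvPolynomial σ k} (hf : f.IsHomogeneous 1) :
    ∃ c : σ → k, f = ∑ s, C (c s) * X s := by
  refine ⟨fun s => coeff (Finsupp.single s 1) f, ?_⟩
  classical
  have h : ∀ m ∈ f.support, ∃ s, m = Finsupp.single s 1 := by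
    intro m hm
    have := hf (mem_support_iff.1 hm)
    replace this := (DFunLike.congr_fun Finsupp.degree_eq_weight_one m).trans this
    exact (deg_one m).1 this
  ext m
  by_cases hm : m ∈ f.support
  · obtain ⟨s, rfl⟩ := h m hm
    rw [coeff_sum, Finset.sum_eq_single s]
    · simp [coeff_C_mul, coeff_X]
    · intro b _ hb
      simp [coeff_C_mul, coeff_X', Finsupp.single_left_inj, hb]
    · simp
  · rw [notMem_support_iff.1 hm, coeff_sum]
    symm
    refine Finset.sum_eq_zero fun s _ => ?_
    rw [coeff_C_mul, coeff_X']
    split_ifs with hh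
    · show coeff (Finsupp.single s 1) f * 1 = 0
      rw [hh, notMem_support_iff.1 hm]; simp
    · simp

theorem quad_form {σ : Type} [Fintype σ] {f : MvPolynomial σ k} (hf : f.IsHomogeneous 2) :
    ∃ c : σ → σ → k, f = ∑ s, ∑ t, C (c s t) * (X s * X t) := by
  classical
  have key : ∀ m : σ →₀ ℕ, m.degree = 2 → ∃ s t, m = Finsupp.single s 1 + Finsupp.single t 1 := by
    intro m hm
    have h0 : m ≠ 0 := by rintro rfl; simp at hm
    obtain ⟨s, hs⟩ := Finsupp.ne_iff.1 h0
    have hs' : Finsupp.single s 1 ≤ m := by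
      rw [Finsupp.single_le_iff]; simp at hs; omega
    obtain ⟨m', rfl⟩ := exists_add_of_le hs'
    have : m'.degree = 1 := by
      rw [map_add, Finsupp.degree_single] at hm; omega
    obtain ⟨t, rfl⟩ := (deg_one m').1 this
    exact ⟨s, t, rfl⟩
  have h2 : ∀ m ∈ f.support, ∃ c : σ → σ → k, monomial m (coeff m f) = ∑ s, ∑ t, C (c s t) * (X s * X t) := by
    intro m hm
    have := hf (mem_support_iff.1 hm)
    replace this := (DFunLike.congr_fun Finsupp.degree_eq_weight_one m).trans this
    obtain ⟨s, t, rfl⟩ := key m this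
    refine ⟨fun s' t' => if s' = s then (if t' = t then coeff (Finsupp.single s 1 + Finsupp.single t 1) f else 0) else 0, ?_⟩
    rw [Finset.sum_eq_single s, Finset.sum_eq_single t]
    · beta_reduce; rw [if_pos rfl, if_pos rfl, X, X, monomial_mul, C_mul_monomial]; simp
    · intro b _ hb; simp [hb]
    · simp
    · intro b _ hb; simp [hb]
    · simp
  choose! c hc using h2
  refine ⟨fun s t => ∑ m ∈ f.support, c m s t, ?_⟩
  conv_lhs => rw [f.as_sum, Finset.sum_congr rfl hc]
  rw [Finset.sum_comm]
  refine Finset.sum_congr rfl fun s _ => ?_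
  rw [Finset.sum_comm]
  refine Finset.sum_congr rfl fun t _ => ?_
  rw [map_sum, Finset.sum_mul]

end
end
end CI16

namespace CI16
section
section

variable {k : Type} [Field k] {d n : ℕ}

/-- Coefficient matrix of the linear forms. -/
def JJ (c : Fin n → Fin d → Fin (d + 2) → k) : Matrix (Fin d) (Fin d ⊕ Fin 2) (MvPolynomial (Fin n) k) :=
  fun i s => ∑ j, C (c j i (finSumFinEquiv s)) * X j

/-- Coefficient matrices of the quadrics. -/
def aa (n : ℕ) (c : Fin 2 → Fin (d + 2) → Fin (d + 2) → k) : Fin 2 → Matrix (Fin d ⊕ Fin 2) (Fin d ⊕ Fin 2) (MvPolynomial (Fin n) k) :=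
  fun r t s => C (c r (finSumFinEquiv t) (finSumFinEquiv s))

theorem JJ_hom (c : Fin n → Fin d → Fin (d + 2) → k) (i s) : (JJ c i s).IsHomogeneous 1 := by
  refine IsHomogeneous.sum _ _ _ fun j _ => ?_
  simpa using (isHomogeneous_C _ _).mul (isHomogeneous_X k j)

theorem aa_hom (c : Fin 2 → Fin (d + 2) → Fin (d + 2) → k) (i s t) : (aa n c i s t).IsHomogeneous 0 :=
  isHomogeneous_C _ _

theorem EE_quad (c : Fin 2 → Fin (d + 2) → Fin (d + 2) → k) (r : Fin 2) :
    EE k d n (rename Sum.inl (∑ s, ∑ t, C (c r s t) * (X s * X t))) = quad (aa n c r) := by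
  rw [quad, ← Equiv.sum_comp finSumFinEquiv, map_sum, map_sum]
  refine Finset.sum_congr rfl fun s _ => ?_
  rw [← Equiv.sum_comp finSumFinEquiv, map_sum, map_sum]
  refine Finset.sum_congr rfl fun t _ => ?_
  simp [EE_inl, EE_C, aa]

theorem EE_lin (c : Fin n → Fin d → Fin (d + 2) → k) (i : Fin d) :
    EE k d n (∑ j, rename Sum.inl (∑ s, C (c j i s) * X s) * X (Sum.inr j)) = ∑ s, C (JJ c i s) * X s := by
  have : ∀ j, EE k d n (rename Sum.inl (∑ s, C (c j i s) * X s) * X (Sum.inr j)) =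
      ∑ s : Fin d ⊕ Fin 2, C (C (c j i (finSumFinEquiv s)) * X j) * X s := by
    intro j
    rw [← Equiv.sum_comp finSumFinEquiv, map_sum, Finset.sum_mul, map_sum]
    refine Finset.sum_congr rfl fun t _ => ?_
    simp [EE_inl, EE_inr, EE_C]
    ring
  rw [map_sum, Finset.sum_congr rfl fun j _ => this j, Finset.sum_comm]
  refine Finset.sum_congr rfl fun s _ => ?_
  rw [JJ, map_sum, Finset.sum_mul]

theorem LL_eq (c : Fin n → Fin d → Fin (d + 2) → k) (cq : Fin 2 → Fin (d + 2) → Fin (d + 2) → k)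
    {f g : MvPolynomial (Fin (d + 2)) k} (hf : f = ∑ s, ∑ t, C (cq 0 s t) * (X s * X t))
    (hg : g = ∑ s, ∑ t, C (cq 1 s t) * (X s * X t))
    (ψ : Matrix (Fin n) (Fin d) (MvPolynomial (Fin (d + 2)) k)) (hψ : ∀ j i, ψ j i = ∑ s, C (c j i s) * X s)
    (ℓ : Fin d → MvPolynomial (Fin (d + 2) ⊕ Fin n) k)
    (hℓ : ∀ i, ℓ i = ∑ j, (rename Sum.inl (ψ j i)) * X (Sum.inr j))
    (L : Ideal (MvPolynomial (Fin (d + 2) ⊕ Fin n) k))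
    (hL : L = Ideal.span (Set.range ℓ ∪ {rename Sum.inl f, rename Sum.inl g})) :
    LL (JJ c) (aa n cq) = L.map (EE k d n) := by
  have h1 : ∀ i, EE k d n (ℓ i) = (gM (JJ c) (FM (aa n cq))).mulVec X (Sum.inl i) := by
    intro i
    rw [hℓ, gM_lin, ← EE_lin]
    simp only [hψ]
  have h2 : EE k d n (rename Sum.inl f) = (gM (JJ c) (FM (aa n cq))).mulVec X (Sum.inr 0) := by
    rw [gM_quad, hf, EE_quad]
  have h3 : EE k d n (rename Sum.inl g) = (gM (JJ c) (FM (aa n cq))).mulVec X (Sum.inr 1) := by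
    rw [gM_quad, hg, EE_quad]
  rw [hL, Ideal.map_span, LL]
  congr 1
  ext x
  constructor
  · rintro ⟨i | i, rfl⟩
    · exact ⟨ℓ i, Or.inl ⟨i, rfl⟩, h1 i⟩
    · fin_cases i
      · exact ⟨_, Or.inr (Or.inl rfl), h2⟩
      · exact ⟨_, Or.inr (Or.inr rfl), h3⟩
  · rintro ⟨y, ⟨i, rfl⟩ | rfl | rfl, rfl⟩
    · exact ⟨_, (h1 i).symm⟩
    · exact ⟨_, h2.symm⟩
    · exact ⟨_, h3.symm⟩

/-- The identification of the bigraded ring with polynomials in `y` over `S`. -/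
def FF (k : Type) [Field k] (d n : ℕ) : MvPolynomial (Fin n) (MvPolynomial (Fin (d + 2)) k) ≃+*
    MvPolynomial (Fin (d + 2) ⊕ Fin n) k :=
  (sumAlgEquiv k (Fin n) (Fin (d + 2))).symm.toRingEquiv.trans
    (renameEquiv k (Equiv.sumComm (Fin n) (Fin (d + 2)))).toRingEquiv

theorem FF_X (j) : FF k d n (X j) = X (Sum.inr j) := by
  simp [FF, sumAlgEquiv_symm_X]

theorem FF_C (p : MvPolynomial (Fin (d + 2)) k) : FF k d n (C p) = rename Sum.inl p := by
  have : ((FF k d n).toRingHom.comp C) = (rename Sum.inl : MvPolynomial (Fin (d + 2)) k →ₐ[k] _).toRingHom := by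
    ext i : 1
    · ext c; simp [FF, sumAlgEquiv_symm_C_C]
    · simp [FF, sumAlgEquiv_symm_C_X]
  exact RingHom.congr_fun this p

theorem HT_of {J : Matrix (Fin d) (Fin d ⊕ Fin 2) (MvPolynomial (Fin n) k)} {a}
    {f g : MvPolynomial (Fin (d + 2)) k}
    (ψ : Matrix (Fin n) (Fin d) (MvPolynomial (Fin (d + 2)) k))
    (ℓ : Fin d → MvPolynomial (Fin (d + 2) ⊕ Fin n) k)
    (hℓ : ∀ i, ℓ i = ∑ j, (rename Sum.inl (ψ j i)) * X (Sum.inr j))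
    (L : Ideal (MvPolynomial (Fin (d + 2) ⊕ Fin n) k))
    (hL : L = Ideal.span (Set.range ℓ ∪ {rename Sum.inl f, rename Sum.inl g}))
    (hLL : LL J a = L.map (EE k d n))
    (H : ∀ Q : Ideal (MvPolynomial (Fin n) (MvPolynomial (Fin (d + 2)) k)), Q.IsPrime →
      (∀ i, ∑ j, C (ψ j i) * X j ∈ Q) → C f ∈ Q → C g ∈ Q → ((d + 2 : ℕ) : ℕ∞) ≤ Q.height) : HT J a := by
  intro Q hQ hle
  have hLQ : ∀ x ∈ L, EE k d n x ∈ Q := fun x hx => hle (hLL ▸ Ideal.mem_map_of_mem _ hx)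
  have hx : ∀ x ∈ Set.range ℓ ∪ {rename Sum.inl f, rename Sum.inl g}, EE k d n x ∈ Q := fun x hx =>
    hLQ x (hL ▸ Ideal.subset_span hx)
  have := H (Q.comap ((FF k d n).trans (EE k d n))) (Ideal.comap_isPrime _ _) (by
    intro i
    rw [Ideal.mem_comap]
    have := hx (ℓ i) (Or.inl ⟨i, rfl⟩)
    rw [hℓ] at this
    simpa [FF_C, FF_X] using this) (by
    rw [Ideal.mem_comap]
    simpa [FF_C] using hx _ (Or.inr (Or.inl rfl))) (by
    rw [Ideal.mem_comap]
    simpa [FF_C] using hx _ (Or.inr (Or.inr rfl)))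
  rwa [RingEquiv.height_comap] at this

end
end
end CI16

namespace CI16
section
section

variable {k : Type} [Field k] {d n : ℕ}

theorem tsmul (L : Ideal (MvPolynomial (Fin (d + 2) ⊕ Fin n) k)) (t : MvPolynomial (Fin n) k) (p : MvPolynomial (Fin (d + 2) ⊕ Fin n) k) :
    (t • (Ideal.Quotient.mk L p) : Stmt16.B k (d + 2) n ⧸ L) = Ideal.Quotient.mk L (rename Sum.inr t * p) := rfl

theorem mem_SxDeg (L : Ideal (Stmt16.B k (d + 2) n)) (j : ℕ) (x) :
    x ∈ Stmt16.SxDeg k (d + 2) n L j ↔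
      ∃ p : Stmt16.B k (d + 2) n, p.IsWeightedHomogeneous (Stmt16.wx (d + 2) n) j ∧ Ideal.Quotient.mk L p = x := by
  constructor
  · intro hx
    induction hx using Submodule.span_induction with
    | mem x h => obtain ⟨p, hp, rfl⟩ := h; exact ⟨p, hp, rfl⟩
    | zero => exact ⟨0, isWeightedHomogeneous_zero _ _ _, map_zero _⟩
    | add x y _ _ hx hy =>
      obtain ⟨p, hp, rfl⟩ := hx
      obtain ⟨q, hq, rfl⟩ := hy
      exact ⟨p + q, hp.add hq, map_add _ _ _⟩
    | smul t x _ hx =>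
      obtain ⟨p, hp, rfl⟩ := hx
      refine ⟨rename Sum.inr t * p, ?_, rfl⟩
      simpa using (rename_wx t).mul hp
  · rintro ⟨p, hp, rfl⟩
    exact Submodule.subset_span ⟨p, hp, rfl⟩

theorem mem_H0 (L : Ideal (Stmt16.B k (d + 2) n)) (p : Stmt16.B k (d + 2) n) :
    Ideal.Quotient.mk L p ∈ Stmt16.H0 k (d + 2) n L ↔ ∃ N, ∀ b ∈ Stmt16.mxB k (d + 2) n ^ N, b * p ∈ L := by
  rw [Stmt16.H0, Submodule.mem_iSup_of_directed]
  · refine exists_congr fun N => ?_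
    rw [Submodule.mem_torsionBySet_iff]
    constructor
    · intro h b hb
      have := h ⟨b, hb⟩
      rw [← Ideal.Quotient.eq_zero_iff_mem]
      exact this
    · rintro h ⟨b, hb⟩
      exact Ideal.Quotient.eq_zero_iff_mem.2 (h b hb)
  · refine Monotone.directed_le fun a b hab => ?_
    exact Submodule.torsionBySet_le_torsionBySet_of_subset (Ideal.pow_le_pow_right hab)

theorem mxB_map : (Stmt16.mxB k (d + 2) n).map (EE k d n) = idealOfVars (Fin d ⊕ Fin 2) (MvPolynomial (Fin n) k) := by
  rw [Stmt16.mxB, Ideal.map_span, idealOfVars]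
  congr 1
  ext x
  constructor
  · rintro ⟨_, ⟨i, rfl⟩, rfl⟩
    exact ⟨_, (EE_inl i).symm⟩
  · rintro ⟨i, rfl⟩
    refine ⟨_, ⟨finSumFinEquiv i, rfl⟩, ?_⟩
    rw [EE_inl]; simp

theorem mem_map_EE (I : Ideal (MvPolynomial (Fin (d + 2) ⊕ Fin n) k)) (x) : EE k d n x ∈ I.map (EE k d n) ↔ x ∈ I := by
  rw [Ideal.mem_map_of_equiv]
  constructor
  · rintro ⟨y, hy, h⟩
    exact (EE k d n).injective h ▸ hy
  · intro h; exact ⟨x, h, rfl⟩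

theorem Tor_iff {J : Matrix (Fin d) (Fin d ⊕ Fin 2) (MvPolynomial (Fin n) k)} {a} {L : Ideal (Stmt16.B k (d + 2) n)}
    (hLL : LL J a = L.map (EE k d n)) (t : MvPolynomial (Fin n) k) (N : ℕ) :
    (∀ b ∈ Stmt16.mxB k (d + 2) n ^ N, b * rename Sum.inr t ∈ L) ↔ Tor J a t N := by
  have hmm : (Stmt16.mxB k (d + 2) n ^ N).map (EE k d n) =
      Ideal.span ((fun m => monomial m 1) '' (Finsupp.degree ⁻¹' {N})) := by
    rw [Ideal.map_pow, mxB_map, pow_idealOfVars_eq_span]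
  constructor
  · intro h μ hμ
    have h1 : (monomial μ 1 : MvPolynomial (Fin d ⊕ Fin 2) (MvPolynomial (Fin n) k)) ∈ (Stmt16.mxB k (d + 2) n ^ N).map (EE k d n) := by
      rw [hmm]; exact Ideal.subset_span ⟨μ, hμ, rfl⟩
    rw [Ideal.mem_map_of_equiv] at h1
    obtain ⟨b, hb, hbe⟩ := h1
    have := (mem_map_EE L _).2 (h b hb)
    rw [_root_.map_mul, EE_rename, hbe, mul_comm, C_mul_monomial, mul_one, ← hLL] at this
    exact this
  · intro h b hb
    rw [← mem_map_EE, _root_.map_mul, EE_rename, ← hLL]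
    have h1 := Ideal.mem_map_of_mem (EE k d n) hb
    rw [hmm] at h1
    revert h1
    generalize EE k d n b = x
    intro h1
    induction h1 using Submodule.span_induction with
    | mem x h' =>
      obtain ⟨μ, hμ, rfl⟩ := h'
      have := h μ hμ
      rw [mul_comm, C_mul_monomial, mul_one]
      exact this
    | zero => simp
    | add x y _ _ hx hy => rw [add_mul]; exact Ideal.add_mem _ hx hy
    | smul t x _ hx => rw [smul_eq_mul, mul_assoc]; exact Ideal.mul_mem_left _ _ hx

theorem mem_A0 {J : Matrix (Fin d) (Fin d ⊕ Fin 2) (MvPolynomial (Fin n) k)} {a} {L : Ideal (Stmt16.B k (d + 2) n)}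
    (hLL : LL J a = L.map (EE k d n)) (x) :
    x ∈ Stmt16.AcompZ k (d + 2) n L 0 ↔
      ∃ t : MvPolynomial (Fin n) k, (∃ N, Tor J a t N) ∧ Ideal.Quotient.mk L (rename Sum.inr t) = x := by
  rw [Stmt16.AcompZ, Submodule.mem_inf, Submodule.restrictScalars_mem, Stmt16.SxDegZ, if_pos le_rfl, Int.toNat_zero, mem_SxDeg]
  constructor
  · rintro ⟨h, p, hp, rfl⟩
    have h0 := (totalDegree_zero_iff_isHomogeneous _).2 (EE_hom hp)
    rw [totalDegree_eq_zero_iff_eq_C] at h0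
    have hpt : p = rename Sum.inr (coeff 0 (EE k d n p)) := by
      apply (EE k d n).injective
      rw [EE_rename]; exact h0
    rw [mem_H0] at h
    refine ⟨coeff 0 (EE k d n p), ?_, by rw [← hpt]⟩
    obtain ⟨N, hN⟩ := h
    refine ⟨N, (Tor_iff hLL _ N).1 ?_⟩
    rw [← hpt]; exact hN
  · rintro ⟨t, ⟨N, hN⟩, rfl⟩
    exact ⟨(mem_H0 L _).2 ⟨N, (Tor_iff hLL _ N).2 hN⟩, _, rename_wx t, rfl⟩

theorem A0_span {J : Matrix (Fin d) (Fin d ⊕ Fin 2) (MvPolynomial (Fin n) k)} {a} {L : Ideal (Stmt16.B k (d + 2) n)}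
    (hLL : LL J a = L.map (EE k d n)) {z : MvPolynomial (Fin n) k} (hz : ∀ t, (∃ N, Tor J a t N) ↔ z ∣ t) :
    Stmt16.AcompZ k (d + 2) n L 0 = Submodule.span (Stmt16.T k n) {Ideal.Quotient.mk L (rename Sum.inr z)} := by
  ext x
  rw [mem_A0 hLL, Submodule.mem_span_singleton]
  constructor
  · rintro ⟨t, ht, rfl⟩
    obtain ⟨u, rfl⟩ := (hz t).1 ht
    exact ⟨u, by rw [tsmul, mul_comm z, _root_.map_mul (rename Sum.inr)]⟩
  · rintro ⟨u, rfl⟩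
    refine ⟨z * u, (hz _).2 (dvd_mul_right _ _), ?_⟩
    rw [tsmul, mul_comm z, _root_.map_mul]

theorem rename_bwt {z : MvPolynomial (Fin n) k} {m : ℕ} (hz : z.IsHomogeneous m) :
    (rename Sum.inr z : Stmt16.B k (d + 2) n) ∈ weightedHomogeneousSubmodule k (Stmt16.bwt (d + 2) n) (0, m) := by
  rw [mem_weightedHomogeneousSubmodule, z.as_sum, map_sum]
  refine IsWeightedHomogeneous.sum _ _ _ fun μ hμ => ?_
  rw [rename_monomial]
  apply isWeightedHomogeneous_monomial
  have h := hz (mem_support_iff.1 hμ)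
  rw [Finsupp.weight_apply] at h
  rw [Finsupp.weight_apply, Finsupp.sum_mapDomain_index (by simp) (by simp [add_mul])]
  rw [← h]
  simp only [Stmt16.bwt, Sum.elim_inr, Finsupp.sum]
  ext
  · simp [Prod.fst_sum]
  · simp [Prod.snd_sum]

theorem part2 (hn : 1 ≤ n) (hd : 1 ≤ d)
    {J : Matrix (Fin d) (Fin d ⊕ Fin 2) (MvPolynomial (Fin n) k)} {a} (hT : HT J a)
    (hJ : ∀ i s, (J i s).IsHomogeneous 1) (ha : ∀ i s u, (a i s u).IsHomogeneous 0)
    {L : Ideal (Stmt16.B k (d + 2) n)}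
    (hLL : LL J a = L.map (EE k d n))
    {ι κ : Type} [Fintype ι] [Fintype κ] [DecidableEq ι] [DecidableEq κ] (ρ : Matrix ι κ (MvPolynomial (Fin n) k))
    (πρ : (ι → MvPolynomial (Fin n) k) →ₗ[MvPolynomial (Fin n) k] Stmt16.SxDeg k (d + 2) n L 2) (hs : Function.Surjective πρ) (hk : LinearMap.ker πρ = LinearMap.range ρ.mulVecLin)
    (hD : Stmt16.htGE (Stmt16.minorsIdeal ρ ρ.rank) 2) :
    ∃ z : MvPolynomial (Fin n) k, z.IsHomogeneous (4 * d) ∧ ∀ t, (∃ N, Tor J a t N) ↔ z ∣ t := by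
  let q : (Stmt16.B k (d + 2) n ⧸ L) ≃+* (MvPolynomial (Fin d ⊕ Fin 2) (MvPolynomial (Fin n) k) ⧸ LL J a) :=
    Ideal.quotientEquiv L (LL J a) (EE k d n) hLL
  have hq : ∀ p, q (Ideal.Quotient.mk L p) = Ideal.Quotient.mk _ (EE k d n p) := fun p => rfl
  refine main_two hn hd hT hJ ha (N := Stmt16.SxDeg k (d + 2) n L 2)
    (q.toAddEquiv.toAddMonoidHom.comp (Stmt16.SxDeg k (d + 2) n L 2).toAddSubgroup.subtype) ?_ ?_ ?_ ρ πρ hs hk ?_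
  · rintro t ⟨x, hx⟩
    obtain ⟨p, rfl⟩ := Ideal.Quotient.mk_surjective x
    show q (t • Ideal.Quotient.mk L p) = _ * q (Ideal.Quotient.mk L p)
    rw [tsmul, hq, hq, _root_.map_mul, EE_rename, _root_.map_mul]
  · intro x y h
    exact Subtype.ext (q.injective h)
  · intro z
    constructor
    · rintro ⟨⟨x, hx⟩, rfl⟩
      obtain ⟨p, hp, rfl⟩ := (mem_SxDeg L 2 x).1 hx
      exact ⟨_, EE_hom hp, rfl⟩
    · rintro ⟨p, hp, rfl⟩
      refine ⟨⟨Ideal.Quotient.mk L ((EE k d n).symm p), (mem_SxDeg L 2 _).2 ⟨_, EE_symm_hom hp, rfl⟩⟩, ?_⟩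
      show q (Ideal.Quotient.mk L ((EE k d n).symm p)) = _
      rw [hq, RingEquiv.apply_symm_apply]
  · intro p hp hle
    have := hD p hp (Ideal.span_le.2 hle)
    rw [IsLocalization.AtPrime.ringKrullDim_eq_height p] at this
    exact WithBot.coe_le_coe.1 this

end
end
end CI16

namespace Stmt16

variable (k : Type) [Field k] (d n : ℕ)

variable (I : Ideal (B k d n))

set_option synthInstance.maxHeartbeats 1000000
set_option maxHeartbeats 3000000

theorem ci_A0_generator
    (d e : ℕ) (hd : 2 ≤ d)
    -- `f, g`: a homogeneous `S`-regular sequence of quadrics in `S = k[x_1,…,x_{d+2}]`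
    (f g : MvPolynomial (Fin (d + 2)) k)
    (hf : f ∈ homogeneousSubmodule (Fin (d + 2)) k 2)
    (hg : g ∈ homogeneousSubmodule (Fin (d + 2)) k 2)
    (hfg : RingTheory.Sequence.IsRegular (MvPolynomial (Fin (d + 2)) k) [f, g])
    -- `E`: a module over `R = S/(f,g)`
    (E : Type) [AddCommGroup E]
    [Module (MvPolynomial (Fin (d + 2)) k ⧸
      (Ideal.span {f, g} : Ideal (MvPolynomial (Fin (d + 2)) k))) E]
    [Module.Finite (MvPolynomial (Fin (d + 2)) k ⧸
      (Ideal.span {f, g} : Ideal (MvPolynomial (Fin (d + 2)) k))) E]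
    -- `E` is torsion-free
    (htf : Submodule.torsion (MvPolynomial (Fin (d + 2)) k ⧸
      (Ideal.span {f, g} : Ideal (MvPolynomial (Fin (d + 2)) k))) E = ⊥)
    -- `ψ`: the matrix of linear forms over `S` lifting the presentation matrix `φ`
    (ψ : Matrix (Fin (d + e)) (Fin d) (MvPolynomial (Fin (d + 2)) k))
    (hψlin : ∀ i j, ψ i j ∈ homogeneousSubmodule (Fin (d + 2)) k 1)
    (φ : Matrix (Fin (d + e)) (Fin d) (MvPolynomial (Fin (d + 2)) k ⧸
      (Ideal.span {f, g} : Ideal (MvPolynomial (Fin (d + 2)) k))))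
    (hφψ : ∀ i j, φ i j = Ideal.Quotient.mk _ (ψ i j))
    -- `0 → R^d →φ R^{d+e} →π E → 0` is a (minimal) free resolution, so `pd_R E = 1`
    -- and `rank E = e`
    (hinj : Function.Injective φ.mulVecLin)
    (π : (Fin (d + e) → (MvPolynomial (Fin (d + 2)) k ⧸
        (Ideal.span {f, g} : Ideal (MvPolynomial (Fin (d + 2)) k)))) →ₗ[MvPolynomial (Fin (d + 2)) k ⧸
        (Ideal.span {f, g} : Ideal (MvPolynomial (Fin (d + 2)) k))] E)
    (hsurj : Function.Surjective π)
    (hker : LinearMap.ker π = LinearMap.range φ.mulVecLin)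
    -- `I_1(φ) = (x_1,…,x_{d+2})R`
    (hI1 : Ideal.span {r | ∃ i j, φ i j = r} =
      Ideal.span (Set.range fun t : Fin (d + 2) => Ideal.Quotient.mk _ (X t)))
    -- `E` is minimally generated by `μ(E) = d+e` elements
    (hμ : ∀ s : Finset E,
      Submodule.span (MvPolynomial (Fin (d + 2)) k ⧸
        (Ideal.span {f, g} : Ideal (MvPolynomial (Fin (d + 2)) k))) (s : Set E) = ⊤ →
      d + e ≤ s.card)
    -- `E` satisfies `G_d`
    (hGd : ∀ (p : Ideal (MvPolynomial (Fin (d + 2)) k ⧸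
        (Ideal.span {f, g} : Ideal (MvPolynomial (Fin (d + 2)) k)))) (_ : p.IsPrime) (c : ℕ),
      ringKrullDim (Localization.AtPrime p) = (c : WithBot ℕ∞) → 1 ≤ c → c ≤ d - 1 →
      ∃ s : Finset (LocalizedModule p.primeCompl E), s.card ≤ c + e - 1 ∧
        Submodule.span (Localization.AtPrime p)
          (s : Set (LocalizedModule p.primeCompl E)) = ⊤)
    -- the defining ideal `L = (ℓ_1,…,ℓ_d,f,g)` of `S(E)` as a quotient of
    -- `B = S ⊗_k T`, with `[ℓ_1 … ℓ_d] = [y_1 … y_{d+e}]·ψ`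
    (ℓ : Fin d → B k (d + 2) (d + e))
    (hℓ : ∀ i, ℓ i = ∑ j, (rename Sum.inl (ψ j i)) * X (Sum.inr j))
    (L : Ideal (B k (d + 2) (d + e)))
    (hL : L = Ideal.span (Set.range ℓ ∪ {rename Sum.inl f, rename Sum.inl g}))
    -- `ρ`: a matrix over `T` presenting the `T`-module `S(E)_2`
    (ι κ : Type) [Fintype ι] [Fintype κ] [DecidableEq ι] [DecidableEq κ]
    (ρ : Matrix ι κ (T k (d + e)))
    (hρ : ∃ πρ : (ι → T k (d + e)) →ₗ[T k (d + e)] (SxDeg k (d + 2) (d + e) L 2),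
      Function.Surjective πρ ∧ LinearMap.ker πρ = LinearMap.range ρ.mulVecLin) :
    -- `A_0` is a principal ideal of `T` (a cyclic `T`-submodule of `S(E)_0 ≅ T`)
    (∃ z : B k (d + 2) (d + e) ⧸ L,
      AcompZ k (d + 2) (d + e) L 0 = Submodule.span (T k (d + e)) {z}) ∧
    -- if `ht I(ρ) ≥ 2` the generator has bidegree `(0, 4d)`
    (htGE (minorsIdeal ρ ρ.rank) 2 →
      ∃ gA : B k (d + 2) (d + e),
        gA ∈ weightedHomogeneousSubmodule k (bwt (d + 2) (d + e)) (0, 4 * d) ∧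
        AcompZ k (d + 2) (d + e) L 0 =
          Submodule.span (T k (d + e)) {Ideal.Quotient.mk L gA}) := by
  choose c hc using fun j i => CI16.lin_form ((mem_homogeneousSubmodule _ _).1 (hψlin j i))
  obtain ⟨cf, hcf⟩ := CI16.quad_form ((mem_homogeneousSubmodule _ _).1 hf)
  obtain ⟨cg, hcg⟩ := CI16.quad_form ((mem_homogeneousSubmodule _ _).1 hg)
  have hLL := CI16.LL_eq c ![cf, cg] hcf hcg ψ hc ℓ hℓ L hL
  have hT := CI16.HT_of ψ ℓ hℓ L hL hLL (fun Q hQ h1 h2 h3 =>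
    CI16.height_all hfg _ rfl hd ψ φ hφψ hinj π hsurj hker hGd Q h1 h2 h3)
  constructor
  · obtain ⟨z, hz⟩ := CI16.main_one (by omega) hT
    exact ⟨_, CI16.A0_span hLL hz⟩
  · intro hD
    obtain ⟨πρ, hs, hk⟩ := hρ
    obtain ⟨z, hz, hz'⟩ := CI16.part2 (by omega) (by omega) hT (CI16.JJ_hom c) (CI16.aa_hom _) hLL ρ πρ hs hk hD
    exact ⟨_, CI16.rename_bwt hz, CI16.A0_span hLL hz'⟩

end Stmt16
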